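/- arXiv:1806.06199 — 2 statements merged into one kernel-verified Lean document; each statement's English description precedes it below -/
import Mathlib

section
/- Let k ≥ 3, m ≥ 1 and n_1, …, n_m ≥ 1. Then 0 is an eigenvalue of the starlike hypergraph S^k_{n_1,…,n_m}, and a nonzero complex number λ is an eigenvalue of S^k_{n_1,…,n_m} if and only if either (a) M_s(λ^k) = 0 for some i ∈ {1,…,m} and some s with 1 ≤ s ≤ n_i − 1, or (b) there exist s_i ∈ {0, 1, …, n_i} (i = 1, …, m) such that M_{s_i−1}(λ^k) ≠ 0 for every i and λ^k · ∏_{i=1}^m M_{s_i−1}(λ^k) = ∑_{i=1}^m N_{s_i−1}(λ^k) · ∏_{j≠i} M_{s_j−1}(λ^k). -/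
open Finset

/-- `λ` is an eigenvalue of the `k`-uniform hypergraph with vertex type `V` and
edge set `E`. -/
def IsEigenvalue {V : Type*} [Fintype V] [DecidableEq V] (k : ℕ)
    (E : Finset (Finset V)) (lam : ℂ) : Prop :=
  ∃ x : V → ℂ, x ≠ 0 ∧ ∀ v : V,
    ∑ e ∈ E.filter (fun e => v ∈ e), ∏ u ∈ e.erase v, x u = lam * (x v) ^ (k - 1)

/-- The vertex type of the starlike hypergraph `S^k_{n_1,…,n_m}`:
`none` is the common vertex `w`, and `some ⟨i, u⟩` is the vertex `(i, u+1)`. -/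
abbrev StarVertex (k m : ℕ) (n : Fin m → ℕ) : Type :=
  Option ((i : Fin m) × Fin (n i * (k - 1)))

/-- The edge `e_{i,t}` of the starlike hypergraph: it consists of the vertices
`(i, v)` with `(t-1)(k-1) ≤ v ≤ t(k-1)`, where `(i, 0)` is the common vertex `w`
(so `w ∈ e_{i,t}` exactly when `t = 1`). -/
def starEdge (k : ℕ) {m : ℕ} (n : Fin m → ℕ) (i : Fin m) (t : ℕ) :
    Finset (StarVertex k m n) :=
  ((Finset.univ.filter (fun p : (j : Fin m) × Fin (n j * (k - 1)) =>
      p.1 = i ∧ (t - 1) * (k - 1) ≤ p.2.val + 1 ∧ p.2.val + 1 ≤ t * (k - 1))).image some)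
    ∪ (if t = 1 then {none} else ∅)

/-- The edge set of the starlike hypergraph `S^k_{n_1,…,n_m}`. -/
def starEdges (k : ℕ) {m : ℕ} (n : Fin m → ℕ) :
    Finset (Finset (StarVertex k m n)) :=
  Finset.univ.biUnion (fun i : Fin m => (Finset.Icc 1 (n i)).image (starEdge k n i))

/-- The polynomials `M_s`, evaluated: `M_0 = 1`, `M_1 = t - 1`,
`M_s = t·(M_{s-1} - M_{s-2})` for `s ≥ 2`. -/
noncomputable def Mpoly : ℕ → ℂ → ℂ
  | 0, _ => 1
  | 1, z => z - 1
  | (s + 2), z => z * (Mpoly (s + 1) z - Mpoly s z)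

/-- `Mpred s z = M_{s-1}(z)`, with `M_{-1} = 1`. -/
noncomputable def Mpred (s : ℕ) (z : ℂ) : ℂ :=
  if s = 0 then 1 else Mpoly (s - 1) z

/-- `Npred s z = N_{s-1}(z)`, where `N_{-1} = 0`, `N_0 = 1`, and
`N_s = t·M_{s-1}` for `s ≥ 1`. -/
noncomputable def Npred (s : ℕ) (z : ℂ) : ℂ :=
  if s = 0 then 0 else if s = 1 then 1 else z * Mpoly (s - 2) z


section Combinatorics

variable {k m : ℕ} {n : Fin m → ℕ}

/-- The vertex `(i, j)` of the starlike hypergraph, where `(i, 0)` is the common vertex. -/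
def legVertex (k : ℕ) {m : ℕ} (n : Fin m → ℕ) (i : Fin m) (j : ℕ) : StarVertex k m n :=
  if h : 1 ≤ j ∧ j - 1 < n i * (k - 1) then some ⟨i, ⟨j - 1, h.2⟩⟩ else none

lemma legVertex_zero (i : Fin m) : legVertex k n i 0 = none := by
  simp [legVertex]

lemma legVertex_succ (i : Fin m) (u : Fin (n i * (k - 1))) :
    legVertex k n i (u + 1) = some ⟨i, u⟩ := by
  simp [legVertex]

lemma legVertex_injOn (i : Fin m) : Set.InjOn (legVertex k n i) (Set.Iic (n i * (k - 1))) := by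
  intro a ha b hb h
  rcases a with _ | a <;> rcases b with _ | b
  · rfl
  · rw [legVertex_zero, legVertex_succ i ⟨b, hb⟩] at h
    simp at h
  · rw [legVertex_zero, legVertex_succ i ⟨a, ha⟩] at h
    simp at h
  · rw [legVertex_succ i ⟨a, ha⟩, legVertex_succ i ⟨b, hb⟩] at h
    simp only [Option.some.injEq, Sigma.mk.injEq, heq_eq_eq, true_and] at h
    rw [show a = b from congrArg Fin.val h]

lemma some_mem_starEdge (i i' : Fin m) (u : Fin (n i * (k - 1))) (t : ℕ) :
    some ⟨i, u⟩ ∈ starEdge k n i' (t + 1) ↔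
      i = i' ∧ t * (k - 1) ≤ u.val + 1 ∧ u.val + 1 ≤ (t + 1) * (k - 1) := by
  unfold starEdge
  split_ifs <;> simp

lemma none_mem_starEdge (i : Fin m) (t : ℕ) :
    none ∈ starEdge k n i (t + 1) ↔ t = 0 := by
  unfold starEdge
  split_ifs with h <;> simp at h ⊢ <;> exact h

lemma legVertex_mem_starEdge (i i' : Fin m) {j : ℕ} (hj : 1 ≤ j) (hj' : j ≤ n i * (k - 1))
    (t : ℕ) : legVertex k n i j ∈ starEdge k n i' (t + 1) ↔
      i = i' ∧ t * (k - 1) ≤ j ∧ j ≤ (t + 1) * (k - 1) := by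
  obtain ⟨j, rfl⟩ : ∃ l, j = l + 1 := ⟨j - 1, by omega⟩
  rw [legVertex_succ i ⟨j, hj'⟩, some_mem_starEdge]

lemma succ_mul_le_mul {a t d : ℕ} (h : t < a) : (t + 1) * d ≤ a * d :=
  Nat.mul_le_mul_right d h

lemma starEdge_eq_image (hk : 3 ≤ k) (i : Fin m) {t : ℕ} (ht : t < n i) :
    starEdge k n i (t + 1) =
      (Icc (t * (k - 1)) ((t + 1) * (k - 1))).image (legVertex k n i) := by
  have hle : (t + 1) * (k - 1) ≤ n i * (k - 1) := succ_mul_le_mul ht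
  ext v
  rcases v with _ | ⟨i', u⟩
  · rw [none_mem_starEdge]
    simp only [mem_image, mem_Icc]
    constructor
    · rintro rfl
      exact ⟨0, by simp, legVertex_zero i⟩
    · rintro ⟨j, ⟨h1, h2⟩, h3⟩
      have := legVertex_injOn i (show j ∈ Set.Iic (n i * (k - 1)) from h2.trans hle)
        (show 0 ∈ Set.Iic (n i * (k - 1)) from Nat.zero_le _) (h3.trans (legVertex_zero i).symm)
      subst this
      rcases Nat.mul_eq_zero.1 (Nat.le_zero.1 h1) with h | h <;> omega
  · rw [some_mem_starEdge]
    simp only [mem_image, mem_Icc]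
    constructor
    · rintro ⟨rfl, h1, h2⟩
      exact ⟨u + 1, ⟨h1, h2⟩, legVertex_succ _ u⟩
    · rintro ⟨j, ⟨h1, h2⟩, h3⟩
      rcases j with _ | j
      · simp [legVertex_zero] at h3
      · rw [legVertex_succ i ⟨j, by omega⟩] at h3
        simp only [Option.some.injEq, Sigma.mk.injEq] at h3
        obtain ⟨rfl, h3⟩ := h3
        rw [heq_eq_eq] at h3
        subst h3
        exact ⟨rfl, h1, h2⟩

lemma starEdge_inj (hk : 3 ≤ k) {i i' : Fin m} {t t' : ℕ} (ht : t < n i) (ht' : t' < n i')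
    (h : starEdge k n i (t + 1) = starEdge k n i' (t' + 1)) : i = i' ∧ t = t' := by
  have key : ∀ {i i' : Fin m} {t t' : ℕ}, t < n i →
      starEdge k n i (t + 1) = starEdge k n i' (t' + 1) → i = i' ∧ t ≤ t' := by
    intro i i' t t' ht h
    have hpos : 1 ≤ (t + 1) * (k - 1) := Nat.mul_pos (by omega) (by omega)
    have hle : (t + 1) * (k - 1) ≤ n i * (k - 1) := succ_mul_le_mul ht
    have h1 := (legVertex_mem_starEdge i i hpos hle t).2
      ⟨rfl, Nat.mul_le_mul_right _ (by omega), le_rfl⟩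
    rw [h, legVertex_mem_starEdge i i' hpos hle] at h1
    have := Nat.le_of_mul_le_mul_right h1.2.2 (show 0 < k - 1 by omega)
    exact ⟨h1.1, by omega⟩
  exact ⟨(key ht h).1, le_antisymm (key ht h).2 (key ht' h.symm).2⟩

lemma sum_edges_mem (hk : 3 ≤ k) (v : StarVertex k m n) (F : Finset (StarVertex k m n) → ℂ) :
    ∑ e ∈ (starEdges k n).filter (fun e => v ∈ e), F e =
      ∑ i, ∑ t ∈ range (n i),
        if v ∈ starEdge k n i (t + 1) then F (starEdge k n i (t + 1)) else 0 := by
  have himg : ∀ i, (Icc 1 (n i)).image (starEdge k n i) =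
      (range (n i)).image (fun t => starEdge k n i (t + 1)) := by
    intro i
    ext e
    simp only [mem_image, mem_Icc, mem_range]
    constructor
    · rintro ⟨t, ht, rfl⟩
      exact ⟨t - 1, by omega, by rw [Nat.sub_add_cancel ht.1]⟩
    · rintro ⟨t, ht, rfl⟩
      exact ⟨t + 1, by omega, rfl⟩
  rw [sum_filter, starEdges, sum_biUnion]
  · refine sum_congr rfl fun i _ => ?_
    rw [himg, sum_image]
    intro t ht t' ht' h
    exact (starEdge_inj hk (by simpa using ht) (by simpa using ht') h).2
  · intro i _ i' _ hne
    simp only [Function.onFun]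
    rw [himg, himg, disjoint_left]
    intro e he he'
    simp only [mem_image, mem_range] at he he'
    obtain ⟨t, ht, rfl⟩ := he
    obtain ⟨t', ht', h⟩ := he'
    exact hne (starEdge_inj hk ht' ht h).1.symm

lemma sum_edges_center (hk : 3 ≤ k) (hn : ∀ i, 1 ≤ n i)
    (F : Finset (StarVertex k m n) → ℂ) :
    ∑ e ∈ (starEdges k n).filter (fun e => none ∈ e), F e = ∑ i, F (starEdge k n i 1) := by
  rw [sum_edges_mem hk]
  refine sum_congr rfl fun i _ => ?_
  simp only [none_mem_starEdge]
  rw [sum_ite_eq' (range (n i)) 0 (fun t => F (starEdge k n i (t + 1)))]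
  simp [Nat.pos_iff_ne_zero.1 (hn i)]

lemma sum_edges_leg (hk : 3 ≤ k) (i : Fin m) {j : ℕ} (hj : 1 ≤ j) (hj' : j ≤ n i * (k - 1))
    (F : Finset (StarVertex k m n) → ℂ) :
    ∑ e ∈ (starEdges k n).filter (fun e => legVertex k n i j ∈ e), F e =
      ∑ t ∈ range (n i), if t * (k - 1) ≤ j ∧ j ≤ (t + 1) * (k - 1) then
        F (starEdge k n i (t + 1)) else 0 := by
  rw [sum_edges_mem hk, sum_eq_single i]
  · refine sum_congr rfl fun t _ => ?_
    simp only [legVertex_mem_starEdge i i hj hj', true_and]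
  · intro i' _ hne
    refine sum_eq_zero fun t _ => ?_
    rw [if_neg]
    rw [legVertex_mem_starEdge i i' hj hj']
    exact fun h => hne h.1.symm
  · simp

lemma sum_edges_interior (hk : 3 ≤ k) (i : Fin m) {t j : ℕ} (ht : t < n i)
    (hj : j ∈ Ioo (t * (k - 1)) ((t + 1) * (k - 1))) (F : Finset (StarVertex k m n) → ℂ) :
    ∑ e ∈ (starEdges k n).filter (fun e => legVertex k n i j ∈ e), F e =
      F (starEdge k n i (t + 1)) := by
  rw [mem_Ioo] at hj
  have hle : (t + 1) * (k - 1) ≤ n i * (k - 1) := succ_mul_le_mul ht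
  rw [sum_edges_leg hk i (by omega) (by omega)]
  have : ∀ t', (t' * (k - 1) ≤ j ∧ j ≤ (t' + 1) * (k - 1)) ↔ t' = t := by
    intro t'
    constructor
    · rintro ⟨h1, h2⟩
      have a1 := Nat.lt_of_mul_lt_mul_right (h1.trans_lt hj.2)
      have a2 := Nat.lt_of_mul_lt_mul_right (hj.1.trans_le h2)
      omega
    · rintro rfl
      exact ⟨hj.1.le, hj.2.le⟩
  simp only [this]
  rw [sum_ite_eq' (range (n i)) t (fun t => F (starEdge k n i (t + 1)))]
  simp [ht]

lemma sum_edges_joint (hk : 3 ≤ k) (i : Fin m) {t : ℕ} (ht : t < n i)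
    (F : Finset (StarVertex k m n) → ℂ) :
    ∑ e ∈ (starEdges k n).filter (fun e => legVertex k n i ((t + 1) * (k - 1)) ∈ e), F e =
      F (starEdge k n i (t + 1)) +
        if t + 1 < n i then F (starEdge k n i (t + 2)) else 0 := by
  have hle : (t + 1) * (k - 1) ≤ n i * (k - 1) := succ_mul_le_mul ht
  have hpos : 0 < k - 1 := by omega
  rw [sum_edges_leg hk i (Nat.mul_pos (by omega) hpos) hle]
  have : ∀ t' ∈ range (n i), (if t' * (k - 1) ≤ (t + 1) * (k - 1) ∧
        (t + 1) * (k - 1) ≤ (t' + 1) * (k - 1) then F (starEdge k n i (t' + 1)) else 0) =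
      (if t' = t then F (starEdge k n i (t' + 1)) else 0) +
        (if t' = t + 1 then F (starEdge k n i (t' + 1)) else 0) := by
    intro t' _
    simp only [Nat.mul_le_mul_right_iff hpos]
    by_cases h1 : t' = t
    · simp [h1]
    · by_cases h2 : t' = t + 1
      · simp [h2]
      · rw [if_neg (by omega), if_neg h1, if_neg h2, add_zero]
  rw [sum_congr rfl this, sum_add_distrib,
    sum_ite_eq' (range (n i)) t (fun t => F (starEdge k n i (t + 1))),
    sum_ite_eq' (range (n i)) (t + 1) (fun t => F (starEdge k n i (t + 1)))]
  simp [ht]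

/-- Every vertex is the center, interior to an edge, or the far end of an edge. -/
lemma vertex_cases (hk : 3 ≤ k) {P : StarVertex k m n → Prop} (center : P none)
    (interior : ∀ i t j, t < n i → j ∈ Ioo (t * (k - 1)) ((t + 1) * (k - 1)) →
      P (legVertex k n i j))
    (joint : ∀ i t, t < n i → P (legVertex k n i ((t + 1) * (k - 1)))) (v) : P v := by
  rcases v with _ | ⟨i, u⟩
  · exact center
  · rw [← legVertex_succ]
    have hpos : 0 < k - 1 := by omega
    have h1 := Nat.div_mul_le_self u.val (k - 1)
    have h2 : u.val < (u.val / (k - 1) + 1) * (k - 1) :=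
      (Nat.div_lt_iff_lt_mul hpos).1 (Nat.lt_succ_self _)
    have ht : u.val / (k - 1) < n i := by
      rw [Nat.div_lt_iff_lt_mul hpos]; exact u.2
    rcases Nat.lt_or_ge (u.val + 1) ((u.val / (k - 1) + 1) * (k - 1)) with h | h
    · exact interior i _ _ ht (mem_Ioo.2 ⟨by omega, h⟩)
    · have : u.val + 1 = (u.val / (k - 1) + 1) * (k - 1) := le_antisymm h2 h
      rw [this]
      exact joint i _ ht

lemma prod_starEdge_erase (hk : 3 ≤ k) (i : Fin m) {t j : ℕ} (ht : t < n i)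
    (hj : j ∈ Icc (t * (k - 1)) ((t + 1) * (k - 1))) (x : StarVertex k m n → ℂ) :
    ∏ u ∈ (starEdge k n i (t + 1)).erase (legVertex k n i j), x u =
      ∏ l ∈ (Icc (t * (k - 1)) ((t + 1) * (k - 1))).erase j, x (legVertex k n i l) := by
  have hle : (t + 1) * (k - 1) ≤ n i * (k - 1) := succ_mul_le_mul ht
  have hinj : Set.InjOn (legVertex k n i) (Icc (t * (k - 1)) ((t + 1) * (k - 1))) :=
    (legVertex_injOn i).mono fun l hl => (mem_Icc.1 (mem_coe.1 hl)).2.trans hle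
  have : (starEdge k n i (t + 1)).erase (legVertex k n i j) =
      ((Icc (t * (k - 1)) ((t + 1) * (k - 1))).erase j).image (legVertex k n i) := by
    rw [starEdge_eq_image hk i ht]
    ext v
    simp only [mem_erase, mem_image]
    constructor
    · rintro ⟨h, l, hl, rfl⟩
      exact ⟨l, ⟨fun h' => h (by rw [h']), hl⟩, rfl⟩
    · rintro ⟨l, ⟨h, hl⟩, rfl⟩
      exact ⟨fun h' => h (hinj hl hj h'), l, hl, rfl⟩
  rw [this, prod_image]
  exact hinj.mono (by simp)

lemma Icc_eq_insert_insert_Ioo {a b : ℕ} (h : a < b) : Icc a b = insert a (insert b (Ioo a b)) := by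
  ext l
  simp only [mem_Icc, mem_insert, mem_Ioo]
  omega

lemma prod_starEdge (hk : 3 ≤ k) (i : Fin m) {t : ℕ} (ht : t < n i)
    (x : StarVertex k m n → ℂ) :
    ∏ u ∈ starEdge k n i (t + 1), x u =
      x (legVertex k n i (t * (k - 1))) * (x (legVertex k n i ((t + 1) * (k - 1))) *
        ∏ l ∈ Ioo (t * (k - 1)) ((t + 1) * (k - 1)), x (legVertex k n i l)) := by
  have hle : (t + 1) * (k - 1) ≤ n i * (k - 1) := succ_mul_le_mul ht
  have hlt : t * (k - 1) < (t + 1) * (k - 1) := Nat.mul_lt_mul_of_pos_right (by omega) (by omega)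
  rw [starEdge_eq_image hk i ht, prod_image, Icc_eq_insert_insert_Ioo hlt, prod_insert,
    prod_insert]
  · simp
  · simp [hlt.ne]
  · exact (legVertex_injOn i).mono fun l hl => (mem_Icc.1 (mem_coe.1 hl)).2.trans hle

end Combinatorics

section Recurrence

lemma Npred_add_two (s : ℕ) (z : ℂ) : Npred (s + 2) z = z * Mpoly s z := by
  simp [Npred]

lemma Mpred_succ (s : ℕ) (z : ℂ) : Mpred (s + 1) z = Mpoly s z := by
  simp [Mpred]

lemma Mpoly_succ (s : ℕ) (z : ℂ) : Mpoly (s + 1) z = z * Mpoly s z - Npred (s + 1) z := by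
  rcases s with _ | s
  · simp [Mpoly, Npred]
  · rw [Npred_add_two, Mpoly]
    ring

lemma ratio_of_run {z : ℂ} (hz : z ≠ 0) (s : ℕ) : ∀ p : ℕ → ℂ,
    (∀ t ≤ s, p (t + 1) ≠ 0 ∧
      z * p (t + 1) ^ 2 = (p t + p (t + 1)) * (p (t + 1) + p (t + 2))) →
    p (s + 2) = 0 →
    Mpoly s z ≠ 0 ∧ z * p 1 * Mpoly s z = (p 0 + p 1) * Npred (s + 1) z := by
  induction s with
  | zero =>
    intro p hp hend
    obtain ⟨h1, h2⟩ := hp 0 le_rfl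
    simp only [zero_add] at h1 h2 hend
    refine ⟨by simp [Mpoly], ?_⟩
    simp only [Mpoly, Npred]
    rw [hend] at h2
    apply mul_right_cancel₀ h1
    simp only [zero_add, one_ne_zero, if_false, if_true]
    linear_combination h2
  | succ s ih =>
    intro p hp hend
    obtain ⟨hM, hr⟩ := ih (fun t => p (t + 1)) (fun t ht => hp (t + 1) (by omega)) hend
    obtain ⟨h1, h2⟩ := hp 0 (by omega)
    simp only [zero_add, Nat.reduceAdd] at h1 h2 hr
    have hne : p 1 + p 2 ≠ 0 := by
      intro h
      rw [h, mul_zero] at h2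
      exact mul_ne_zero hz (pow_ne_zero 2 h1) h2
    have key : (p 1 + p 2) * Mpoly (s + 1) z = z * p 1 * Mpoly s z := by
      rw [Mpoly_succ]
      linear_combination hr
    refine ⟨?_, ?_⟩
    · intro h
      rw [h, mul_zero] at key
      exact mul_ne_zero (mul_ne_zero hz h1) hM key.symm
    · apply mul_left_cancel₀ hne
      rw [Npred_add_two]
      linear_combination z * p 1 * key + z * Mpoly s z * h2

lemma exists_run_length (p : ℕ → ℂ) {N : ℕ} (hp : p (N + 1) = 0) :
    ∃ s ≤ N, p (s + 1) = 0 ∧ ∀ t < s, p (t + 1) ≠ 0 := by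
  classical
  have hex : ∃ s, p (s + 1) = 0 := ⟨N, hp⟩
  exact ⟨Nat.find hex, Nat.find_min' hex hp, Nat.find_spec hex, fun t ht => Nat.find_min hex ht⟩

lemma mpoly_conditions_of_edge_products {m : ℕ} {n : Fin m → ℕ} {z Y : ℂ} (hz : z ≠ 0)
    (p : Fin m → ℕ → ℂ) (hY : ∀ i, p i 0 + p i 1 = Y) (hsum : ∑ i, p i 1 = Y)
    (hzero : ∀ i t, n i < t → p i t = 0)
    (hrel : ∀ i t, p i (t + 1) ≠ 0 →
      z * p i (t + 1) ^ 2 = (p i t + p i (t + 1)) * (p i (t + 1) + p i (t + 2)))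
    (hne : ∃ i t, p i (t + 1) ≠ 0) :
    (∃ i : Fin m, ∃ s, 1 ≤ s ∧ s ≤ n i - 1 ∧ Mpoly s z = 0) ∨
      (∃ s : Fin m → ℕ, (∀ i, s i ≤ n i) ∧ (∀ i, Mpred (s i) z ≠ 0) ∧
        z * ∏ i, Mpred (s i) z =
          ∑ i, Npred (s i) z * ∏ j ∈ Finset.univ.erase i, Mpred (s j) z) := by
  classical
  by_cases hfirst : ∃ i, p i 1 ≠ 0
  · right
    choose s hs hs0 hs1 using fun i => exists_run_length (p i) (hzero i _ (Nat.lt_succ_self (n i)))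
    have hrun : ∀ i, Mpred (s i) z ≠ 0 ∧ z * p i 1 * Mpred (s i) z = Y * Npred (s i) z := by
      intro i
      obtain h | ⟨l, hl⟩ : s i = 0 ∨ ∃ l, s i = l + 1 := by
        rcases s i with _ | l
        · exact Or.inl rfl
        · exact Or.inr ⟨l, rfl⟩
      · have h0 := hs0 i
        rw [h] at h0 ⊢
        simp [Mpred, Npred, h0]
      · rw [hl, Mpred_succ, ← hY i]
        refine ratio_of_run hz l (p i) (fun t ht => ?_) (by rw [← hs0 i, hl])
        have := hs1 i t (by omega)
        exact ⟨this, hrel i t this⟩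
    have hYne : Y ≠ 0 := by
      obtain ⟨i, hi⟩ := hfirst
      have := hrel i 0 hi
      simp only [zero_add] at this
      rw [hY] at this
      rintro rfl
      rw [zero_mul] at this
      exact mul_ne_zero hz (pow_ne_zero 2 hi) this
    refine ⟨s, hs, fun i => (hrun i).1, mul_left_cancel₀ hYne ?_⟩
    rw [mul_sum]
    calc Y * (z * ∏ i, Mpred (s i) z) = ∑ i, z * p i 1 * ∏ j, Mpred (s j) z := by
          rw [← sum_mul, ← mul_sum, hsum]
          ring
      _ = _ := by
          refine sum_congr rfl fun i _ => ?_
          rw [← mul_prod_erase univ _ (mem_univ i), ← mul_assoc, (hrun i).2]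
          ring
  · left
    push Not at hfirst
    obtain ⟨i, hi⟩ := hne
    have hmin := fun {t} (ht : t < Nat.find hi) => not_not.1 (Nat.find_min hi ht)
    have hspec := Nat.find_spec hi
    set a := Nat.find hi
    obtain ⟨b, hb⟩ : ∃ b, a = b + 1 := by
      refine ⟨a - 1, ?_⟩
      have : a ≠ 0 := fun h => by rw [h] at hspec; exact hspec (hfirst i)
      omega
    have hbn : a < n i := by
      by_contra h
      exact hspec (hzero i _ (by omega))
    obtain ⟨s, hs, hs0, hs1⟩ := exists_run_length (fun t => p i (a + t)) (N := n i - a)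
      (hzero i _ (by omega))
    obtain ⟨l, rfl⟩ : ∃ l, s = l + 1 := by
      refine ⟨s - 1, ?_⟩
      have : s ≠ 0 := by rintro rfl; exact hspec hs0
      omega
    have hrun := (ratio_of_run hz l (fun t => p i (a + t)) (fun t ht => ?_) hs0).2
    · refine ⟨i, l + 1, by omega, by omega, ?_⟩
      have h0 : p i (a + 0) = 0 := by
        rw [add_zero, hb]
        exact hmin (by omega)
      simp only [h0, zero_add] at hrun
      rw [Mpoly_succ]
      apply mul_left_cancel₀ hspec
      linear_combination hrun
    · have := hs1 t (by omega)
      exact ⟨this, hrel i (a + t) this⟩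

end Recurrence

section Forward

variable {k m : ℕ} {n : Fin m → ℕ}

lemma mpoly_conditions_of_isEigenvalue (hk : 3 ≤ k) (hn : ∀ i, 1 ≤ n i) {lam : ℂ}
    (hlam : lam ≠ 0) (h : IsEigenvalue k (starEdges k n) lam) :
    (∃ i : Fin m, ∃ s, 1 ≤ s ∧ s ≤ n i - 1 ∧ Mpoly s (lam ^ k) = 0) ∨
      (∃ s : Fin m → ℕ, (∀ i, s i ≤ n i) ∧ (∀ i, Mpred (s i) (lam ^ k) ≠ 0) ∧
        lam ^ k * ∏ i, Mpred (s i) (lam ^ k) =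
          ∑ i, Npred (s i) (lam ^ k) * ∏ j ∈ Finset.univ.erase i, Mpred (s j) (lam ^ k)) := by
  obtain ⟨x, hx, heq⟩ := h
  have hmul : ∀ v, ∑ e ∈ (starEdges k n).filter (fun e => v ∈ e), ∏ u ∈ e, x u =
      lam * x v ^ k := by
    intro v
    obtain ⟨d, rfl⟩ : ∃ d, k = d + 1 := ⟨k - 1, by omega⟩
    have h1 : lam * x v ^ (d + 1) = x v * (lam * x v ^ (d + 1 - 1)) := by
      rw [Nat.add_sub_cancel]
      ring
    rw [h1, ← heq v, mul_sum]
    refine sum_congr rfl fun e he => ?_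
    rw [mul_prod_erase _ _ (mem_filter.1 he).2]
  set P : Fin m → ℕ → ℂ := fun i t =>
    if t < n i then ∏ u ∈ starEdge k n i (t + 1), x u else 0 with hP
  set Y : ℂ := lam * x none ^ k with hYdef
  set p : Fin m → ℕ → ℂ := fun i t => Nat.casesOn t (Y - P i 0) (P i) with hp
  have hcenter : ∑ i, P i 0 = Y := by
    rw [hYdef, ← hmul none, sum_edges_center hk hn]
    refine sum_congr rfl fun i _ => ?_
    exact if_pos (hn i)
  have hinterior : ∀ i t j, t < n i → j ∈ Ioo (t * (k - 1)) ((t + 1) * (k - 1)) →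
      lam * x (legVertex k n i j) ^ k = P i t := by
    intro i t j ht hj
    rw [← hmul, sum_edges_interior hk i ht hj]
    simp only [hP, if_pos ht]
  have hjoint : ∀ i t, t < n i →
      lam * x (legVertex k n i ((t + 1) * (k - 1))) ^ k = P i t + P i (t + 1) := by
    intro i t ht
    rw [← hmul, sum_edges_joint hk i ht]
    simp only [hP, if_pos ht]
  have hend : ∀ i t, t ≤ n i →
      lam * x (legVertex k n i (t * (k - 1))) ^ k = p i t + p i (t + 1) := by
    intro i t ht
    rcases t with _ | t
    · rw [zero_mul, legVertex_zero]
      exact (sub_add_cancel Y (P i 0)).symm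
    · exact hjoint i t ht
  refine mpoly_conditions_of_edge_products (Y := Y) (pow_ne_zero k hlam) p ?_ hcenter ?_ ?_ ?_
  · intro i
    simp [hp]
  · intro i t ht
    rcases t with _ | t
    · omega
    · simp only [hp, hP]
      rw [if_neg (by omega)]
  · intro i t hne
    have ht : t < n i := by
      by_contra h
      simp [hp, hP, h] at hne
    have hpt : p i (t + 1) = ∏ u ∈ starEdge k n i (t + 1), x u := by
      simp only [hp, hP, if_pos ht]
    have hcard : (Ioo (t * (k - 1)) ((t + 1) * (k - 1))).card = k - 2 := by
      rw [Nat.card_Ioo, add_mul]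
      omega
    have hedge := prod_starEdge hk i ht x
    rw [← hpt] at hedge
    have hall : ∏ l ∈ Ioo (t * (k - 1)) ((t + 1) * (k - 1)), (lam * x (legVertex k n i l) ^ k) =
        p i (t + 1) ^ (k - 2) := by
      rw [prod_congr rfl fun l hl => hinterior i t l ht hl, prod_const, hcard]
    rw [prod_mul_distrib, prod_const, hcard, prod_pow] at hall
    apply mul_right_cancel₀ (pow_ne_zero (k - 2) hne)
    have hpk : lam ^ k * p i (t + 1) ^ 2 * (p i (t + 1)) ^ (k - 2) =
        lam ^ 2 * lam ^ (k - 2) * p i (t + 1) ^ k := by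
      rw [mul_assoc, ← pow_add, ← pow_add, Nat.add_sub_cancel' (by omega)]
    rw [← hend i t ht.le, ← hend i (t + 1) ht, hpk, ← hall, hedge]
    ring
  · by_contra hall
    push Not at hall
    have hPz : ∀ i t, P i t = 0 := hall
    apply hx
    funext v
    have hv : lam * x v ^ k = 0 := by
      induction v using vertex_cases hk with
      | center => rw [← hYdef, ← hcenter]; simp [hPz]
      | interior i t j ht hj => rw [hinterior i t j ht hj, hPz]
      | joint i t ht => rw [hjoint i t ht, hPz, hPz, add_zero]
    exact pow_eq_zero_iff (by omega) |>.1 ((mul_eq_zero.1 hv).resolve_left hlam)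

end Forward

section Construction

variable {k m : ℕ} {n : Fin m → ℕ}

/-- The vector with value `β` at the center, `b i t` at the far end of the `t`-th edge of leg `i`,
and `c i t` at the interior vertices of its `(t + 1)`-st edge. -/
def legVector (k : ℕ) {m : ℕ} (n : Fin m → ℕ) (β : ℂ) (b c : Fin m → ℕ → ℂ) :
    StarVertex k m n → ℂ
  | none => β
  | some ⟨i, u⟩ =>
    if (k - 1) ∣ u.val + 1 then b i ((u.val + 1) / (k - 1)) else c i (u.val / (k - 1))

lemma legVector_joint (hk : 3 ≤ k) {β : ℂ} {b : Fin m → ℕ → ℂ} (c : Fin m → ℕ → ℂ)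
    (hb : ∀ i, b i 0 = β) (i : Fin m) {t : ℕ} (ht : t ≤ n i) :
    legVector k n β b c (legVertex k n i (t * (k - 1))) = b i t := by
  rcases t with _ | t
  · rw [zero_mul, legVertex_zero, hb]
    rfl
  · have hpos : 0 < (t + 1) * (k - 1) := Nat.mul_pos (by omega) (by omega)
    have hle : (t + 1) * (k - 1) ≤ n i * (k - 1) := succ_mul_le_mul ht
    obtain ⟨u, hu⟩ : ∃ u, (t + 1) * (k - 1) = u + 1 := ⟨(t + 1) * (k - 1) - 1, by omega⟩
    rw [hu, legVertex_succ i ⟨u, by omega⟩]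
    simp only [legVector]
    rw [← hu, if_pos (Nat.dvd_mul_left _ _), Nat.mul_div_cancel _ (by omega)]

lemma legVector_interior {β : ℂ} (b c : Fin m → ℕ → ℂ) (i : Fin m)
    {t j : ℕ} (ht : t < n i) (hj : j ∈ Ioo (t * (k - 1)) ((t + 1) * (k - 1))) :
    legVector k n β b c (legVertex k n i j) = c i t := by
  rw [mem_Ioo] at hj
  have hle : (t + 1) * (k - 1) ≤ n i * (k - 1) := succ_mul_le_mul ht
  obtain ⟨u, rfl⟩ : ∃ u, j = u + 1 := ⟨j - 1, by omega⟩
  rw [legVertex_succ i ⟨u, by omega⟩]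
  simp only [legVector]
  rw [if_neg, Nat.div_eq_of_lt_le (show t * (k - 1) ≤ u by omega) (by omega)]
  rintro ⟨q, hq⟩
  rw [hq, mul_comm (k - 1) q] at hj
  have h1 := Nat.lt_of_mul_lt_mul_right hj.1
  have h2 := Nat.lt_of_mul_lt_mul_right hj.2
  omega

lemma isEigenvalue_of_legs (hk : 3 ≤ k) (hn : ∀ i, 1 ≤ n i) {lam β : ℂ} {b c : Fin m → ℕ → ℂ}
    (hb : ∀ i, b i 0 = β)
    (hcenter : ∑ i, b i 1 * c i 0 ^ (k - 2) = lam * β ^ (k - 1))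
    (hinterior : ∀ i t, t < n i → b i t * (b i (t + 1) * c i t ^ (k - 3)) = lam * c i t ^ (k - 1))
    (hjoint : ∀ i t, t < n i → b i t * c i t ^ (k - 2) +
      (if t + 1 < n i then b i (t + 2) * c i (t + 1) ^ (k - 2) else 0) =
        lam * b i (t + 1) ^ (k - 1))
    (hne : β ≠ 0 ∨ ∃ i t, t ≤ n i ∧ b i t ≠ 0) :
    IsEigenvalue k (starEdges k n) lam := by
  have hlt : ∀ t, t * (k - 1) < (t + 1) * (k - 1) := fun t =>
    Nat.mul_lt_mul_of_pos_right (by omega) (by omega)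
  have hcard : ∀ t, (Ioo (t * (k - 1)) ((t + 1) * (k - 1))).card = k - 2 := by
    intro t
    rw [Nat.card_Ioo, add_mul]
    omega
  set x := legVector k n β b c
  have xjoint : ∀ i t, t ≤ n i → x (legVertex k n i (t * (k - 1))) = b i t :=
    fun i t ht => legVector_joint hk c hb i ht
  have xint : ∀ i t j, t < n i → j ∈ Ioo (t * (k - 1)) ((t + 1) * (k - 1)) →
      x (legVertex k n i j) = c i t := fun i t j ht hj => legVector_interior b c i ht hj
  have pstart : ∀ i t, t < n i →
      ∏ u ∈ (starEdge k n i (t + 1)).erase (legVertex k n i (t * (k - 1))), x u =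
        b i (t + 1) * c i t ^ (k - 2) := by
    intro i t ht
    rw [prod_starEdge_erase hk i ht (left_mem_Icc.2 (hlt t).le), Icc_eq_insert_insert_Ioo (hlt t),
      erase_insert (by simp [(hlt t).ne]), prod_insert (by simp), xjoint i _ ht,
      prod_congr rfl fun l hl => xint i t l ht hl, prod_const, hcard]
  have pend : ∀ i t, t < n i →
      ∏ u ∈ (starEdge k n i (t + 1)).erase (legVertex k n i ((t + 1) * (k - 1))), x u =
        b i t * c i t ^ (k - 2) := by
    intro i t ht
    rw [prod_starEdge_erase hk i ht (right_mem_Icc.2 (hlt t).le), Icc_eq_insert_insert_Ioo (hlt t),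
      insert_comm, erase_insert (by simp [(hlt t).ne']), prod_insert (by simp), xjoint i _ ht.le,
      prod_congr rfl fun l hl => xint i t l ht hl, prod_const, hcard]
  have pint : ∀ i t j, t < n i → j ∈ Ioo (t * (k - 1)) ((t + 1) * (k - 1)) →
      ∏ u ∈ (starEdge k n i (t + 1)).erase (legVertex k n i j), x u =
        b i t * (b i (t + 1) * c i t ^ (k - 3)) := by
    intro i t j ht hj
    have hj' := mem_Ioo.1 hj
    rw [prod_starEdge_erase hk i ht (Ioo_subset_Icc_self hj), Icc_eq_insert_insert_Ioo (hlt t),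
      erase_insert_of_ne hj'.1.ne, erase_insert_of_ne hj'.2.ne', prod_insert, prod_insert,
      xjoint i _ ht.le, xjoint i _ ht, prod_congr rfl fun l hl => xint i t l ht (mem_of_mem_erase hl),
      prod_const, card_erase_of_mem hj, hcard]
    · rfl
    · simp
    · simp [(hlt t).ne]
  refine ⟨x, ?_, fun v => ?_⟩
  · intro h
    rcases hne with hβ | ⟨i, t, ht, hbt⟩
    · exact hβ (congrFun h none)
    · exact hbt (by rw [← xjoint i t ht, h]; rfl)
  · induction v using vertex_cases hk with
    | center =>
      rw [sum_edges_center hk hn]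
      refine Eq.trans (sum_congr rfl fun i _ => ?_) hcenter
      rw [← pstart i 0 (hn i), zero_mul, legVertex_zero]
    | interior i t j ht hj =>
      rw [sum_edges_interior hk i ht hj (fun e => ∏ u ∈ e.erase (legVertex k n i j), x u),
        pint i t j ht hj, xint i t j ht hj, hinterior i t ht]
    | joint i t ht =>
      rw [sum_edges_joint hk i ht
        (fun e => ∏ u ∈ e.erase (legVertex k n i ((t + 1) * (k - 1))), x u),
        pend i t ht, xjoint i _ ht, ← hjoint i t ht]
      congr 1
      split_ifs with h
      · exact pstart i (t + 1) h
      · rfl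

lemma isEigenvalue_zero (hk : 3 ≤ k) (hn : ∀ i, 1 ≤ n i) :
    IsEigenvalue k (starEdges k n) 0 := by
  have h2 : k - 2 ≠ 0 := by omega
  refine isEigenvalue_of_legs (β := 1) (b := fun _ t => if t = 0 then 1 else 0) (c := fun _ _ => 0)
    hk hn ?_ ?_ ?_ ?_ ?_ <;> simp [h2]

/-- The values at the ends of the edges of a leg which vanish before position `a`, are `1` there,
and then grow by the factors `ρ r ^ 2 / lam`. -/
noncomputable def jointValue (lam : ℂ) (a : ℕ) (ρ : ℕ → ℂ) (t : ℕ) : ℂ :=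
  if t < a then 0 else ∏ r ∈ range (t - a), (ρ r ^ 2 / lam)

lemma jointValue_of_lt {lam : ℂ} {a : ℕ} {ρ : ℕ → ℂ} {t : ℕ} (h : t < a) :
    jointValue lam a ρ t = 0 := if_pos h

lemma jointValue_self {lam : ℂ} {a : ℕ} {ρ : ℕ → ℂ} : jointValue lam a ρ a = 1 := by
  simp [jointValue]

lemma jointValue_succ {lam : ℂ} {a : ℕ} {ρ : ℕ → ℂ} {t : ℕ} (h : a ≤ t) :
    jointValue lam a ρ (t + 1) = jointValue lam a ρ t * (ρ (t - a) ^ 2 / lam) := by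
  rw [jointValue, jointValue, if_neg (by omega), if_neg (by omega), Nat.succ_sub h,
    prod_range_succ]

lemma joint_equation {lam r q : ℂ} (hlam : lam ≠ 0) (B : ℂ) {d : ℕ}
    (h : (lam ^ (d + 3) - q) * r ^ (d + 3) = lam ^ (d + 3)) :
    B * (B * r / lam) ^ (d + 1) + (B * (r ^ 2 / lam)) ^ (d + 2) * q / lam ^ (d + 2) =
      lam * (B * (r ^ 2 / lam)) ^ (d + 2) := by
  have h1 : B * (B * r / lam) ^ (d + 1) =
      B ^ (d + 2) * r ^ (d + 1) * lam ^ (d + 3) / lam ^ (2 * d + 4) := by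
    rw [div_pow]
    field_simp
    ring
  have h2 : (B * (r ^ 2 / lam)) ^ (d + 2) =
      B ^ (d + 2) * r ^ (d + 1) * r ^ (d + 3) / lam ^ (d + 2) := by
    rw [mul_pow, div_pow]
    field_simp
    ring
  have h3 : lam ^ (2 * d + 4) = lam ^ (d + 2) * lam ^ (d + 2) := by ring
  rw [h1, h2, h3]
  field_simp
  linear_combination -(B ^ (d + 2) * r ^ (d + 1)) * h

/-- Legs described by ratios `ρ` satisfying the continued fraction recursion give an
eigenvector. -/
lemma isEigenvalue_of_ratios (hk : 3 ≤ k) (hn : ∀ i, 1 ≤ n i) {lam : ℂ} (hlam : lam ≠ 0)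
    (β : ℂ) (a : Fin m → ℕ) (ρ : Fin m → ℕ → ℂ)
    (hβ : ∀ i, jointValue lam (a i) (ρ i) 0 = β)
    (hcenter : β ≠ 0 → ∑ i, ρ i 0 ^ k = lam ^ k)
    (hstart : ∀ i, 0 < a i → a i ≤ n i → a i < n i ∧ ρ i 0 ^ k = lam ^ k)
    (hrec : ∀ i r, ρ i r = 0 ∨ (lam ^ k - ρ i (r + 1) ^ k) * ρ i r ^ k = lam ^ k)
    (hlast : ∀ i r, n i ≤ a i + r → ρ i r = 0)
    (hne : β ≠ 0 ∨ ∃ i, a i ≤ n i) :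
    IsEigenvalue k (starEdges k n) lam := by
  obtain ⟨d, rfl⟩ : ∃ d, k = d + 3 := ⟨k - 3, by omega⟩
  have hstep : ∀ i t, a i ≤ t →
      jointValue lam (a i) (ρ i) (t + 1) *
        (jointValue lam (a i) (ρ i) t * ρ i (t - a i) / lam) ^ (d + 3 - 2) =
      jointValue lam (a i) (ρ i) t ^ (d + 2) * ρ i (t - a i) ^ (d + 3) / lam ^ (d + 2) := by
    intro i t h
    rw [jointValue_succ h, show d + 3 - 2 = d + 1 by omega, div_pow, mul_pow]
    field_simp
    ring
  refine isEigenvalue_of_legs (β := β) (b := fun i => jointValue lam (a i) (ρ i))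
    (c := fun i t => jointValue lam (a i) (ρ i) t * ρ i (t - a i) / lam) hk hn hβ ?_ ?_ ?_ ?_
  · by_cases h0 : β = 0
    · simp [hβ, h0]
    · have ha : ∀ i, a i = 0 := by
        intro i
        by_contra h
        exact h0 ((hβ i).symm.trans (jointValue_of_lt (by omega)))
      have hsum := hcenter h0
      rw [sum_congr rfl fun i _ => hstep i 0 (ha i).le]
      simp only [hβ, Nat.zero_sub]
      rw [← sum_div, ← mul_sum, hsum, show d + 3 - 1 = d + 2 by omega]
      field_simp
      ring
  · intro i t ht
    rcases Nat.lt_or_ge t (a i) with h | h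
    · simp [jointValue_of_lt h]
    · rw [jointValue_succ h, show d + 3 - 3 = d by omega, show d + 3 - 1 = d + 2 by omega,
        div_pow, div_pow]
      field_simp
      ring
  · intro i t ht
    have hnext : a i ≤ t + 1 → (if t + 1 < n i then jointValue lam (a i) (ρ i) (t + 2) *
        (jointValue lam (a i) (ρ i) (t + 1) * ρ i (t + 1 - a i) / lam) ^ (d + 3 - 2) else 0) =
        jointValue lam (a i) (ρ i) (t + 1) ^ (d + 2) * ρ i (t + 1 - a i) ^ (d + 3) /
          lam ^ (d + 2) := by
      intro h
      split_ifs with hlt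
      · exact hstep i (t + 1) h
      · rw [hlast i (t + 1 - a i) (by omega)]
        simp
    rw [show d + 3 - 1 = d + 2 by omega]
    rcases Nat.lt_trichotomy (t + 1) (a i) with h | h | h
    · simp [jointValue_of_lt h, jointValue_of_lt (show t < a i by omega)]
    · rw [hnext h.ge, jointValue_of_lt (show t < a i by omega), h, jointValue_self, Nat.sub_self,
        (hstart i (by omega) (by omega)).2]
      field_simp
      simp
      ring
    · rw [hnext h.le, jointValue_succ (show a i ≤ t by omega), show t + 1 - a i = t - a i + 1 by omega,
        show d + 3 - 2 = d + 1 by omega]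
      rcases hrec i (t - a i) with h0 | h0
      · simp [h0]
      · exact joint_equation hlam _ h0
  · rcases hne with h | ⟨i, h⟩
    · exact Or.inl h
    · exact Or.inr ⟨i, a i, h, by rw [jointValue_self]; exact one_ne_zero⟩

lemma exists_ratios (hk : 3 ≤ k) (lam : ℂ) (s : ℕ)
    (hM : ∀ l < s, Mpoly l (lam ^ k) ≠ 0) :
    ∃ ρ : ℕ → ℂ, (∀ r, ρ r ^ k = Npred (s - r) (lam ^ k) / Mpred (s - r) (lam ^ k)) ∧
      (∀ r, ρ r = 0 ∨ (lam ^ k - ρ (r + 1) ^ k) * ρ r ^ k = lam ^ k) ∧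
      ∀ r, s ≤ r → ρ r = 0 := by
  choose ρ hρ using fun r => IsAlgClosed.exists_pow_nat_eq
    (Npred (s - r) (lam ^ k) / Mpred (s - r) (lam ^ k)) (show 0 < k by omega)
  have hzero : ∀ r, s ≤ r → ρ r = 0 := by
    intro r hr
    have := hρ r
    rw [Nat.sub_eq_zero_of_le hr] at this
    simpa [Npred, show k ≠ 0 by omega] using this
  refine ⟨ρ, hρ, fun r => ?_, hzero⟩
  rcases Nat.lt_or_ge r s with h | h
  · right
    obtain ⟨j, hj⟩ : ∃ j, s - r = j + 1 := ⟨s - r - 1, by omega⟩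
    rw [hρ, hρ, hj, show s - (r + 1) = j by omega, Mpred_succ]
    rcases j with _ | j
    · simp [Npred, Mpoly]
    · have h1 := hM j (by omega)
      have h2 := hM (j + 1) (by omega)
      rw [Mpred_succ, Npred_add_two]
      field_simp
      rw [Mpoly_succ]
  · exact Or.inl (hzero r h)

lemma isEigenvalue_of_root (hk : 3 ≤ k) (hn : ∀ i, 1 ≤ n i) {lam : ℂ} (hlam : lam ≠ 0)
    (h : ∃ i : Fin m, ∃ s, 1 ≤ s ∧ s ≤ n i - 1 ∧ Mpoly s (lam ^ k) = 0) :
    IsEigenvalue k (starEdges k n) lam := by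
  classical
  obtain ⟨i, h⟩ := h
  obtain ⟨hs1, hs2, hs0⟩ := Nat.find_spec h
  have hmin : ∀ l < Nat.find h, Mpoly l (lam ^ k) ≠ 0 := by
    intro l hl h0
    rcases l with _ | l
    · simp [Mpoly] at h0
    · exact Nat.find_min h hl ⟨by omega, by omega, h0⟩
  set s := Nat.find h
  obtain ⟨ρ, hρ, hrec, hlast⟩ := exists_ratios hk lam s hmin
  have hpos : ∀ j, 0 < if j = i then n i - s else n j + 1 := by
    intro j
    split_ifs <;> omega
  refine isEigenvalue_of_ratios hk hn hlam 0 (fun j => if j = i then n i - s else n j + 1)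
    (fun j => if j = i then ρ else 0) (fun j => jointValue_of_lt (hpos j)) (fun h => (h rfl).elim)
    ?_ ?_ ?_ (Or.inr ⟨i, by simp⟩)
  · intro j _ hj
    by_cases hji : j = i
    · subst hji
      obtain ⟨l, hl⟩ : ∃ l, s = l + 1 := ⟨s - 1, by omega⟩
      have hMl := hmin l (by omega)
      rw [hl, Mpoly_succ] at hs0
      simp only [if_true]
      refine ⟨by omega, ?_⟩
      rw [hρ 0, Nat.sub_zero, hl, Mpred_succ, div_eq_iff hMl]
      linear_combination -hs0
    · simp [hji] at hj
  · intro j r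
    by_cases hji : j = i
    · simpa [hji] using hrec r
    · simp [hji]
  · intro j r hr
    by_cases hji : j = i
    · subst hji
      simp only [if_true] at hr ⊢
      exact hlast r (by omega)
    · simp [hji]

lemma isEigenvalue_of_sum (hk : 3 ≤ k) (hn : ∀ i, 1 ≤ n i) {lam : ℂ} (hlam : lam ≠ 0)
    (hM : ∀ i : Fin m, ∀ l < n i, Mpoly l (lam ^ k) ≠ 0)
    (h : ∃ s : Fin m → ℕ, (∀ i, s i ≤ n i) ∧ (∀ i, Mpred (s i) (lam ^ k) ≠ 0) ∧
      lam ^ k * ∏ i, Mpred (s i) (lam ^ k) =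
        ∑ i, Npred (s i) (lam ^ k) * ∏ j ∈ Finset.univ.erase i, Mpred (s j) (lam ^ k)) :
    IsEigenvalue k (starEdges k n) lam := by
  obtain ⟨s, hs, hMs, heq⟩ := h
  choose ρ hρ hrec hlast using fun i =>
    exists_ratios hk lam (s i) fun l hl => hM i l (hl.trans_le (hs i))
  refine isEigenvalue_of_ratios hk hn hlam 1 (fun _ => 0) ρ (fun i => jointValue_self) (fun _ => ?_)
    (fun i h => (lt_irrefl 0 h).elim) hrec (fun i r hr => hlast i r ?_) (Or.inl one_ne_zero)
  · have hprod : ∏ i, Mpred (s i) (lam ^ k) ≠ 0 := prod_ne_zero_iff.2 fun i _ => hMs i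
    apply mul_right_cancel₀ hprod
    rw [heq, sum_mul]
    refine sum_congr rfl fun i _ => ?_
    rw [hρ i 0, Nat.sub_zero, ← mul_prod_erase univ _ (mem_univ i), ← mul_assoc,
      div_mul_cancel₀ _ (hMs i)]
  · have := hs i
    omega

end Construction

/-- Eigenvalues of the starlike hypergraph `S^k_{n_1,…,n_m}`: `0` is always an
eigenvalue, and a nonzero `λ` is an eigenvalue iff (a) `M_s(λ^k) = 0` for some
`i` and some `1 ≤ s ≤ n_i - 1`, or (b) there are `s_i ∈ {0,…,n_i}` with
`M_{s_i-1}(λ^k) ≠ 0` for all `i` and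
`λ^k·∏_i M_{s_i-1}(λ^k) = ∑_i N_{s_i-1}(λ^k)·∏_{j≠i} M_{s_j-1}(λ^k)`. -/
theorem starlike_eigenvalue_iff (k m : ℕ) (hk : 3 ≤ k) (hm : 1 ≤ m)
    (n : Fin m → ℕ) (hn : ∀ i, 1 ≤ n i) (lam : ℂ) (hlam : lam ≠ 0) :
    IsEigenvalue k (starEdges k n) (0 : ℂ) ∧
    (IsEigenvalue k (starEdges k n) lam ↔
      (∃ i : Fin m, ∃ s, 1 ≤ s ∧ s ≤ n i - 1 ∧ Mpoly s (lam ^ k) = 0) ∨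
      (∃ s : Fin m → ℕ, (∀ i, s i ≤ n i) ∧ (∀ i, Mpred (s i) (lam ^ k) ≠ 0) ∧
        lam ^ k * ∏ i, Mpred (s i) (lam ^ k) =
          ∑ i, Npred (s i) (lam ^ k) * ∏ j ∈ Finset.univ.erase i, Mpred (s j) (lam ^ k))) := by
  refine ⟨isEigenvalue_zero hk hn, mpoly_conditions_of_isEigenvalue hk hn hlam, fun h => ?_⟩
  by_cases ha : ∃ i : Fin m, ∃ s, 1 ≤ s ∧ s ≤ n i - 1 ∧ Mpoly s (lam ^ k) = 0
  · exact isEigenvalue_of_root hk hn hlam ha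
  · refine isEigenvalue_of_sum hk hn hlam (fun i l hl h0 => ?_) (h.resolve_left ha)
    rcases l with _ | l
    · simp [Mpoly] at h0
    · exact ha ⟨i, l + 1, by omega, by omega, h0⟩
end

section
/- Let k ≥ 3, n ≥ 1, r = n(k−1), and let λ ∈ ℂ satisfy λ ≠ 0 and λ^k − a_{i−1} ≠ 0 for all 0 ≤ i ≤ n, and assume the quotient algebra A is finite-dimensional over ℂ. Then the determinant of the ℂ-linear endomorphism of A given by multiplication by λ − x_1·x_2·⋯·x_{k−1} equals ∏_{s=0}^{n} (λ − a_{s−1}/λ^{k−1})^{μ_{n,k}(s)}. -/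
open Finset MvPolynomial

/-- Vertex `v` belongs to the edge `e_t = {(t-1)(k-1), …, t(k-1)}` of the
hyperpath `P_n^k`. -/
def inEdge (k t v : ℕ) : Prop := (t - 1) * (k - 1) ≤ v ∧ v ≤ t * (k - 1)

instance (k t v : ℕ) : Decidable (inEdge k t v) :=
  inferInstanceAs (Decidable (_ ∧ _))

/-- `aseq k λ i = a_{i-1}`, where `a_{-1} = 0`, `a_0 = 1` and
`a_i = λ^k/(λ^k - a_{i-1})` for `i ≥ 1`. -/
noncomputable def aseq (k : ℕ) (lam : ℂ) : ℕ → ℂ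
  | 0 => 0
  | 1 => 1
  | (i + 2) => lam ^ k / (lam ^ k - aseq k lam (i + 1))

/-- `μ_{n,k}(s)`: the multiplicity `k^{s(k-2)}·((k-1)^{k-1} - k^{k-2})·(k-1)^{(n-s-1)(k-1)}`
for `0 ≤ s ≤ n-1`, and `k^{n(k-2)}` for `s = n`. -/
def muPath (n k s : ℕ) : ℕ :=
  if s = n then k ^ (n * (k - 2))
  else k ^ (s * (k - 2)) * ((k - 1) ^ (k - 1) - k ^ (k - 2)) * (k - 1) ^ ((n - s - 1) * (k - 1))

/-- The polynomial `f_v = λ·x_v^{k-1} - ∑_{t : v ∈ e_t} ∏_{u ∈ e_t, u ∉ {v,0}} x_u`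
in the variables `x_1, …, x_r` (`r = n(k-1)`); the variable `x_v` is indexed by
`v - 1 : Fin (n(k-1))`. -/
noncomputable def fpoly (k n : ℕ) (lam : ℂ) (v : Fin (n * (k - 1))) :
    MvPolynomial (Fin (n * (k - 1))) ℂ :=
  C lam * (X v) ^ (k - 1) -
    ∑ t ∈ (Finset.Icc 1 n).filter (fun t => inEdge k t (v.val + 1)),
      ∏ u ∈ (Finset.univ.filter
          (fun u : Fin (n * (k - 1)) => inEdge k t (u.val + 1))).erase v,
        X u

/-- The ideal `⟨f_1, …, f_r⟩`; the quotient is the algebra `A`. -/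
noncomputable def pathIdeal (k n : ℕ) (lam : ℂ) :
    Ideal (MvPolynomial (Fin (n * (k - 1))) ℂ) :=
  Ideal.span (Set.range (fpoly k n lam))

/-- Polynomials of total degree `< n` (only `0` when `n = 0`). -/
def degreeBelow (σ R : Type*) [CommRing R] (n : ℕ) : Submodule R (MvPolynomial σ R) where
  carrier := {p | ∀ β : σ →₀ ℕ, n ≤ β.degree → coeff β p = 0}
  add_mem' {p q} hp hq β h := by simp [hp β h, hq β h]
  zero_mem' β _ := by simp
  smul_mem' c p hp β h := by simp [hp β h]

section MonicQuotient

variable {σ R : Type*} [CommRing R]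

theorem degreeBelow_mono {a b : ℕ} (h : a ≤ b) : degreeBelow σ R a ≤ degreeBelow σ R b :=
  fun _ hp β hβ => hp β (h.trans hβ)

theorem mul_mem_degreeBelow {a b : ℕ} {p q : MvPolynomial σ R}
    (hp : p ∈ degreeBelow σ R a) (hq : q ∈ degreeBelow σ R (b + 1)) :
    p * q ∈ degreeBelow σ R (a + b) := by
  classical
  intro β hβ
  rw [coeff_mul]
  refine Finset.sum_eq_zero fun x hx => ?_
  rw [Finset.HasAntidiagonal.mem_antidiagonal] at hx
  have hdeg : x.1.degree + x.2.degree = β.degree := by rw [← map_add, hx]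
  by_cases h : a ≤ x.1.degree
  · rw [hp _ h, zero_mul]
  · rw [hq _ (by omega), mul_zero]

theorem eq_zero_of_mem_degreeBelow_zero {p : MvPolynomial σ R} (hp : p ∈ degreeBelow σ R 0) :
    p = 0 := by
  ext β
  simpa using hp β (Nat.zero_le _)

theorem exists_mem_degreeBelow (p : MvPolynomial σ R) : ∃ n, p ∈ degreeBelow σ R n := by
  refine ⟨p.totalDegree + 1, fun β hβ => coeff_eq_zero_of_totalDegree_lt ?_⟩
  have : β.degree = ∑ i ∈ β.support, β i := rfl
  omega

theorem monomial_mem_degreeBelow (β : σ →₀ ℕ) (c : R) :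
    monomial β c ∈ degreeBelow σ R (β.degree + 1) := by
  classical
  intro γ hγ
  rw [coeff_monomial, if_neg]
  rintro rfl
  omega

/-- `p` agrees with `q` up to terms of degree `< n`, and `q` has degree `≤ n`. -/
def SameTop (n : ℕ) (p q : MvPolynomial σ R) : Prop :=
  q ∈ degreeBelow σ R (n + 1) ∧ p - q ∈ degreeBelow σ R n

theorem SameTop.mul {a b : ℕ} {p p' q q' : MvPolynomial σ R} (h : SameTop a p p')
    (h' : SameTop b q q') : SameTop (a + b) (p * q) (p' * q') := by
  have hq : q ∈ degreeBelow σ R (b + 1) := by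
    have := add_mem (degreeBelow_mono (Nat.le_succ b) h'.2) h'.1
    simpa using this
  refine ⟨?_, ?_⟩
  · have := mul_mem_degreeBelow h.1 h'.1
    rwa [show a + b + 1 = a + 1 + b by ring]
  · have h1 := mul_mem_degreeBelow h.2 hq
    have h2 := mul_mem_degreeBelow h'.2 h.1
    rw [add_comm b a] at h2
    have := add_mem h1 h2
    convert this using 1
    ring

theorem SameTop.refl_monomial (β : σ →₀ ℕ) (c : R) :
    SameTop β.degree (monomial β c) (monomial β c) :=
  ⟨monomial_mem_degreeBelow β c, by simp⟩

theorem SameTop.one : SameTop 0 (1 : MvPolynomial σ R) 1 := by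
  simpa using SameTop.refl_monomial (0 : σ →₀ ℕ) (1 : R)

theorem SameTop.pow {a : ℕ} {p q : MvPolynomial σ R} (h : SameTop a p q) (n : ℕ) :
    SameTop (n * a) (p ^ n) (q ^ n) := by
  induction n with
  | zero => simpa using SameTop.one
  | succ n ih =>
    rw [pow_succ, pow_succ, add_mul, one_mul]
    exact ih.mul h

theorem SameTop.prod {ι : Type*} (s : Finset ι) {a : ι → ℕ} {p q : ι → MvPolynomial σ R}
    (h : ∀ i, SameTop (a i) (p i) (q i)) :
    SameTop (∑ i ∈ s, a i) (∏ i ∈ s, p i) (∏ i ∈ s, q i) := by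
  classical
  induction s using Finset.induction_on with
  | empty => simpa using SameTop.one
  | insert i s hi ih =>
    rw [Finset.sum_insert hi, Finset.prod_insert hi, Finset.prod_insert hi]
    exact (h i).mul ih

/-- A quotient of a free module by the span of a part of a basis is free on the other part. -/
theorem nonempty_basis_quotient_span_image {I M : Type*} [AddCommGroup M] [Module R M]
    (B : Module.Basis I R M) (s : Set I) :
    Nonempty (Module.Basis (sᶜ : Set I) R (M ⧸ Submodule.span R (B '' s))) := by
  classical
  let L : M →ₗ[R] ((sᶜ : Set I) →₀ R) :=
    (Finsupp.lsubtypeDomain (sᶜ : Set I)).comp B.repr.toLinearMap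
  have hker : LinearMap.ker L = Submodule.span R (B '' s) := by
    ext x
    rw [LinearMap.mem_ker, Module.Basis.mem_span_image]
    constructor
    · intro h i hi
      by_contra his
      have := DFunLike.congr_fun h ⟨i, his⟩
      simp only [L, LinearMap.comp_apply, Finsupp.lsubtypeDomain_apply,
        Finsupp.subtypeDomain_apply, Finsupp.zero_apply] at this
      exact (Finsupp.mem_support_iff.1 hi) this
    · intro h
      ext ⟨i, hi⟩
      by_contra hne
      exact hi (h (Finsupp.mem_support_iff.2 hne))
  have hsurj : Function.Surjective L := by
    intro f
    refine ⟨B.repr.symm (f.mapDomain Subtype.val), ?_⟩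
    ext i
    simp only [L, LinearMap.comp_apply, Finsupp.lsubtypeDomain_apply, LinearEquiv.coe_coe,
      LinearEquiv.apply_symm_apply, Finsupp.subtypeDomain_apply]
    exact Finsupp.mapDomain_apply Subtype.val_injective f i
  exact ⟨⟨(Submodule.quotEquivOfEq _ _ hker.symm).trans (L.quotKerEquivOfSurjective hsurj)⟩⟩

variable [Fintype σ]

/-- If every `f i` is `X i ^ D` plus terms of smaller degree, the quotient by the `f i` is free
of rank `D ^ card σ`. -/
theorem nonempty_basis_quotient_monic {D : ℕ} (hD : 0 < D) (f : σ → MvPolynomial σ R)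
    (hf : ∀ i, f i - X i ^ D ∈ degreeBelow σ R D) :
    Nonempty (Module.Basis (σ → Fin D) R
      (MvPolynomial σ R ⧸ Ideal.span (Set.range f))) := by
  classical
  let b : (σ →₀ ℕ) → MvPolynomial σ R := fun β => ∏ i, (f i ^ (β i / D) * X i ^ (β i % D))
  have hX : ∀ (i : σ) (n : ℕ), SameTop n (X i ^ n : MvPolynomial σ R) (X i ^ n) := by
    intro i n
    rw [X_pow_eq_monomial]
    simpa using SameTop.refl_monomial (Finsupp.single i n) (1 : R)
  have hfi : ∀ i, SameTop D (f i) (X i ^ D) := fun i => ⟨(hX i D).1, hf i⟩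
  have hmon : ∀ β : σ →₀ ℕ, monomial β (1 : R) = ∏ i, X i ^ β i := fun β => by
    rw [monomial_eq, C_1, one_mul, Finsupp.prod_fintype _ _ (by simp)]
  have hb : ∀ β, b β - monomial β 1 ∈ degreeBelow σ R β.degree := by
    intro β
    have key := SameTop.prod Finset.univ
      (fun i => ((hfi i).pow (β i / D)).mul (hX i (β i % D)))
    have hdeg : ∑ i, (β i / D * D + β i % D) = β.degree := by
      rw [Finsupp.degree_eq_sum]
      exact Finset.sum_congr rfl fun i _ => Nat.div_add_mod' _ _
    have hpr : ∏ i, ((X i ^ D : MvPolynomial σ R) ^ (β i / D) * X i ^ (β i % D)) =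
        monomial β 1 := by
      rw [hmon]
      refine Finset.prod_congr rfl fun i _ => ?_
      rw [← pow_mul, ← pow_add, Nat.div_add_mod]
    rw [hdeg, hpr] at key
    exact key.2
  let T : MvPolynomial σ R →ₗ[R] MvPolynomial σ R := (basisMonomials σ R).constr R b
  have hT : ∀ β, T (monomial β 1) = b β := fun β => by
    have := (basisMonomials σ R).constr_basis R b β
    simpa using this
  have hTlow : ∀ n, ∀ p ∈ degreeBelow σ R (n + 1), T p - p ∈ degreeBelow σ R n := by
    intro n p hp
    have hp' : p = ∑ β ∈ p.support, coeff β p • monomial β (1 : R) := by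
      conv_lhs => rw [p.as_sum]
      refine Finset.sum_congr rfl fun β _ => ?_
      rw [smul_monomial, smul_eq_mul, mul_one]
    have : T p - p = ∑ β ∈ p.support, coeff β p • (b β - monomial β (1 : R)) := by
      conv_lhs => rw [hp']
      rw [map_sum, ← Finset.sum_sub_distrib]
      refine Finset.sum_congr rfl fun β _ => ?_
      rw [map_smul, hT, smul_sub]
    rw [this]
    refine Submodule.sum_mem _ fun β hβ => Submodule.smul_mem _ _ (degreeBelow_mono ?_ (hb β))
    by_contra hlt
    exact (mem_support_iff.1 hβ) (hp β (by omega))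
  have hinj : Function.Injective T := by
    rw [← LinearMap.ker_eq_bot, LinearMap.ker_eq_bot']
    intro p hp
    have : ∀ n, p ∈ degreeBelow σ R n → p = 0 := by
      intro n
      induction n with
      | zero => exact eq_zero_of_mem_degreeBelow_zero
      | succ n ih =>
        intro h
        have := hTlow n p h
        rw [hp, zero_sub, neg_mem_iff] at this
        exact ih this
    obtain ⟨n, hn⟩ := exists_mem_degreeBelow p
    exact this n hn
  have hsurj : Function.Surjective T := by
    have : ∀ n, ∀ p ∈ degreeBelow σ R n, ∃ q, T q = p := by
      intro n
      induction n with
      | zero => exact fun p hp => ⟨0, by rw [eq_zero_of_mem_degreeBelow_zero hp, map_zero]⟩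
      | succ n ih =>
        intro p hp
        obtain ⟨q, hq⟩ := ih _ (hTlow n p hp)
        exact ⟨p - q, by rw [map_sub, hq]; ring⟩
    intro p
    obtain ⟨n, hn⟩ := exists_mem_degreeBelow p
    exact this n p hn
  let B : Module.Basis (σ →₀ ℕ) R (MvPolynomial σ R) :=
    (basisMonomials σ R).map (LinearEquiv.ofBijective T ⟨hinj, hsurj⟩)
  have hB : ∀ β, B β = b β := fun β => by
    simp only [B, Module.Basis.map_apply, coe_basisMonomials]
    exact hT β
  let s : Set (σ →₀ ℕ) := {β | ∃ i, D ≤ β i}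
  have hspan : Submodule.span R (B '' s) =
      (Ideal.span (Set.range f)).restrictScalars R := by
    apply le_antisymm
    · rw [Submodule.span_le]
      rintro _ ⟨β, ⟨i, hi⟩, rfl⟩
      rw [hB]
      simp only [b, Submodule.coe_restrictScalars, SetLike.mem_coe]
      refine Ideal.mem_of_dvd _ ((dvd_mul_of_dvd_left (dvd_pow_self (f i) ?_) _).trans
        (Finset.dvd_prod_of_mem _ (Finset.mem_univ i))) (Ideal.subset_span ⟨i, rfl⟩)
      exact (Nat.div_pos hi hD).ne'
    · intro x hx
      rw [Submodule.restrictScalars_mem] at hx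
      induction hx using Submodule.span_induction with
      | mem x hx =>
        obtain ⟨i, rfl⟩ := hx
        refine Submodule.subset_span ⟨Finsupp.single i D, ⟨i, by simp⟩, ?_⟩
        rw [hB]
        simp only [b]
        rw [Finset.prod_eq_single i]
        · simp [Nat.div_self hD]
        · intro j _ hj
          simp [Finsupp.single_eq_of_ne hj]
        · simp
      | zero => exact zero_mem _
      | add x y _ _ hx hy => exact add_mem hx hy
      | smul a x _ hx =>
        have ha : a ∈ Submodule.span R (Set.range B) := by rw [B.span_eq]; trivial
        refine Submodule.span_induction (p := fun x _ => a • x ∈ Submodule.span R (B '' s))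
          ?_ ?_ ?_ ?_ hx
        · rintro _ ⟨β, ⟨i, hi⟩, rfl⟩
          have hdvd : ∃ c, B β = c * f i := by
            rw [hB]
            simp only [b]
            obtain ⟨c, hc⟩ := ((dvd_mul_of_dvd_left (dvd_pow_self (f i)
              (Nat.div_pos hi hD).ne') _).trans (Finset.dvd_prod_of_mem
              (fun i => f i ^ (β i / D) * X i ^ (β i % D)) (Finset.mem_univ i)))
            exact ⟨c, by rw [hc, mul_comm]⟩
          obtain ⟨c, hc⟩ := hdvd
          rw [hc, smul_eq_mul, ← mul_assoc]
          have hac : a * c ∈ Submodule.span R (Set.range B) := by rw [B.span_eq]; trivial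
          refine Submodule.span_induction
            (p := fun x _ => x * f i ∈ Submodule.span R (B '' s)) ?_ ?_ ?_ ?_ hac
          · rintro _ ⟨γ, rfl⟩
            refine Submodule.subset_span ⟨γ + Finsupp.single i D, ⟨i, by simp⟩, ?_⟩
            rw [hB, hB]
            simp only [b]
            rw [← Finset.mul_prod_erase _ _ (Finset.mem_univ i),
              ← Finset.mul_prod_erase _ _ (Finset.mem_univ i),
              Finset.prod_congr (rfl : Finset.univ.erase i = Finset.univ.erase i)
                (g := fun j => f j ^ (γ j / D) * X j ^ (γ j % D))]
            · simp only [Finsupp.add_apply, Finsupp.single_eq_same, Nat.add_div_right _ hD,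
                Nat.add_mod_right, pow_succ]
              ring
            · intro j hj
              simp [Finsupp.single_eq_of_ne (Finset.ne_of_mem_erase hj)]
          · simp
          · intro x y _ _ hx hy
            rw [add_mul]
            exact add_mem hx hy
          · intro r x _ hx
            rw [smul_mul_assoc]
            exact Submodule.smul_mem _ _ hx
        · simp
        · intro x y _ _ hx hy
          rw [smul_add]
          exact add_mem hx hy
        · intro r x _ hx
          rw [smul_comm]
          exact Submodule.smul_mem _ _ hx
  obtain ⟨Q⟩ := nonempty_basis_quotient_span_image B s
  let e : (sᶜ : Set (σ →₀ ℕ)) ≃ (σ → Fin D) :=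
    { toFun := fun β i => ⟨β.1 i, by
        have := β.2
        simp only [s, Set.mem_compl_iff, Set.mem_ofPred_eq, not_exists, not_le] at this
        exact this i⟩
      invFun := fun g => ⟨Finsupp.equivFunOnFinite.symm fun i => (g i : ℕ), by
        simp [s]⟩
      left_inv := fun β => by ext; simp
      right_inv := fun g => by ext; simp }
  have q : (MvPolynomial σ R ⧸ Submodule.span R (B '' s)) ≃ₗ[R]
      (MvPolynomial σ R ⧸ Ideal.span (Set.range f)) :=
    (Submodule.quotEquivOfEq _ _ hspan).trans
      (Submodule.Quotient.restrictScalarsEquiv R (Ideal.span (Set.range f)))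
  exact ⟨(Q.map q).reindex e⟩

end MonicQuotient

/-- Let `M` be an `S`-module, regarded as a `K`-module along `φ : K →+* S`. It is triangular for
`p : S` with diagonal `e` if it has a `K`-basis in which multiplication by `p` is upper triangular
with diagonal entries `e i`. -/
def IsTriangular {K S : Type*} [CommRing K] [CommRing S] (φ : K →+* S) (p : S)
    (M : Type*) [AddCommGroup M] [Module S M] {ι : Type*} [LinearOrder ι] (e : ι → K) : Prop :=
  letI : Module K M := Module.compHom M φ
  ∃ v : Module.Basis ι K M, ∀ i, p • v i - e i • v i ∈ Submodule.span K (v '' Set.Iio i)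

section Triangular

/-- Cokernels of triangular endomorphisms of free `H`-modules are assembled from the quotients
`H ⧸ (h i)` by the diagonal entries, when these are non-zero-divisors. -/
theorem IsTriangular.coker {K H : Type*} [CommRing K] [CommRing H] (φ : K →+* H) (p : H)
    {C M : Type*} [AddCommGroup C] [Module H C] [AddCommGroup M] [Module H M]
    {ι κ : Type*} [LinearOrder ι] [LinearOrder κ] [Fintype ι] [Fintype κ]
    (e : Module.Basis ι H C) (Ψ : C →ₗ[H] C) (h : ι → H)
    (hΨ : ∀ i, Ψ (e i) - h i • e i ∈ Submodule.span H (e '' Set.Iio i))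
    (hreg : ∀ i, ∀ g : H, g * h i = 0 → g = 0)
    (π : C →ₗ[H] M) (hπ : Function.Surjective π)
    (hker : LinearMap.ker π = LinearMap.range Ψ)
    (E : ι → κ → K) (hE : ∀ i, IsTriangular φ p (H ⧸ Ideal.span {h i}) (E i)) :
    IsTriangular φ p M (fun x : ι ×ₗ κ => E (ofLex x).1 (ofLex x).2) := by
  classical
  let _ : Module K M := Module.compHom M φ
  let _ : ∀ i, Module K (H ⧸ Ideal.span {h i}) := fun i => Module.compHom _ φ
  have hK : ∀ (c : K) (x : M), c • x = φ c • x := fun _ _ => rfl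
  have hK' : ∀ i (c : K) (x : H ⧸ Ideal.span {h i}), c • x = φ c • x := fun _ _ _ => rfl
  choose v hv using hE
  have hlift : ∀ i j, ∃ u : H, Ideal.Quotient.mk (Ideal.span {h i}) u = v i j :=
    fun i j => Ideal.Quotient.mk_surjective _
  choose u hu using hlift
  let w : ι ×ₗ κ → M := fun x => π (u (ofLex x).1 (ofLex x).2 • e (ofLex x).1)
  let W : ι → Submodule K M := fun i => Submodule.span K (w '' {x | (ofLex x).1 < i})
  have hmk : ∀ i (f : κ → K), Ideal.Quotient.mk (Ideal.span {h i}) (∑ j, φ (f j) * u i j) =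
      ∑ j, f j • v i j := by
    intro i f
    rw [map_sum]
    refine Finset.sum_congr rfl fun j _ => ?_
    rw [map_mul, hu, hK', Algebra.smul_def]
    rfl
  have hred : ∀ i, ∀ (a : H) (f : κ → K),
      Ideal.Quotient.mk (Ideal.span {h i}) a = ∑ j, f j • v i j →
      π (a • e i) - ∑ j, f j • w (toLex (i, j)) ∈ W i := by
    intro i
    induction i using WellFoundedLT.induction with
    | ind i ih =>
      intro a f haf
      have hspan : ∀ x ∈ Submodule.span H (e '' Set.Iio i), ∀ g : H, π (g • x) ∈ W i := by
        intro x hx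
        induction hx using Submodule.span_induction with
        | mem x hx =>
          obtain ⟨l, hl, rfl⟩ := hx
          intro g
          have h1 := ih l hl g (v l |>.repr (Ideal.Quotient.mk _ g))
            ((v l).sum_repr _).symm
          have h2 : W l ≤ W i := Submodule.span_mono (Set.image_mono fun x hx =>
            lt_trans (show (ofLex x).1 < l from hx) hl)
          have h3 : ∑ j, (v l |>.repr (Ideal.Quotient.mk _ g)) j • w (toLex (l, j)) ∈ W i :=
            Submodule.sum_mem _ fun j _ => Submodule.smul_mem _ _
              (Submodule.subset_span ⟨_, hl, rfl⟩)
          simpa using add_mem (h2 h1) h3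
        | zero => intro g; simp
        | add x y _ _ hx hy =>
          intro g
          rw [smul_add, map_add]
          exact add_mem (hx g) (hy g)
        | smul c x _ hx =>
          intro g
          rw [smul_smul]
          exact hx _
      rw [← hmk, Ideal.Quotient.eq, Ideal.mem_span_singleton'] at haf
      obtain ⟨g, hg⟩ := haf
      have h0 : π (Ψ (g • e i)) = 0 := by
        have : Ψ (g • e i) ∈ LinearMap.ker π := hker ▸ ⟨_, rfl⟩
        exact this
      have hsum : ∑ j, f j • w (toLex (i, j)) = π ((∑ j, φ (f j) * u i j) • e i) := by
        rw [Finset.sum_smul, map_sum]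
        refine Finset.sum_congr rfl fun j _ => ?_
        rw [mul_smul, map_smul, hK]
        rfl
      have key := hspan _ (hΨ i) (-g)
      convert key using 1
      rw [hsum, ← map_sub, ← sub_smul, ← hg]
      rw [map_smul] at h0
      rw [neg_smul, smul_sub, map_neg, map_sub, h0, smul_smul]
      simp
  have hspanw : ⊤ ≤ Submodule.span K (Set.range w) := by
    rintro x -
    obtain ⟨c, rfl⟩ := hπ x
    rw [← e.sum_repr c, map_sum]
    refine Submodule.sum_mem _ fun i _ => ?_
    have h1 := hred i (e.repr c i) (v i |>.repr (Ideal.Quotient.mk _ (e.repr c i)))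
      ((v i).sum_repr _).symm
    have h2 : W i ≤ Submodule.span K (Set.range w) :=
      Submodule.span_mono (Set.image_subset_range _ _)
    have h3 : ∑ j, (v i |>.repr (Ideal.Quotient.mk _ (e.repr c i))) j • w (toLex (i, j)) ∈
        Submodule.span K (Set.range w) :=
      Submodule.sum_mem _ fun j _ => Submodule.smul_mem _ _ (Submodule.subset_span ⟨_, rfl⟩)
    simpa using add_mem (h2 h1) h3
  have hind : LinearIndependent K w := by
    rw [Fintype.linearIndependent_iff]
    intro f hf
    have hf' : π (∑ i, (∑ j, φ (f (toLex (i, j))) * u i j) • e i) = 0 := by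
      rw [← hf, map_sum, ← (toLex : ι × κ ≃ ι ×ₗ κ).sum_comp, Fintype.sum_prod_type]
      refine Finset.sum_congr rfl fun i _ => ?_
      rw [Finset.sum_smul, map_sum]
      refine Finset.sum_congr rfl fun j _ => ?_
      rw [mul_smul, map_smul, hK]
      rfl
    rw [← LinearMap.mem_ker, hker] at hf'
    obtain ⟨c, hc⟩ := hf'
    have hcoord : ∀ l i, l ≤ i → e.repr (Ψ (e l)) i = if l = i then h i else 0 := by
      intro l i hli
      have hz : e.repr (Ψ (e l) - h l • e l) i = 0 := by
        have := (Module.Basis.mem_span_image e).1 (hΨ l)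
        by_contra hne
        have := this (Finsupp.mem_support_iff.2 hne)
        exact absurd hli (not_le.2 this)
      rw [map_sub, Finsupp.sub_apply, sub_eq_zero] at hz
      rw [hz]
      simp only [map_smul, Module.Basis.repr_self, Finsupp.smul_single, smul_eq_mul, mul_one,
        Finsupp.single_apply]
      split_ifs with hli'
      · rw [hli']
      · rfl
    have hall : ∀ i, e.repr c i = 0 ∧ ∀ j, f (toLex (i, j)) = 0 := by
      intro i
      induction i using WellFoundedGT.induction with
      | ind i ih =>
        have h1 : e.repr (Ψ c) i = e.repr c i * h i := by
          conv_lhs => rw [← e.sum_repr c]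
          rw [map_sum, map_sum, Finset.sum_apply']
          rw [Finset.sum_eq_single i]
          · simp [hcoord i i le_rfl]
          · intro l _ hl
            rcases lt_or_gt_of_ne hl with hl' | hl'
            · simp [hcoord l i hl'.le, hl]
            · simp [(ih l hl').1]
          · simp
        rw [hc] at h1
        have h2 : ∑ j, φ (f (toLex (i, j))) * u i j = e.repr c i * h i := by
          rw [← h1, map_sum, Finset.sum_apply', Finset.sum_eq_single i]
          · simp
          · intro l _ hl
            simp [Finsupp.single_eq_of_ne hl.symm]
          · simp
        have h3 : ∑ j, f (toLex (i, j)) • v i j = 0 := by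
          rw [← hmk, h2, Ideal.Quotient.eq_zero_iff_mem, Ideal.mem_span_singleton']
          exact ⟨_, rfl⟩
        have h4 := Fintype.linearIndependent_iff.1 (v i).linearIndependent _ h3
        refine ⟨hreg i _ ?_, h4⟩
        rw [← h2]
        simp [h4]
    intro x
    exact (hall (ofLex x).1).2 (ofLex x).2
  refine ⟨Module.Basis.mk hind hspanw, fun x => ?_⟩
  simp only [Module.Basis.coe_mk]
  obtain ⟨⟨i, j⟩, rfl⟩ := (toLex : ι × κ ≃ ι ×ₗ κ).surjective x
  have hvij := hv i j
  obtain ⟨f, hf⟩ : ∃ f : κ → K, (∀ l, ¬ l < j → f l = 0) ∧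
      p • v i j - E i j • v i j = ∑ l, f l • v i l := by
    refine ⟨fun l => (v i).repr (p • v i j - E i j • v i j) l, fun l hl => ?_,
      ((v i).sum_repr _).symm⟩
    by_contra hne
    exact hl ((Module.Basis.mem_span_image (v i)).1 hvij (Finsupp.mem_support_iff.2 hne))
  have h1 := hred i (p * u i j - φ (E i j) * u i j) f (by
    rw [← hf.2, map_sub, map_mul, map_mul, hu, hK', Algebra.smul_def, Algebra.smul_def]
    rfl)
  have h2 : p • w (toLex (i, j)) - E i j • w (toLex (i, j)) =
      π ((p * u i j - φ (E i j) * u i j) • e i) := by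
    rw [sub_smul, mul_smul, mul_smul, map_sub, map_smul π p, map_smul π (φ _), hK]
    rfl
  change p • w (toLex (i, j)) - E i j • w (toLex (i, j)) ∈ _
  rw [h2]
  have h3 : W i ≤ Submodule.span K (w '' Set.Iio (toLex (i, j))) :=
    Submodule.span_mono (Set.image_mono fun y hy => by
      rw [Set.mem_Iio, Prod.Lex.lt_iff]
      exact Or.inl hy)
  have h4 : ∑ l, f l • w (toLex (i, l)) ∈ Submodule.span K (w '' Set.Iio (toLex (i, j))) := by
    refine Submodule.sum_mem _ fun l _ => ?_
    by_cases hl : l < j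
    · refine Submodule.smul_mem _ _ (Submodule.subset_span ⟨_, ?_, rfl⟩)
      rw [Set.mem_Iio, Prod.Lex.lt_iff]
      exact Or.inr ⟨rfl, hl⟩
    · rw [hf.1 l hl, zero_smul]
      exact zero_mem _
  simpa using add_mem (h3 h1) h4

end Triangular

/-- The endomorphism `f` is upper triangular with diagonal `e` in some basis. -/
def HasTriangularBasis {K M ι : Type*} [CommRing K] [AddCommGroup M] [Module K M]
    [LinearOrder ι] (f : M →ₗ[K] M) (e : ι → K) : Prop :=
  ∃ v : Module.Basis ι K M, ∀ i, f (v i) - e i • v i ∈ Submodule.span K (v '' Set.Iio i)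

namespace HasTriangularBasis

variable {K M ι : Type*} [CommRing K] [AddCommGroup M] [Module K M] [LinearOrder ι]

theorem reindex {ι' : Type*} [LinearOrder ι'] {f : M →ₗ[K] M} {e : ι → K}
    (h : HasTriangularBasis f e) (o : ι' ≃o ι) : HasTriangularBasis f (e ∘ o) := by
  obtain ⟨v, hv⟩ := h
  refine ⟨v.reindex o.symm.toEquiv, fun i => ?_⟩
  have h1 : (v.reindex o.symm.toEquiv : ι' → M) = v ∘ o := by
    ext j
    simp
  rw [h1, Set.image_comp, OrderIso.image_Iio]
  exact hv (o i)

theorem matrix_upper [Fintype ι] {f : M →ₗ[K] M} {e : ι → K} {v : Module.Basis ι K M}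
    (hv : ∀ i, f (v i) - e i • v i ∈ Submodule.span K (v '' Set.Iio i)) (i j : ι) (hij : j ≤ i) :
    LinearMap.toMatrix v v f i j = if i = j then e i else 0 := by
  have h1 : v.repr (f (v j) - e j • v j) i = 0 := by
    by_contra hne
    exact absurd hij (not_le.2 ((Module.Basis.mem_span_image v).1 (hv j)
      (Finsupp.mem_support_iff.2 hne)))
  rw [map_sub, Finsupp.sub_apply, sub_eq_zero] at h1
  rw [LinearMap.toMatrix_apply, h1]
  rcases eq_or_ne i j with rfl | hne
  · simp
  · simp [hne]

theorem charpoly_eq [Fintype ι] [Module.Finite K M] [Module.Free K M] {f : M →ₗ[K] M} {e : ι → K}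
    (h : HasTriangularBasis f e) : f.charpoly = ∏ i, (Polynomial.X - Polynomial.C (e i)) := by
  obtain ⟨v, hv⟩ := h
  rw [← LinearMap.charpoly_toMatrix f v, Matrix.charpoly_of_isUpperTriangular]
  · simp [matrix_upper hv]
  · intro i j hij
    rw [matrix_upper hv i j (le_of_lt hij), if_neg (ne_of_gt (show j < i from hij))]

theorem extension {κ : Type*} [LinearOrder κ] {f : M →ₗ[K] M} (N : Submodule K M)
    (hN : N ≤ N.comap f) {e₁ : ι → K} {e₂ : κ → K}
    (h₁ : HasTriangularBasis (f.restrict hN) e₁) (h₂ : HasTriangularBasis (N.mapQ N f hN) e₂) :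
    HasTriangularBasis f (fun x : ι ⊕ₗ κ => Sum.elim e₁ e₂ (ofLex x)) := by
  obtain ⟨v, hv⟩ := h₁
  obtain ⟨w, hw⟩ := h₂
  let b : Module.Basis (ι ⊕ₗ κ) K M := (Module.Basis.sumQuot v w).reindex toLex
  have hinl : ∀ i, b (toLex (Sum.inl i)) = v i := fun i => by simp [b]
  have hinr : ∀ i, N.mkQ (b (toLex (Sum.inr i))) = w i := fun i => by simp [b]
  refine ⟨b, fun x => ?_⟩
  obtain ⟨x, rfl⟩ := (toLex : ι ⊕ κ ≃ ι ⊕ₗ κ).surjective x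
  rcases x with i | i
  · have h1 := Submodule.mem_map_of_mem (f := N.subtype) (hv i)
    rw [Submodule.map_span, ← Set.image_comp] at h1
    simp only [hinl, ofLex_toLex, Sum.elim_inl]
    refine Submodule.span_mono ?_ h1
    rintro _ ⟨j, hj, rfl⟩
    exact ⟨toLex (Sum.inl j), Sum.Lex.inl_lt_inl_iff.2 hj, hinl j⟩
  · have hNle : N ≤ Submodule.span K (b '' Set.Iio (toLex (Sum.inr i))) := by
      intro y hy
      have h1 : (⟨y, hy⟩ : N) ∈ Submodule.span K (Set.range v) := by
        rw [v.span_eq]; trivial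
      have h2 := Submodule.mem_map_of_mem (f := N.subtype) h1
      rw [Submodule.map_span, ← Set.range_comp] at h2
      refine Submodule.span_mono ?_ h2
      rintro _ ⟨j, rfl⟩
      exact ⟨toLex (Sum.inl j), Sum.Lex.inl_lt_inr _ _, hinl j⟩
    have h1 : N.mkQ (f (b (toLex (Sum.inr i))) - e₂ i • b (toLex (Sum.inr i))) ∈
        Submodule.map N.mkQ (Submodule.span K (b '' Set.Iio (toLex (Sum.inr i)))) := by
      rw [Submodule.map_span, ← Set.image_comp, map_sub, map_smul, hinr]
      have h3 : N.mkQ (f (b (toLex (Sum.inr i)))) = N.mapQ N f hN (w i) := by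
        rw [← hinr]; rfl
      rw [h3]
      refine Submodule.span_mono ?_ (hw i)
      rintro _ ⟨j, hj, rfl⟩
      exact ⟨toLex (Sum.inr j), Sum.Lex.inr_lt_inr_iff.2 hj, hinr j⟩
    obtain ⟨z, hz, hz'⟩ := h1
    rw [← sub_eq_zero, ← map_sub, ← LinearMap.mem_ker, Submodule.ker_mkQ] at hz'
    have h4 := sub_mem hz (hNle hz')
    simpa using h4

end HasTriangularBasis

section Nilpotent

variable {K : Type*} [CommRing K] [IsDomain K] [IsPrincipalIdealRing K]

/-- A nilpotent endomorphism of a finite torsion-free module over a principal ideal domain is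
strictly upper triangular in some basis. -/
theorem exists_hasTriangularBasis_of_pow_eq_zero (N : ℕ) :
    ∀ (M : Type*) [AddCommGroup M] [Module K M] [Module.Finite K M] [Module.IsTorsionFree K M]
      (f : M →ₗ[K] M), (∀ x, (f ^ N) x = 0) →
      ∃ r : ℕ, HasTriangularBasis f (fun _ : Fin r => (0 : K)) := by
  induction N with
  | zero =>
    intro M _ _ _ _ f hf
    have : Subsingleton M := ⟨fun x y => by simpa using (hf x).trans (hf y).symm⟩
    exact ⟨0, Module.Basis.empty M, fun i => i.elim0⟩
  | succ N ih =>
    intro M _ _ _ _ f hf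
    have hN : LinearMap.ker f ≤ (LinearMap.ker f).comap f := fun x hx => by
      simp [LinearMap.mem_ker.1 hx]
    have : Module.IsTorsionFree K (M ⧸ LinearMap.ker f) :=
      f.quotKerEquivRange.injective.moduleIsTorsionFree _ (fun c x => map_smul _ c x)
    obtain ⟨r, hr⟩ := ih (M ⧸ LinearMap.ker f) ((LinearMap.ker f).mapQ _ f hN) (by
      intro x
      obtain ⟨x, rfl⟩ := (LinearMap.ker f).mkQ_surjective x
      have h1 : ∀ n (x : M), (((LinearMap.ker f).mapQ _ f hN) ^ n) ((LinearMap.ker f).mkQ x) =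
          (LinearMap.ker f).mkQ ((f ^ n) x) := by
        intro n
        induction n with
        | zero => intro x; simp
        | succ n ihn =>
          intro x
          rw [pow_succ', pow_succ', Module.End.mul_apply, Module.End.mul_apply, ihn]
          rfl
      rw [h1, ← LinearMap.mem_ker, Submodule.ker_mkQ, LinearMap.mem_ker,
        ← Module.End.mul_apply, ← pow_succ']
      exact hf x)
    have h2 : HasTriangularBasis (f.restrict hN)
        (fun _ : Fin (Module.finrank K (LinearMap.ker f)) => (0 : K)) := by
      refine ⟨Module.finBasis K (LinearMap.ker f), fun i => ?_⟩
      have h3 : ∀ y : LinearMap.ker f, f.restrict hN y = (0 : LinearMap.ker f) :=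
        fun y => Subtype.ext y.2
      rw [h3]
      simp
    have h4 := HasTriangularBasis.extension _ hN h2 hr
    have h5 := h4.reindex (Fintype.orderIsoFinOfCardEq _ rfl)
    refine ⟨Fintype.card (Fin (Module.finrank K (LinearMap.ker f)) ⊕ₗ Fin r), ?_⟩
    convert h5 with i
    exact (Sum.rec (fun _ => rfl) (fun _ => rfl) :
      ∀ x : Fin (Module.finrank K (LinearMap.ker f)) ⊕ Fin r,
        (0 : K) = Sum.elim (fun _ => 0) (fun _ => 0) x) _

/-- An endomorphism `f` of a finite torsion-free module over a principal ideal domain with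
`f ^ N * (f - c) = 0` is upper triangular in some basis, the diagonal consisting of entries `c`
followed by entries `0`. -/
theorem exists_hasTriangularBasis_of_pow_mul_sub {M : Type*} [AddCommGroup M] [Module K M]
    [Module.Finite K M] [Module.IsTorsionFree K M] (N : ℕ) (c : K) (f : M →ₗ[K] M)
    (hf : ∀ x, f ((f ^ N) x) = c • (f ^ N) x) :
    ∃ r₁ r₀ : ℕ, HasTriangularBasis f
      (fun x : Fin r₁ ⊕ₗ Fin r₀ => Sum.elim (fun _ => c) (fun _ => 0) (ofLex x)) := by
  let g : M →ₗ[K] M := f - c • LinearMap.id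
  have hg : ∀ x, g x = f x - c • x := fun x => rfl
  have hN : LinearMap.ker g ≤ (LinearMap.ker g).comap f := fun x hx => by
    rw [LinearMap.mem_ker, hg, sub_eq_zero] at hx
    rw [Submodule.mem_comap, LinearMap.mem_ker, hx, map_smul, hg, hx, sub_self, smul_zero]
  have : Module.IsTorsionFree K (M ⧸ LinearMap.ker g) :=
    g.quotKerEquivRange.injective.moduleIsTorsionFree _ (fun c x => map_smul _ c x)
  obtain ⟨r₀, hr₀⟩ := exists_hasTriangularBasis_of_pow_eq_zero (K := K) N (M ⧸ LinearMap.ker g)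
    ((LinearMap.ker g).mapQ _ f hN) (by
      intro x
      obtain ⟨x, rfl⟩ := (LinearMap.ker g).mkQ_surjective x
      have h1 : ∀ n (x : M), (((LinearMap.ker g).mapQ _ f hN) ^ n) ((LinearMap.ker g).mkQ x) =
          (LinearMap.ker g).mkQ ((f ^ n) x) := by
        intro n
        induction n with
        | zero => intro x; simp
        | succ n ihn =>
          intro x
          rw [pow_succ', pow_succ', Module.End.mul_apply, Module.End.mul_apply, ihn]
          rfl
      rw [h1, ← LinearMap.mem_ker, Submodule.ker_mkQ, LinearMap.mem_ker, hg, hf, sub_self])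
  refine ⟨Module.finrank K (LinearMap.ker g), r₀, ?_⟩
  refine HasTriangularBasis.extension _ hN ⟨Module.finBasis K (LinearMap.ker g), fun i => ?_⟩ hr₀
  have h3 : ∀ y : LinearMap.ker g, f.restrict hN y = c • y :=
    fun y => Subtype.ext (sub_eq_zero.1 ((hg y).symm.trans y.2))
  rw [h3, sub_self]
  exact zero_mem _

end Nilpotent

section TriangularModule

variable {K S M ι : Type*} [CommRing K] [CommRing S] [AddCommGroup M] [Module S M]
  [LinearOrder ι] {φ : K →+* S} {p : S} {e : ι → K}

theorem isTriangular_iff [inst : Module K M] (h : ∀ (c : K) (x : M), c • x = φ c • x) :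
    IsTriangular φ p M e ↔ ∃ v : Module.Basis ι K M,
      ∀ i, p • v i - e i • v i ∈ Submodule.span K (v '' Set.Iio i) := by
  have h1 : inst = Module.compHom M φ := by
    refine Module.ext' _ _ fun c x => ?_
    exact h c x
  subst h1
  rfl

/-- Transfer of triangularity along an isomorphism. -/
theorem IsTriangular.of_equiv {S' M' : Type*} [CommRing S'] [AddCommGroup M'] [Module S' M']
    {φ' : K →+* S'} {p' : S'} (h : IsTriangular φ p M e) (g : M ≃+ M')
    (hg : ∀ c x, g (φ c • x) = φ' c • g x) (hp : ∀ x, g (p • x) = p' • g x) :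
    IsTriangular φ' p' M' e := by
  let _ : Module K M := Module.compHom M φ
  let _ : Module K M' := Module.compHom M' φ'
  obtain ⟨v, hv⟩ := h
  let g' : M ≃ₗ[K] M' := { g with map_smul' := fun c x => hg c x }
  refine ⟨v.map g', fun i => ?_⟩
  have h1 := Submodule.mem_map_of_mem (f := g'.toLinearMap) (hv i)
  rw [Submodule.map_span, ← Set.image_comp] at h1
  have h2 : (g' : M →ₗ[K] M') (p • v i - e i • v i) = p' • g' (v i) - e i • g' (v i) := by
    rw [map_sub, map_smul (g' : M →ₗ[K] M')]
    congr 1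
    exact hp _
  rw [h2] at h1
  have h3 : (v.map g' : ι → M') = g' ∘ v := by ext; simp
  rw [h3]
  exact h1

end TriangularModule

section Specialization

variable {B A ι : Type*} [CommRing B] [Algebra ℂ B] [CommRing A] [Algebra ℂ A]
  [LinearOrder ι]

/-- Specialization of a triangular algebra over `ℂ[t]` at `t = 1`. -/
theorem IsTriangular.specialize [Fintype ι] {t p : B} {e : ι → Polynomial ℂ}
    (h : IsTriangular (Polynomial.aeval (R := ℂ) t).toRingHom p B e)
    (ρ : B →ₐ[ℂ] A) (hρ : Function.Surjective ρ) (hker : ∀ x, ρ x = 0 ↔ ∃ y, x = (t - 1) * y) :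
    IsTriangular (algebraMap ℂ A) (ρ p) A (fun i => (e i).eval 1) := by
  classical
  rw [isTriangular_iff (fun c x => Algebra.smul_def c x)]
  let _ : Module (Polynomial ℂ) B :=
    Module.compHom B (Polynomial.aeval (R := ℂ) t).toRingHom
  have hK : ∀ (c : Polynomial ℂ) (x : B), c • x = Polynomial.aeval t c * x := fun _ _ => rfl
  obtain ⟨v, hv⟩ := h
  have ht : ρ t = 1 := by
    have := (hker (t - 1)).2 ⟨1, by simp⟩
    rwa [map_sub, map_one, sub_eq_zero] at this
  have hsm : ∀ (c : Polynomial ℂ) (x : B), ρ (c • x) = c.eval 1 • ρ x := by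
    intro c x
    rw [hK, map_mul, ← Polynomial.aeval_algHom_apply, ht, Algebra.smul_def,
      ← Polynomial.aeval_algebraMap_apply_eq_algebraMap_eval, map_one]
  have hmem : ∀ s : Set ι, ∀ x ∈ Submodule.span (Polynomial ℂ) (v '' s),
      ρ x ∈ Submodule.span ℂ ((fun i => ρ (v i)) '' s) := by
    intro s x hx
    induction hx using Submodule.span_induction with
    | mem x hx =>
      obtain ⟨i, hi, rfl⟩ := hx
      exact Submodule.subset_span ⟨i, hi, rfl⟩
    | zero => simp
    | add x y _ _ hx hy => rw [map_add]; exact add_mem hx hy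
    | smul c x _ hx => rw [hsm]; exact Submodule.smul_mem _ _ hx
  have hspan : ⊤ ≤ Submodule.span ℂ (Set.range fun i => ρ (v i)) := by
    rintro x -
    obtain ⟨x, rfl⟩ := hρ x
    rw [← Set.image_univ]
    refine hmem _ _ ?_
    rw [Set.image_univ, v.span_eq]
    trivial
  have hind : LinearIndependent ℂ fun i => ρ (v i) := by
    rw [Fintype.linearIndependent_iff]
    intro f hf i
    have h1 : ρ (∑ i, Polynomial.C (f i) • v i) = 0 := by
      simp [map_sum, hsm, hf]
    obtain ⟨y, hy⟩ := (hker _).1 h1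
    have h2 : (t - 1) * y = (Polynomial.X - 1 : Polynomial ℂ) • y := by simp [hK]
    rw [h2] at hy
    have h3 := congrArg (fun z => (v.repr z i).eval 1) hy
    simpa [Finsupp.single_apply] using h3
  refine ⟨Module.Basis.mk hind hspan, fun i => ?_⟩
  have h1 := hmem _ _ (hv i)
  rw [map_sub, hsm, smul_eq_mul, map_mul] at h1
  simpa using h1

theorem IsTriangular.hasTriangularBasis_mulLeft {p : A} {e : ι → ℂ}
    (h : IsTriangular (algebraMap ℂ A) p A e) : HasTriangularBasis (LinearMap.mulLeft ℂ p) e := by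
  rw [isTriangular_iff (fun c x => Algebra.smul_def c x)] at h
  exact h

theorem IsTriangular.finite [Finite ι] {p : A} {e : ι → ℂ}
    (h : IsTriangular (algebraMap ℂ A) p A e) : FiniteDimensional ℂ A := by
  obtain ⟨v, -⟩ := h.hasTriangularBasis_mulLeft
  exact Module.Basis.finiteDimensional_of_finite v

theorem IsTriangular.det_mulLeft_sub [Fintype ι] {p : A} {e : ι → ℂ}
    (h : IsTriangular (algebraMap ℂ A) p A e) (c : ℂ) :
    LinearMap.det (LinearMap.mulLeft ℂ (algebraMap ℂ A c - p)) = ∏ i, (c - e i) := by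
  have := h.finite
  have h1 := h.hasTriangularBasis_mulLeft.charpoly_eq
  have h2 := LinearMap.eval_charpoly (LinearMap.mulLeft ℂ p) c
  rw [h1, Polynomial.eval_prod] at h2
  simp only [Polynomial.eval_sub, Polynomial.eval_X, Polynomial.eval_C] at h2
  rw [h2]
  congr 1
  ext x
  simp [Algebra.smul_def, sub_mul]

end Specialization

section StarAlgebra

variable {σ R : Type*} [Fintype σ] [DecidableEq σ] [CommRing R]

/-- The polynomial `x_i ^ D - u_i ∏_{j ≠ i} x_j`. -/
noncomputable def starPoly (D : ℕ) (u : σ → R) (i : σ) : MvPolynomial σ R :=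
  X i ^ D - C (u i) * ∏ j ∈ univ.erase i, X j

/-- The `R`-algebra generated by `x_i`, `i : σ`, with relations `x_i ^ D = u_i ∏_{j ≠ i} x_j`. -/
def StarAlgebra (D : ℕ) (u : σ → R) : Type _ :=
  MvPolynomial σ R ⧸ Ideal.span (Set.range (starPoly D u))

noncomputable instance (D : ℕ) (u : σ → R) : CommRing (StarAlgebra D u) :=
  inferInstanceAs (CommRing (MvPolynomial σ R ⧸ Ideal.span (Set.range (starPoly D u))))

noncomputable instance (D : ℕ) (u : σ → R) {k : Type*} [CommSemiring k] [Algebra k R] :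
    Algebra k (StarAlgebra D u) :=
  inferInstanceAs (Algebra k (MvPolynomial σ R ⧸ Ideal.span (Set.range (starPoly D u))))

instance (D : ℕ) (u : σ → R) {k : Type*} [CommSemiring k] [Algebra k R] :
    IsScalarTower k R (StarAlgebra D u) :=
  inferInstanceAs (IsScalarTower k R (MvPolynomial σ R ⧸ Ideal.span (Set.range (starPoly D u))))

namespace StarAlgebra

variable {D : ℕ} {u : σ → R}

/-- The generators of a star algebra. -/
noncomputable def gen (D : ℕ) (u : σ → R) (i : σ) : StarAlgebra D u :=
  Ideal.Quotient.mk (Ideal.span (Set.range (starPoly D u))) (X i)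

theorem gen_pow (i : σ) :
    gen D u i ^ D = algebraMap R _ (u i) * ∏ j ∈ univ.erase i, gen D u j := by
  have h : starPoly D u i ∈ Ideal.span (Set.range (starPoly D u)) :=
    Ideal.subset_span ⟨i, rfl⟩
  rw [← Ideal.Quotient.eq_zero_iff_mem, starPoly, map_sub, sub_eq_zero, map_mul, map_pow,
    map_prod] at h
  exact h

theorem gen_pow_succ (i : σ) :
    gen D u i ^ (D + 1) = algebraMap R _ (u i) * ∏ j, gen D u j := by
  rw [pow_succ, gen_pow, mul_assoc, Finset.prod_erase_mul _ _ (Finset.mem_univ i)]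

theorem nonempty_basis (hD : 0 < D) (hσ : Fintype.card σ ≤ D) :
    Nonempty (Module.Basis (σ → Fin D) R (StarAlgebra D u)) := by
  refine nonempty_basis_quotient_monic hD (starPoly D u) fun i => ?_
  have h1 : starPoly D u i - X i ^ D =
      monomial (∑ j ∈ univ.erase i, Finsupp.single j 1) (- u i) := by
    rw [starPoly, sub_sub_cancel_left, monomial_sum_index]
    simp [X]
  rw [h1]
  refine degreeBelow_mono ?_ (monomial_mem_degreeBelow _ _)
  rw [map_sum]
  have : 0 < Fintype.card σ := Fintype.card_pos_iff.2 ⟨i⟩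
  simp [Finset.card_erase_of_mem]
  omega

variable {S : Type*} [CommRing S] [Algebra ℂ S] [Algebra ℂ R]

theorem exists_lift (ψ : R →ₐ[ℂ] S) (s : σ → S)
    (h : ∀ i, s i ^ D = ψ (u i) * ∏ j ∈ univ.erase i, s j) :
    ∃ f : StarAlgebra D u →ₐ[ℂ] S, (∀ i, f (gen D u i) = s i) ∧
      ∀ c, f (algebraMap R _ c) = ψ c := by
  let g : MvPolynomial σ R →ₐ[ℂ] S :=
    { eval₂Hom (ψ : R →+* S) s with
      commutes' := fun c => by
        simp [IsScalarTower.algebraMap_apply ℂ R (MvPolynomial σ R), MvPolynomial.algebraMap_eq] }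
  have hg : ∀ i, g (X i) = s i := fun i => by simp [g]
  have hg' : ∀ c, g (C c) = ψ c := fun i => by simp [g]
  refine ⟨Ideal.Quotient.liftₐ _ g ?_, fun i => ?_, fun c => ?_⟩
  · intro x hx
    rw [← RingHom.mem_ker]
    refine (Ideal.span_le.2 ?_ : Ideal.span _ ≤ RingHom.ker g) hx
    rintro _ ⟨i, rfl⟩
    rw [SetLike.mem_coe, RingHom.mem_ker, starPoly, map_sub, map_mul, map_pow, map_prod, hg, hg',
      h i, sub_eq_zero]
    simp [hg]
  · exact hg i
  · exact hg' c

theorem hom_ext {f g : StarAlgebra D u →ₐ[ℂ] S} (h : ∀ i, f (gen D u i) = g (gen D u i))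
    (h' : ∀ c, f (algebraMap R _ c) = g (algebraMap R _ c)) : f = g := by
  refine AlgHom.coe_ringHom_injective (Ideal.Quotient.ringHom_ext (MvPolynomial.ringHom_ext ?_ ?_))
  · exact h'
  · exact h

end StarAlgebra

end StarAlgebra

section EdgeAlgebra

open StarAlgebra

/-- The algebra `ℂ[t][x_0, …, x_m] / (x_i ^ (m + 1) - a_i t ∏_{j ≠ i} x_j)`. -/
abbrev EdgeAlgebra (m : ℕ) (a : Option (Fin m) → ℂ) : Type :=
  StarAlgebra (m + 1) fun i => Polynomial.C (a i) * (Polynomial.X : Polynomial ℂ)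

namespace EdgeAlgebra

variable {m : ℕ} {a : Option (Fin m) → ℂ}

/-- The generators of the edge algebra. -/
noncomputable abbrev x (m : ℕ) (a : Option (Fin m) → ℂ) (i : Option (Fin m)) : EdgeAlgebra m a :=
  gen _ _ i

/-- The parameter of the edge algebra. -/
noncomputable abbrev t (m : ℕ) (a : Option (Fin m) → ℂ) : EdgeAlgebra m a :=
  algebraMap (Polynomial ℂ) _ Polynomial.X

theorem algebraMap_relation (i : Option (Fin m)) :
    algebraMap (Polynomial ℂ) (EdgeAlgebra m a) (Polynomial.C (a i) * Polynomial.X) =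
      algebraMap ℂ _ (a i) * t m a := by
  rw [map_mul, t]
  congr 1

theorem prod_pow_mul (m : ℕ) (a : Option (Fin m) → ℂ) :
    (∏ i, x m a i) ^ (m + 1) * ∏ i, x m a i =
      algebraMap (Polynomial ℂ) _ (Polynomial.C (∏ i, a i) * Polynomial.X ^ (m + 1)) *
        (∏ i, x m a i) ^ (m + 1) := by
  rw [← pow_succ, ← Finset.prod_pow]
  simp_rw [x, gen_pow_succ]
  rw [Finset.prod_mul_distrib, ← map_prod, Finset.prod_mul_distrib, ← map_prod]
  simp

theorem exists_lift {S : Type*} [CommRing S] [Algebra ℂ S] (τ : S) (s : Option (Fin m) → S)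
    (h : ∀ i, s i ^ (m + 1) = algebraMap ℂ S (a i) * τ * ∏ j ∈ univ.erase i, s j) :
    ∃ f : EdgeAlgebra m a →ₐ[ℂ] S, (∀ i, f (x m a i) = s i) ∧ f (t m a) = τ := by
  obtain ⟨f, hf, hf'⟩ := StarAlgebra.exists_lift (D := m + 1)
    (u := fun i => Polynomial.C (a i) * (Polynomial.X : Polynomial ℂ))
    (Polynomial.aeval τ) s (fun i => by rw [h i]; simp)
  exact ⟨f, hf, by rw [hf']; simp⟩

theorem hom_ext {S : Type*} [CommRing S] [Algebra ℂ S] {f g : EdgeAlgebra m a →ₐ[ℂ] S}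
    (h : ∀ i, f (x m a i) = g (x m a i)) (ht : f (t m a) = g (t m a)) : f = g := by
  refine StarAlgebra.hom_ext h fun c => ?_
  have h1 : f.comp (IsScalarTower.toAlgHom ℂ (Polynomial ℂ) _) =
      g.comp (IsScalarTower.toAlgHom ℂ (Polynomial ℂ) _) := Polynomial.algHom_ext ht
  exact DFunLike.congr_fun h1 c

/-- The fibre of the edge algebra at `t = 1`. -/
abbrev Fibre (m : ℕ) (a : Option (Fin m) → ℂ) : Type := EdgeAlgebra m a ⧸ Ideal.span {t m a - 1}

/-- The product of the generators in the fibre. -/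
noncomputable abbrev Fibre.p (m : ℕ) (a : Option (Fin m) → ℂ) : Fibre m a :=
  Ideal.Quotient.mkₐ ℂ _ (∏ i, x m a i)

/-- The non-nilpotent part of the fibre has dimension `(m + 2) ^ m`. -/
theorem Fibre.finrank_quotient (ha : ∀ i, a i ≠ 0) :
    Module.finrank ℂ (Fibre m a ⧸
      (Ideal.span {Fibre.p m a - algebraMap ℂ _ (∏ i, a i)} : Ideal (Fibre m a))) =
        (m + 2) ^ m := by
  set q := ∏ i, a i with hq
  have hq0 : q ≠ 0 := Finset.prod_ne_zero_iff.2 fun i _ => ha i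
  let I : Ideal (MvPolynomial (Fin m) ℂ) :=
    Ideal.span (Set.range fun i : Fin m => X i ^ (m + 2) - C (q * a (some i)))
  obtain ⟨b⟩ : Nonempty (Module.Basis (Fin m → Fin (m + 2)) ℂ (MvPolynomial (Fin m) ℂ ⧸ I)) := by
    refine nonempty_basis_quotient_monic (by omega) _ fun i => ?_
    rw [sub_sub_cancel_left, ← map_neg, C_apply]
    refine degreeBelow_mono ?_ (monomial_mem_degreeBelow _ _)
    simp
  have hdim : Module.finrank ℂ (MvPolynomial (Fin m) ℂ ⧸ I) = (m + 2) ^ m := by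
    rw [Module.finrank_eq_card_basis b]
    simp
  rw [← hdim]
  let W := MvPolynomial (Fin m) ℂ ⧸ I
  let Z := Fibre m a ⧸
    (Ideal.span {Fibre.p m a - algebraMap ℂ _ q} : Ideal (Fibre m a))
  let ρ : EdgeAlgebra m a →ₐ[ℂ] Z := (Ideal.Quotient.mkₐ ℂ _).comp (Ideal.Quotient.mkₐ ℂ _)
  let z : Fin m → W := fun i => Ideal.Quotient.mk _ (X i)
  have hz : ∀ i, z i ^ (m + 2) = algebraMap ℂ W (q * a (some i)) := by
    intro i
    have h : X i ^ (m + 2) - C (q * a (some i)) ∈ I := Ideal.subset_span ⟨i, rfl⟩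
    rw [← Ideal.Quotient.eq_zero_iff_mem, map_sub, sub_eq_zero, map_pow] at h
    exact h
  let w : W := algebraMap ℂ W q * ∏ i, (z i ^ (m + 1) * algebraMap ℂ W (q * a (some i))⁻¹)
  have hunit : ∀ c : ℂ, c ≠ 0 → IsUnit (algebraMap ℂ W c) := fun c hc => (Ne.isUnit hc).map _
  have hunitZ : ∀ c : ℂ, c ≠ 0 → IsUnit (algebraMap ℂ Z c) := fun c hc => (Ne.isUnit hc).map _
  have hw : w * ∏ i, z i = algebraMap ℂ W q := by
    have h1 : ∀ i, z i ^ (m + 1) * algebraMap ℂ W (q * a (some i))⁻¹ * z i = 1 := by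
      intro i
      rw [mul_right_comm, ← pow_succ, hz, ← map_mul,
        mul_inv_cancel₀ (mul_ne_zero hq0 (ha _)), map_one]
    simp only [w]
    rw [mul_assoc, ← Finset.prod_mul_distrib, Finset.prod_congr rfl fun i _ => h1 i]
    simp
  have hw' : w ^ (m + 2) = algebraMap ℂ W (q * a none) := by
    have h1 : w ^ (m + 2) * algebraMap ℂ W (∏ i, q * a (some i)) =
        algebraMap ℂ W (q * a none) * algebraMap ℂ W (∏ i, q * a (some i)) := by
      have h2 : algebraMap ℂ W (∏ i, q * a (some i)) = (∏ i, z i) ^ (m + 2) := by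
        rw [map_prod, ← Finset.prod_pow]
        exact Finset.prod_congr rfl fun i _ => (hz i).symm
      rw [h2, ← mul_pow, hw, ← h2, ← map_mul, ← map_pow]
      congr 1
      rw [Finset.prod_mul_distrib, hq, Fintype.prod_option]
      simp
      ring
    refine (hunit _ ?_).mul_right_cancel h1
    exact Finset.prod_ne_zero_iff.2 fun i _ => mul_ne_zero hq0 (ha _)
  let s : Option (Fin m) → W := fun i => i.elim w z
  have hs : ∏ i, s i = algebraMap ℂ W q := by
    rw [Fintype.prod_option]
    exact hw
  have hs' : ∀ i, s i ^ (m + 2) = algebraMap ℂ W (q * a i) := by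
    rintro (_ | i)
    · exact hw'
    · exact hz i
  obtain ⟨F, hF, hFt⟩ := exists_lift (a := a) (1 : W) s (by
    intro i
    have hu : IsUnit (s i) := by
      have h1 := hunit _ (mul_ne_zero hq0 (ha i))
      rw [← hs' i] at h1
      exact (isUnit_pow_iff (by omega)).1 h1
    refine hu.mul_right_cancel ?_
    rw [← pow_succ, hs', mul_assoc, Finset.prod_erase_mul _ _ (Finset.mem_univ i), hs]
    simp [mul_comm])
  let F' : Fibre m a →ₐ[ℂ] W := Ideal.Quotient.liftₐ _ F (by
    intro y hy
    obtain ⟨y, rfl⟩ := Ideal.mem_span_singleton'.1 hy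
    simp [hFt])
  have hF' : ∀ y, F' (Ideal.Quotient.mkₐ ℂ _ y) = F y := fun y => rfl
  have hF'p : F' (Fibre.p m a) = algebraMap ℂ W q := by
    rw [hF', map_prod, ← hs]
    exact Finset.prod_congr rfl fun i _ => hF i
  let F'' : Z →ₐ[ℂ] W := Ideal.Quotient.liftₐ _ F' (by
    intro y hy
    obtain ⟨y, rfl⟩ := Ideal.mem_span_singleton'.1 hy
    rw [map_mul, map_sub, hF'p, AlgHom.commutes, sub_self, mul_zero])
  have hF'' : ∀ y, F'' (ρ y) = F y := fun y => rfl
  have hρt : ρ (t m a) = 1 := by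
    have h1 : Ideal.Quotient.mkₐ ℂ (Ideal.span {t m a - 1}) (t m a - 1) = 0 :=
      Ideal.Quotient.eq_zero_iff_mem.2 (Ideal.mem_span_singleton_self _)
    rw [map_sub, map_one, sub_eq_zero] at h1
    simp only [ρ]
    rw [AlgHom.comp_apply, h1, map_one]
  have hρp : ∏ i, ρ (x m a i) = algebraMap ℂ Z q := by
    have h1 : Ideal.Quotient.mkₐ ℂ (Ideal.span {Fibre.p m a - algebraMap ℂ (Fibre m a) q})
        (Fibre.p m a - algebraMap ℂ (Fibre m a) q) = 0 :=
      Ideal.Quotient.eq_zero_iff_mem.2 (Ideal.mem_span_singleton_self _)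
    rw [map_sub, sub_eq_zero, AlgHom.commutes] at h1
    rw [← map_prod]
    exact h1
  let G₀ : MvPolynomial (Fin m) ℂ →ₐ[ℂ] Z := aeval fun i => ρ (x m a (some i))
  let G : W →ₐ[ℂ] Z := Ideal.Quotient.liftₐ _ G₀ (by
    intro y hy
    rw [← RingHom.mem_ker]
    refine (Ideal.span_le.2 ?_ : Ideal.span _ ≤ RingHom.ker G₀) hy
    rintro _ ⟨i, rfl⟩
    rw [SetLike.mem_coe, RingHom.mem_ker, map_sub, map_pow, sub_eq_zero]
    simp only [G₀, aeval_X, aeval_C]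
    rw [← map_pow, x, gen_pow_succ, map_mul, map_prod ρ, hρp, algebraMap_relation, map_mul, hρt,
      AlgHom.commutes, mul_one, ← map_mul, mul_comm])
  have hG : ∀ i, G (z i) = ρ (x m a (some i)) := fun i => by
    change G₀ (X i) = _
    simp [G₀]
  have hFG : F''.comp G = AlgHom.id ℂ W := by
    refine Ideal.Quotient.algHom_ext _ (MvPolynomial.algHom_ext fun i => ?_)
    change F'' (G (z i)) = z i
    rw [hG, hF'', hF]
    rfl
  have hGF : G.comp F'' = AlgHom.id ℂ Z := by
    refine Ideal.Quotient.algHom_ext _ (Ideal.Quotient.algHom_ext _ (hom_ext ?_ ?_))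
    · intro i
      change G (F'' (ρ (x m a i))) = ρ (x m a i)
      rw [hF'', hF]
      rcases i with _ | i
      · have hu : IsUnit (∏ i, ρ (x m a (some i))) := by
          refine isUnit_of_mul_isUnit_right (x := ρ (x m a none)) ?_
          rw [← Fintype.prod_option fun i => ρ (x m a i), hρp]
          exact hunitZ q hq0
        refine hu.mul_right_cancel ?_
        rw [← Fintype.prod_option fun i => ρ (x m a i), hρp]
        have h1 := congrArg G hw
        rw [map_mul, map_prod G, AlgHom.commutes] at h1
        simp_rw [hG] at h1
        exact h1
      · exact hG i
    · change G (F'' (ρ (t m a))) = ρ (t m a)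
      rw [hρt, map_one, map_one]
  exact (AlgEquiv.ofAlgHom F'' G hFG hGF).toLinearEquiv.finrank_eq

end EdgeAlgebra

end EdgeAlgebra

section EdgeTriangular

/-- If `p ^ N * (p - q) = 0` in a finite-dimensional algebra and `q ≠ 0`, then the generalized
eigenspace of multiplication by `p` for `q` has the dimension of the quotient by `p - q`. -/
theorem finrank_maxGenEigenspace_mulLeft {V : Type*} [CommRing V] [Algebra ℂ V]
    [FiniteDimensional ℂ V] {p : V} {q : ℂ} (hq : q ≠ 0) {N : ℕ}
    (h : p ^ N * p = algebraMap ℂ V q * p ^ N) :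
    Module.finrank ℂ (Module.End.maxGenEigenspace (LinearMap.mulLeft ℂ p) q) =
      Module.finrank ℂ (V ⧸ (Ideal.span {p - algebraMap ℂ V q} : Ideal V)) := by
  set δ := p - algebraMap ℂ V q with hδ
  have hpow : ∀ (n : ℕ) (x : V), ((LinearMap.mulLeft ℂ p - q • 1) ^ n) x = δ ^ n * x := by
    intro n
    induction n with
    | zero => intro x; simp
    | succ n ih =>
      intro x
      rw [pow_succ', Module.End.mul_apply, ih]
      simp only [LinearMap.sub_apply, LinearMap.mulLeft_apply, LinearMap.smul_apply,
        Module.End.one_apply]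
      rw [Algebra.smul_def, hδ]
      ring
  have hker : Module.End.maxGenEigenspace (LinearMap.mulLeft ℂ p) q =
      LinearMap.ker (LinearMap.mulLeft ℂ δ) := by
    ext x
    rw [Module.End.mem_maxGenEigenspace, LinearMap.mem_ker, LinearMap.mulLeft_apply]
    constructor
    · rintro ⟨n, hn⟩
      rw [hpow] at hn
      have hco : IsCoprime (p ^ N) (δ ^ n) := by
        refine IsCoprime.pow ⟨algebraMap ℂ V q⁻¹, - algebraMap ℂ V q⁻¹, ?_⟩
        have : algebraMap ℂ V q⁻¹ * algebraMap ℂ V q = 1 := by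
          rw [← map_mul, inv_mul_cancel₀ hq, map_one]
        rw [hδ]
        linear_combination this
      obtain ⟨α, β, hαβ⟩ := hco
      rw [hδ] at hn hαβ ⊢
      linear_combination (-(p - algebraMap ℂ V q) * x) * hαβ + α * x * h
        + β * (p - algebraMap ℂ V q) * hn
    · intro hx
      exact ⟨1, by rw [hpow, pow_one, hx]⟩
  have hrange : LinearMap.range (LinearMap.mulLeft ℂ δ) =
      (Ideal.span {δ} : Ideal V).restrictScalars ℂ := by
    ext x
    rw [LinearMap.mem_range, Submodule.restrictScalars_mem, Ideal.mem_span_singleton']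
    simp [mul_comm]
  have h1 := LinearMap.finrank_range_add_finrank_ker (LinearMap.mulLeft ℂ δ)
  have h2 := Submodule.finrank_quotient_add_finrank
    ((Ideal.span {δ} : Ideal V).restrictScalars ℂ)
  rw [hrange] at h1
  rw [hker]
  have h3 : Module.finrank ℂ (V ⧸ (Ideal.span {δ} : Ideal V).restrictScalars ℂ) =
    Module.finrank ℂ (V ⧸ (Ideal.span {δ} : Ideal V)) := rfl
  omega

namespace EdgeAlgebra

/-- The diagonal of multiplication by the product of the generators on the edge algebra. -/
noncomputable def diagonal (m : ℕ) (q : ℂ)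
    (x : Fin ((m + 2) ^ m) ⊕ₗ Fin ((m + 1) ^ (m + 1) - (m + 2) ^ m)) : ℂ :=
  Sum.elim (fun _ => q) (fun _ => 0) (ofLex x)

theorem isTriangular {m : ℕ} {a : Option (Fin m) → ℂ} (ha : ∀ i, a i ≠ 0) :
    (m + 2) ^ m ≤ (m + 1) ^ (m + 1) ∧
    IsTriangular (algebraMap (Polynomial ℂ) (EdgeAlgebra m a)) (∏ i, x m a i) (EdgeAlgebra m a)
      (fun j => Polynomial.C (diagonal m (∏ i, a i) j) * Polynomial.X ^ (m + 1)) := by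
  set q := ∏ i, a i with hq
  have hq0 : q ≠ 0 := Finset.prod_ne_zero_iff.2 fun i _ => ha i
  obtain ⟨b⟩ := StarAlgebra.nonempty_basis (σ := Option (Fin m)) (D := m + 1)
    (u := fun i => Polynomial.C (a i) * (Polynomial.X : Polynomial ℂ)) (by omega) (by simp)
  have : Module.Finite (Polynomial ℂ) (EdgeAlgebra m a) := Module.Finite.of_basis b
  have : Module.Free (Polynomial ℂ) (EdgeAlgebra m a) := Module.Free.of_basis b
  have hmulpow : ∀ (n : ℕ) (y : EdgeAlgebra m a),
      ((LinearMap.mulLeft (Polynomial ℂ) (∏ i, x m a i)) ^ n) y = (∏ i, x m a i) ^ n * y := by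
    intro n y
    rw [LinearMap.pow_mulLeft, LinearMap.mulLeft_apply]
  obtain ⟨r₁, r₀, hr⟩ := exists_hasTriangularBasis_of_pow_mul_sub (m + 1)
    (Polynomial.C q * Polynomial.X ^ (m + 1)) (LinearMap.mulLeft (Polynomial ℂ) (∏ i, x m a i)) (by
      intro y
      rw [hmulpow, LinearMap.mulLeft_apply, Algebra.smul_def, ← mul_assoc, ← mul_assoc,
        ← prod_pow_mul]
      ring)
  have hr' : IsTriangular (algebraMap (Polynomial ℂ) (EdgeAlgebra m a)) (∏ i, x m a i)
      (EdgeAlgebra m a) (fun j : Fin r₁ ⊕ₗ Fin r₀ => Sum.elim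
        (fun _ => Polynomial.C q * Polynomial.X ^ (m + 1)) (fun _ => 0) (ofLex j)) := by
    rw [isTriangular_iff (fun c x => Algebra.smul_def c x)]
    exact hr
  have hcard : r₁ + r₀ = (m + 1) ^ (m + 1) := by
    obtain ⟨v, -⟩ := hr
    have h1 := (Module.finrank_eq_card_basis v).symm.trans (Module.finrank_eq_card_basis b)
    rw [Fintype.card_lex] at h1
    simpa using h1
  have haeval : (Polynomial.aeval (R := ℂ) (t m a)).toRingHom =
      algebraMap (Polynomial ℂ) (EdgeAlgebra m a) := by
    have h1 : Polynomial.aeval (R := ℂ) (t m a) =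
        IsScalarTower.toAlgHom ℂ (Polynomial ℂ) (EdgeAlgebra m a) := by
      ext
      simp [t]
    rw [h1]
    rfl
  have hspec := IsTriangular.specialize (t := t m a) (by rw [haeval]; exact hr')
    (Ideal.Quotient.mkₐ ℂ (Ideal.span {t m a - 1})) (Ideal.Quotient.mkₐ_surjective _ _) (by
      intro y
      rw [Ideal.Quotient.mkₐ_eq_mk, Ideal.Quotient.eq_zero_iff_mem, Ideal.mem_span_singleton]
      rfl)
  have := hspec.finite
  have hr₁ : r₁ = (m + 2) ^ m := by
    have hnil := congrArg (Ideal.Quotient.mkₐ ℂ (Ideal.span {t m a - 1})) (prod_pow_mul m a)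
    have ht : Ideal.Quotient.mkₐ ℂ (Ideal.span {t m a - 1}) (t m a) = 1 := by
      have h1 : Ideal.Quotient.mkₐ ℂ (Ideal.span {t m a - 1}) (t m a - 1) = 0 :=
        Ideal.Quotient.eq_zero_iff_mem.2 (Ideal.mem_span_singleton_self _)
      rwa [map_sub, map_one, sub_eq_zero] at h1
    have hc : algebraMap (Polynomial ℂ) (EdgeAlgebra m a)
        (Polynomial.C q * Polynomial.X ^ (m + 1)) = algebraMap ℂ _ q * t m a ^ (m + 1) := by
      rw [map_mul, map_pow]
      rfl
    rw [hc, map_mul, map_mul, map_mul, map_pow, map_pow, ht, one_pow, mul_one,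
      AlgHom.commutes] at hnil
    rw [← Fibre.finrank_quotient ha, ← finrank_maxGenEigenspace_mulLeft hq0 hnil,
      LinearMap.finrank_maxGenEigenspace_eq, hspec.hasTriangularBasis_mulLeft.charpoly_eq]
    rw [← (toLex : Fin r₁ ⊕ Fin r₀ ≃ Fin r₁ ⊕ₗ Fin r₀).prod_comp, Fintype.prod_sum_type]
    simp only [ofLex_toLex, Sum.elim_inl, Sum.elim_inr, Polynomial.eval_mul, Polynomial.eval_C,
      Polynomial.eval_pow, Polynomial.eval_X, one_pow, mul_one, Polynomial.eval_zero, map_zero,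
      sub_zero, Finset.prod_const, Finset.card_univ, Fintype.card_fin]
    rw [Polynomial.rootMultiplicity_mul, Polynomial.rootMultiplicity_X_sub_C_pow,
      Polynomial.rootMultiplicity_eq_zero, add_zero]
    · simp [Polynomial.IsRoot, hq0]
    · exact mul_ne_zero (pow_ne_zero _ (Polynomial.X_sub_C_ne_zero q))
        (pow_ne_zero _ Polynomial.X_ne_zero)
  subst hr₁
  have hr₀ : r₀ = (m + 1) ^ (m + 1) - (m + 2) ^ m := by omega
  subst hr₀
  refine ⟨by omega, ?_⟩
  convert hr' using 2 with j
  rw [diagonal]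
  rcases ofLex j with j | j <;> simp

end EdgeAlgebra

end EdgeTriangular

section HubAlgebra

theorem prod_erase_none {α M : Type*} [Fintype α] [DecidableEq α] [CommMonoid M]
    (s : Option α → M) : ∏ j ∈ univ.erase none, s j = ∏ j, s (some j) := by
  rw [← Finset.filter_ne', Finset.prod_filter, Fintype.prod_option]
  simp

theorem prod_erase_some {α M : Type*} [Fintype α] [DecidableEq α] [CommMonoid M]
    (s : Option α → M) (i : α) :
    ∏ j ∈ univ.erase (some i), s j = s none * ∏ j ∈ univ.erase i, s (some j) := by
  rw [← Finset.filter_ne', Finset.prod_filter, Fintype.prod_option, ← Finset.filter_ne',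
    Finset.prod_filter]
  simp

/-- The algebra `ℂ[y][t][x_1, …, x_m] / (x_i ^ (m + 1) - λ⁻¹ y t ∏_{j ≠ i} x_j)`. -/
abbrev HubAlgebra (m : ℕ) (lam : ℂ) : Type :=
  StarAlgebra (σ := Fin m) (m + 1) fun _ =>
    Polynomial.C (Polynomial.C lam⁻¹ * Polynomial.X) *
      (Polynomial.X : Polynomial (Polynomial ℂ))

namespace HubAlgebra

variable {m : ℕ} {lam : ℂ}

/-- The generators of the hub algebra. -/
noncomputable def x (m : ℕ) (lam : ℂ) (i : Fin m) : HubAlgebra m lam := StarAlgebra.gen _ _ i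

/-- The inner parameter of the hub algebra. -/
noncomputable def y (m : ℕ) (lam : ℂ) : HubAlgebra m lam :=
  algebraMap (Polynomial (Polynomial ℂ)) _ (Polynomial.C Polynomial.X)

/-- The outer parameter of the hub algebra. -/
noncomputable def t (m : ℕ) (lam : ℂ) : HubAlgebra m lam :=
  algebraMap (Polynomial (Polynomial ℂ)) _ Polynomial.X

theorem algebraMap_C (c : ℂ) :
    algebraMap (Polynomial (Polynomial ℂ)) (HubAlgebra m lam) (Polynomial.C (Polynomial.C c)) =
      algebraMap ℂ _ c := rfl

theorem x_pow (i : Fin m) : x m lam i ^ (m + 1) =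
    algebraMap ℂ _ lam⁻¹ * y m lam * t m lam * ∏ j ∈ univ.erase i, x m lam j := by
  have h := StarAlgebra.gen_pow (D := m + 1) (u := fun _ : Fin m =>
    Polynomial.C (Polynomial.C lam⁻¹ * Polynomial.X) *
      (Polynomial.X : Polynomial (Polynomial ℂ))) i
  simp only [map_mul] at h
  exact h

theorem exists_lift {S : Type*} [CommRing S] [Algebra ℂ S] (η τ : S) (s : Fin m → S)
    (h : ∀ i, s i ^ (m + 1) = algebraMap ℂ S lam⁻¹ * η * τ * ∏ j ∈ univ.erase i, s j) :
    ∃ f : HubAlgebra m lam →ₐ[ℂ] S, (∀ i, f (x m lam i) = s i) ∧ f (y m lam) = η ∧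
      f (t m lam) = τ := by
  obtain ⟨f, hf, hf'⟩ := StarAlgebra.exists_lift (D := m + 1)
    (u := fun _ => Polynomial.C (Polynomial.C lam⁻¹ * Polynomial.X) *
      (Polynomial.X : Polynomial (Polynomial ℂ)))
    (Polynomial.eval₂AlgHom (Polynomial.aeval η) τ fun _ => Commute.all _ _) s
    (fun i => by rw [h i]; simp)
  exact ⟨f, hf, by rw [y, hf']; simp, by rw [t, hf']; simp⟩

theorem hom_ext {S : Type*} [CommRing S] [Algebra ℂ S] {f g : HubAlgebra m lam →ₐ[ℂ] S}
    (h : ∀ i, f (x m lam i) = g (x m lam i)) (hy : f (y m lam) = g (y m lam))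
    (ht : f (t m lam) = g (t m lam)) : f = g := by
  refine StarAlgebra.hom_ext h fun c => ?_
  have h1 : f.comp (IsScalarTower.toAlgHom ℂ (Polynomial (Polynomial ℂ)) _) =
      g.comp (IsScalarTower.toAlgHom ℂ (Polynomial (Polynomial ℂ)) _) := by
    refine Polynomial.algHom_ext' ?_ ht
    exact Polynomial.algHom_ext hy
  exact DFunLike.congr_fun h1 c

theorem mul_left_injective {b : ℂ} (hb : b ≠ 0) (g : HubAlgebra m lam)
    (hg : g * (algebraMap ℂ _ b * y m lam ^ (m + 1) - t m lam * ∏ i, x m lam i) = 0) : g = 0 := by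
  obtain ⟨basis⟩ := StarAlgebra.nonempty_basis (σ := Fin m) (D := m + 1)
    (u := fun _ => Polynomial.C (Polynomial.C lam⁻¹ * Polynomial.X) *
      (Polynomial.X : Polynomial (Polynomial ℂ))) (by omega) (by simp)
  have : Module.Free (Polynomial (Polynomial ℂ)) (HubAlgebra m lam) := Module.Free.of_basis basis
  set T := t m lam * ∏ i, x m lam i with hT
  set Y := algebraMap ℂ (HubAlgebra m lam) b * y m lam ^ (m + 1) with hY
  have hTm : T ^ (m + 2) =
      t m lam ^ 2 * (algebraMap ℂ _ lam⁻¹ * y m lam * t m lam) ^ m * T ^ m := by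
    have h1 : (∏ i, x m lam i) ^ (m + 2) =
        (algebraMap ℂ _ lam⁻¹ * y m lam * t m lam) ^ m * (∏ i, x m lam i) ^ m := by
      have h2 : ∀ i, x m lam i ^ (m + 2) =
          algebraMap ℂ _ lam⁻¹ * y m lam * t m lam * ∏ i, x m lam i := by
        intro i
        rw [pow_succ, x_pow, mul_assoc, Finset.prod_erase_mul _ _ (Finset.mem_univ i)]
      rw [← Finset.prod_pow, Finset.prod_congr rfl fun i _ => h2 i]
      simp [mul_pow]
    rw [hT, mul_pow, h1]
    ring
  have hgT : ∀ n : ℕ, g * T ^ n = g * Y ^ n := by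
    intro n
    induction n with
    | zero => simp
    | succ n ih => linear_combination T * ih - Y ^ n * hg
  have h0 : g * (Y ^ (m + 2) -
      t m lam ^ 2 * (algebraMap ℂ _ lam⁻¹ * y m lam * t m lam) ^ m * Y ^ m) = 0 := by
    linear_combination g * hTm - hgT (m + 2) +
      t m lam ^ 2 * (algebraMap ℂ _ lam⁻¹ * y m lam * t m lam) ^ m * hgT m
  let y' : Polynomial (Polynomial ℂ) := Polynomial.C Polynomial.X
  let t' : Polynomial (Polynomial ℂ) := Polynomial.X
  let Y' : Polynomial (Polynomial ℂ) := Polynomial.C (Polynomial.C b) * y' ^ (m + 1)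
  let r : Polynomial (Polynomial ℂ) := Y' ^ (m + 2) -
    t' ^ 2 * (Polynomial.C (Polynomial.C lam⁻¹) * y' * t') ^ m * Y' ^ m
  have hr : r • g = 0 := by
    rw [Algebra.smul_def, mul_comm, ← h0]
    simp only [r, Y', y', t', map_sub, map_mul, map_pow, algebraMap_C, hY, y, t]
  have hr0 : r ≠ 0 := by
    intro h
    have h1 := congrArg (Polynomial.eval 0) h
    simp [r, Y', y', t', hb] at h1
  exact (smul_eq_zero.1 hr).resolve_left hr0

/-- The quotient of the hub algebra by `b y ^ (m + 1) - t ∏ x_i` is an edge algebra. -/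
theorem exists_algEquiv_edgeAlgebra {b : ℂ} (hb : b ≠ 0) {a : Option (Fin m) → ℂ}
    (ha : a none = b⁻¹) (ha' : ∀ i, a (some i) = lam⁻¹) {Q : Type*} [CommRing Q] [Algebra ℂ Q]
    (π : HubAlgebra m lam →ₐ[ℂ] Q) (hπ : Function.Surjective π)
    (hπh : π (algebraMap ℂ _ b * y m lam ^ (m + 1) - t m lam * ∏ i, x m lam i) = 0)
    (hlift : ∀ G₀ : HubAlgebra m lam →ₐ[ℂ] EdgeAlgebra m a,
      G₀ (algebraMap ℂ _ b * y m lam ^ (m + 1) - t m lam * ∏ i, x m lam i) = 0 →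
        ∃ G : Q →ₐ[ℂ] EdgeAlgebra m a, ∀ z, G (π z) = G₀ z) :
    ∃ Φ : EdgeAlgebra m a ≃ₐ[ℂ] Q, Φ (EdgeAlgebra.t m a) = π (t m lam) ∧
      Φ (EdgeAlgebra.x m a none) = π (y m lam) ∧
      ∀ i, Φ (EdgeAlgebra.x m a (some i)) = π (x m lam i) := by
  let s : Option (Fin m) → Q := fun i => i.elim (π (y m lam)) fun i => π (x m lam i)
  obtain ⟨F, hF, hFt⟩ := EdgeAlgebra.exists_lift (a := a) (π (t m lam)) s (by
    rintro (_ | i)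
    · rw [prod_erase_none, ha]
      have h1 : algebraMap ℂ Q b⁻¹ * algebraMap ℂ Q b = 1 := by
        rw [← map_mul, inv_mul_cancel₀ hb, map_one]
      simp only [map_sub, map_mul, map_prod, map_pow, AlgHom.commutes] at hπh
      change π (y m lam) ^ (m + 1) = algebraMap ℂ Q b⁻¹ * π (t m lam) * ∏ i, π (x m lam i)
      linear_combination algebraMap ℂ Q b⁻¹ * hπh - π (y m lam) ^ (m + 1) * h1
    · rw [prod_erase_some, ha']
      change π (x m lam i) ^ (m + 1) = algebraMap ℂ Q lam⁻¹ * π (t m lam) *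
        (π (y m lam) * ∏ j ∈ univ.erase i, π (x m lam j))
      rw [← map_pow, x_pow]
      simp only [map_mul, map_prod, AlgHom.commutes]
      ring)
  have hFnone : F (EdgeAlgebra.x m a none) = π (y m lam) := hF none
  have hFsome : ∀ i, F (EdgeAlgebra.x m a (some i)) = π (x m lam i) := fun i => hF (some i)
  have hx : ∀ i, EdgeAlgebra.x m a i ^ (m + 1) = algebraMap ℂ _ (a i) * EdgeAlgebra.t m a *
      ∏ j ∈ univ.erase i, EdgeAlgebra.x m a j := by
    intro i
    rw [← EdgeAlgebra.algebraMap_relation]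
    exact StarAlgebra.gen_pow i
  obtain ⟨G₀, hG₀, hG₀y, hG₀t⟩ := exists_lift (lam := lam) (EdgeAlgebra.x m a none)
    (EdgeAlgebra.t m a) (fun i : Fin m => EdgeAlgebra.x m a (some i)) (by
      intro i
      rw [hx, prod_erase_some, ha']
      ring)
  obtain ⟨G, hG⟩ := hlift G₀ (by
    have h1 : algebraMap ℂ (EdgeAlgebra m a) b * algebraMap ℂ _ b⁻¹ = 1 := by
      rw [← map_mul, mul_inv_cancel₀ hb, map_one]
    simp only [map_sub, map_mul, map_prod, map_pow, AlgHom.commutes, hG₀y, hG₀t, hG₀]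
    rw [hx, prod_erase_none, ha]
    linear_combination (EdgeAlgebra.t m a * ∏ i, EdgeAlgebra.x m a (some i)) * h1)
  have hFG₀ : F.comp G₀ = π := by
    refine hom_ext (fun i => ?_) ?_ ?_
    · rw [AlgHom.comp_apply, hG₀, hFsome]
    · rw [AlgHom.comp_apply, hG₀y, hFnone]
    · rw [AlgHom.comp_apply, hG₀t, hFt]
  have hFG : F.comp G = AlgHom.id ℂ Q := by
    ext z
    obtain ⟨z, rfl⟩ := hπ z
    rw [AlgHom.comp_apply, hG]
    exact DFunLike.congr_fun hFG₀ z
  have hGF : G.comp F = AlgHom.id ℂ (EdgeAlgebra m a) := by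
    refine EdgeAlgebra.hom_ext ?_ ?_
    · rintro (_ | i)
      · rw [AlgHom.comp_apply, hFnone, hG]
        exact hG₀y
      · rw [AlgHom.comp_apply, hFsome, hG]
        exact hG₀ i
    · rw [AlgHom.comp_apply, hFt, hG]
      exact hG₀t
  exact ⟨AlgEquiv.ofAlgHom F G hFG hGF, hFt, hFnone, hFsome⟩

theorem isTriangular_quotient {b : ℂ} (hb : b ≠ 0) (hlam : lam ≠ 0) :
    IsTriangular (Polynomial.aeval (R := ℂ) (t m lam)).toRingHom
      ((∏ i, x m lam i) * y m lam)
      (HubAlgebra m lam ⧸ (Ideal.span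
        {algebraMap ℂ _ b * y m lam ^ (m + 1) - t m lam * ∏ i, x m lam i} :
          Ideal (HubAlgebra m lam)))
      (fun j => Polynomial.C (EdgeAlgebra.diagonal m (b⁻¹ * lam⁻¹ ^ m) j) *
        Polynomial.X ^ (m + 1)) := by
  let a : Option (Fin m) → ℂ := fun i => i.elim b⁻¹ fun _ => lam⁻¹
  have ha : ∀ i, a i ≠ 0 := by
    rintro (_ | i)
    · exact inv_ne_zero hb
    · exact inv_ne_zero hlam
  have hprod : ∏ i, a i = b⁻¹ * lam⁻¹ ^ m := by
    rw [Fintype.prod_option]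
    simp [a]
  have hE := (EdgeAlgebra.isTriangular ha).2
  rw [hprod] at hE
  set h := algebraMap ℂ (HubAlgebra m lam) b * y m lam ^ (m + 1) - t m lam * ∏ i, x m lam i with hh
  let I : Ideal (HubAlgebra m lam) := Ideal.span {h}
  let π : HubAlgebra m lam →ₐ[ℂ] HubAlgebra m lam ⧸ I := Ideal.Quotient.mkₐ ℂ I
  have hsmul : ∀ (c : HubAlgebra m lam) (z : HubAlgebra m lam ⧸ I), c • z = π c * z :=
    fun c z => Algebra.smul_def c z
  obtain ⟨Φ, hΦt, hΦy, hΦx⟩ := exists_algEquiv_edgeAlgebra (a := a) hb rfl (fun _ => rfl) π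
    (Ideal.Quotient.mkₐ_surjective ℂ I)
    (Ideal.Quotient.eq_zero_iff_mem.2 (Ideal.subset_span rfl))
    (fun G₀ hG₀ => ⟨Ideal.Quotient.liftₐ I G₀ (fun z hz => by
      obtain ⟨c, rfl⟩ := Ideal.mem_span_singleton'.1 hz
      rw [map_mul, hG₀, mul_zero]), fun z => rfl⟩)
  have hcomp : (Φ : EdgeAlgebra m a →ₐ[ℂ] HubAlgebra m lam ⧸ I).comp
      (IsScalarTower.toAlgHom ℂ (Polynomial ℂ) (EdgeAlgebra m a)) =
        π.comp (Polynomial.aeval (t m lam)) := by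
    refine Polynomial.algHom_ext ?_
    rw [AlgHom.comp_apply, AlgHom.comp_apply, Polynomial.aeval_X]
    exact hΦt
  have hΦp : Φ (∏ i, EdgeAlgebra.x m a i) = π ((∏ i, x m lam i) * y m lam) := by
    refine (map_prod Φ _ _).trans ?_
    rw [Fintype.prod_option, hΦy]
    simp only [hΦx]
    refine (mul_comm _ _).trans ?_
    refine Eq.symm ((π.map_mul _ _).trans ?_)
    exact congrArg (· * π (y m lam)) (map_prod π _ _)
  refine hE.of_equiv Φ.toRingEquiv.toAddEquiv (fun c z => ?_) fun z => ?_
  · exact (map_mul Φ _ z).trans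
      ((congrArg (· * Φ z) (DFunLike.congr_fun hcomp c)).trans (hsmul _ _).symm)
  · exact (map_mul Φ _ z).trans ((congrArg (· * Φ z) hΦp).trans (hsmul _ _).symm)

end HubAlgebra

end HubAlgebra

open TensorProduct in
theorem exists_pushout {H B ι : Type} [CommRing H] [CommRing B] [Algebra ℂ H] [Algebra ℂ B]
    [Algebra (Polynomial ℂ) H] [Algebra (Polynomial ℂ) B] [IsScalarTower ℂ (Polynomial ℂ) H]
    [IsScalarTower ℂ (Polynomial ℂ) B] (v : Module.Basis ι (Polynomial ℂ) B) :
    ∃ (C : Type) (_ : CommRing C) (_ : Algebra ℂ C) (_ : Algebra H C) (_ : IsScalarTower ℂ H C)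
      (β : B →ₐ[ℂ] C) (w : Module.Basis ι H C), (∀ i, w i = β (v i)) ∧
      (∀ c, β (algebraMap (Polynomial ℂ) B c) = algebraMap H C (algebraMap (Polynomial ℂ) H c)) ∧
      (∀ (S : Type) [CommRing S] [Algebra ℂ S] (f : H →ₐ[ℂ] S) (g : B →ₐ[ℂ] S),
        f (algebraMap (Polynomial ℂ) H Polynomial.X) =
          g (algebraMap (Polynomial ℂ) B Polynomial.X) →
        ∃ F : C →ₐ[ℂ] S, (∀ a, F (algebraMap H C a) = f a) ∧ ∀ b, F (β b) = g b) ∧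
      ∀ (S : Type) [CommRing S] [Algebra ℂ S] (F G : C →ₐ[ℂ] S),
        (∀ a, F (algebraMap H C a) = G (algebraMap H C a)) → (∀ b, F (β b) = G (β b)) →
          F = G := by
  refine ⟨H ⊗[Polynomial ℂ] B, inferInstance, inferInstance, inferInstance, inferInstance,
    (Algebra.TensorProduct.includeRight (R := Polynomial ℂ) (A := H) (B := B)).restrictScalars ℂ,
    Algebra.TensorProduct.basis H v, ?_, ?_, ?_, ?_⟩
  · intro i
    simp
  · intro c
    simp
  · intro S _ _ f g hfg
    have hcomp : f.comp (IsScalarTower.toAlgHom ℂ (Polynomial ℂ) H) =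
        g.comp (IsScalarTower.toAlgHom ℂ (Polynomial ℂ) B) := Polynomial.algHom_ext hfg
    let _ : Algebra (Polynomial ℂ) S :=
      (f.comp (IsScalarTower.toAlgHom ℂ (Polynomial ℂ) H)).toRingHom.toAlgebra
    have : IsScalarTower ℂ (Polynomial ℂ) S := IsScalarTower.of_algebraMap_eq fun c =>
      (AlgHom.commutes (f.comp (IsScalarTower.toAlgHom ℂ (Polynomial ℂ) H)) c).symm
    let f' : H →ₐ[Polynomial ℂ] S := { f with commutes' := fun c => rfl }
    let g' : B →ₐ[Polynomial ℂ] S :=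
      { g with commutes' := fun c => (DFunLike.congr_fun hcomp c).symm }
    refine ⟨(Algebra.TensorProduct.productMap f' g').restrictScalars ℂ, fun a => ?_, fun b => ?_⟩
    · exact Algebra.TensorProduct.productMap_left_apply f' g' a
    · exact Algebra.TensorProduct.productMap_right_apply f' g' b
  · intro S _ _ F G hl hr
    ext z
    induction z with
    | zero => simp
    | add z w hz hw => rw [map_add, map_add, hz, hw]
    | tmul a b =>
      have : a ⊗ₜ[Polynomial ℂ] b = (a ⊗ₜ 1) * (1 ⊗ₜ b) := by simp
      rw [this, map_mul, map_mul]
      exact congrArg₂ _ (hl a) (hr b)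

theorem isTriangular_quotient_pushout {K H B C ι κ : Type*} [CommRing K] [CommRing H] [CommRing B]
    [CommRing C] [Algebra K H] [Algebra K B] [Algebra H C] [LinearOrder ι] [LinearOrder κ]
    [Fintype ι] [Fintype κ] {v : Module.Basis ι K B} {p : B} {e : ι → K}
    (hv : ∀ i, p • v i - e i • v i ∈ Submodule.span K (v '' Set.Iio i))
    {β : B →+* C} {w : Module.Basis ι H C} (hw : ∀ i, w i = β (v i))
    (hβ : ∀ c, β (algebraMap K B c) = algebraMap H C (algebraMap K H c)) (z : H)
    (hreg : ∀ i, ∀ g : H, g * (z - algebraMap K H (e i)) = 0 → g = 0) {φ : K →+* H} {p' : H}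
    {E : ι → κ → K}
    (hE : ∀ i, IsTriangular φ p' (H ⧸ Ideal.span {z - algebraMap K H (e i)}) (E i)) :
    IsTriangular ((algebraMap H (C ⧸ (Ideal.span {algebraMap H C z - β p} : Ideal C))).comp φ)
      (algebraMap H (C ⧸ (Ideal.span {algebraMap H C z - β p} : Ideal C)) p')
      (C ⧸ (Ideal.span {algebraMap H C z - β p} : Ideal C))
      (fun x : ι ×ₗ κ => E (ofLex x).1 (ofLex x).2) := by
  set I : Ideal C := Ideal.span {algebraMap H C z - β p} with hI
  have hspan : ∀ (i : ι) (b : B), b ∈ Submodule.span K (v '' Set.Iio i) →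
      β b ∈ Submodule.span H (w '' Set.Iio i) := by
    intro i b hb
    induction hb using Submodule.span_induction with
    | mem b hb =>
      obtain ⟨j, hj, rfl⟩ := hb
      rw [← hw]
      exact Submodule.subset_span ⟨j, hj, rfl⟩
    | zero => simp
    | add a b _ _ ha hb =>
      rw [map_add]
      exact Submodule.add_mem _ ha hb
    | smul c b _ hb =>
      rw [Algebra.smul_def, map_mul, hβ, ← Algebra.smul_def]
      exact Submodule.smul_mem _ _ hb
  have h := IsTriangular.coker φ p' w (LinearMap.mulLeft H (algebraMap H C z - β p))
    (fun i => z - algebraMap K H (e i)) (fun i => by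
      have h1 := Submodule.neg_mem _ (hspan i _ (hv i))
      convert h1 using 1
      rw [hw, LinearMap.mulLeft_apply, Algebra.smul_def, map_sub, map_sub, smul_eq_mul, map_mul,
        Algebra.smul_def, map_mul, hβ]
      ring) hreg (Ideal.Quotient.mkₐ H I).toLinearMap (Ideal.Quotient.mkₐ_surjective H I) (by
      ext c
      rw [LinearMap.mem_ker, AlgHom.toLinearMap_apply, Ideal.Quotient.mkₐ_eq_mk,
        Ideal.Quotient.eq_zero_iff_mem, hI, Ideal.mem_span_singleton', LinearMap.mem_range]
      simp only [LinearMap.mulLeft_apply, mul_comm]) E hE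
  exact h.of_equiv (AddEquiv.refl _) (fun c x => Algebra.smul_def (φ c) x) fun x =>
    Algebra.smul_def p' x

/-- The product of the non-initial variables of the first edge of a path with `n` edges. -/
def pathEdge {S : Type*} [CommRing S] (m n : ℕ) (s : ℕ → S) : S :=
  if n = 0 then 0 else (∏ j : Fin m, s (j + 1)) * s (m + 1)

/-- The homogenized eigenvector equations of the path with `n` edges of size `m + 2`. -/
def PathRel (m : ℕ) (lam : ℂ) {S : Type*} [CommRing S] [Algebra ℂ S] : ℕ → (ℕ → S) → Prop
  | 0, _ => True
  | n + 1, s =>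
    (∀ i : Fin m, algebraMap ℂ S lam * s (i + 1) ^ (m + 1) =
      s 0 * s (m + 1) * ∏ j ∈ univ.erase i, s (j + 1)) ∧
    algebraMap ℂ S lam * s (m + 1) ^ (m + 1) =
      s 0 * ∏ j : Fin m, s (j + 1) + pathEdge m n (fun v => s (v + (m + 1))) ∧
    PathRel m lam n fun v => s (v + (m + 1))

/-- The universal commutative algebra with a solution of the homogenized equations of a path. -/
structure IsPathAlgebra (m : ℕ) (lam : ℂ) (n : ℕ) (B : Type) [CommRing B] [Algebra ℂ B]
    (x : ℕ → B) : Prop where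
  rel : PathRel m lam n x
  lift : ∀ (S : Type) [CommRing S] [Algebra ℂ S] (s : ℕ → S), PathRel m lam n s →
    ∃ f : B →ₐ[ℂ] S, ∀ v ≤ n * (m + 1), f (x v) = s v
  ext : ∀ (S : Type) [CommRing S] [Algebra ℂ S] (f g : B →ₐ[ℂ] S),
    (∀ v ≤ n * (m + 1), f (x v) = g (x v)) → f = g

theorem pathEdge_map {S T : Type*} [CommRing S] [CommRing T] (m n : ℕ) (s : ℕ → S)
    (f : S →+* T) : f (pathEdge m n s) = pathEdge m n fun v => f (s v) := by
  unfold pathEdge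
  split_ifs
  · exact map_zero f
  · rw [map_mul, map_prod]

theorem PathRel.map {m : ℕ} {lam : ℂ} {S T : Type*} [CommRing S] [Algebra ℂ S] [CommRing T]
    [Algebra ℂ T] (f : S →ₐ[ℂ] T) {n : ℕ} {s : ℕ → S} (h : PathRel m lam n s) :
    PathRel m lam n fun v => f (s v) := by
  induction n generalizing s with
  | zero => trivial
  | succ n ih =>
    obtain ⟨h1, h2, h3⟩ := h
    refine ⟨fun i => ?_, ?_, ih h3⟩
    · have := congrArg f (h1 i)
      simpa using this
    · have := congrArg f h2
      have h4 : f (pathEdge m n fun v => s (v + (m + 1))) = _ :=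
        pathEdge_map m n (fun v => s (v + (m + 1))) (f : S →+* T)
      simpa [h4] using this

theorem pathEdge_congr {S : Type*} [CommRing S] {m n : ℕ} {s s' : ℕ → S}
    (h : ∀ v ≤ n * (m + 1), s v = s' v) : pathEdge m n s = pathEdge m n s' := by
  unfold pathEdge
  split_ifs with hn
  · rfl
  · have h1 : m + 1 ≤ n * (m + 1) := Nat.le_mul_of_pos_left _ (Nat.pos_of_ne_zero hn)
    rw [h _ h1]
    refine congrArg (· * _) (Finset.prod_congr rfl fun j _ => h _ ?_)
    have := j.2
    omega

/-- The path without edges is represented by a polynomial ring. -/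
theorem isPathAlgebra_zero (m : ℕ) (lam : ℂ) :
    IsPathAlgebra m lam 0 (Polynomial ℂ) fun _ => Polynomial.X where
  rel := trivial
  lift S _ _ s _ := ⟨Polynomial.aeval (s 0), fun v hv => by
    obtain rfl : v = 0 := by omega
    simp⟩
  ext S _ _ f g h := Polynomial.algHom_ext (h 0 (Nat.zero_le _))

theorem isTriangular_zero (m : ℕ) :
    IsTriangular (Polynomial.aeval (R := ℂ) (Polynomial.X : Polynomial ℂ)).toRingHom
      (pathEdge m 0 fun _ => Polynomial.X) (Polynomial ℂ)
      (fun _ : Fin 1 => Polynomial.C 0 * Polynomial.X ^ (m + 1)) := by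
  rw [isTriangular_iff (fun c x => by simp)]
  refine ⟨Module.Basis.singleton (Fin 1) (Polynomial ℂ), fun i => ?_⟩
  simp [pathEdge]

/-- Prepending an edge: `H` carries the new edge, `B` the old path, and `C` is obtained by gluing
them along a vertex. -/
theorem IsPathAlgebra.succ {m n : ℕ} {lam : ℂ} (hlam : lam ≠ 0) {H B C : Type} [CommRing H]
    [CommRing B] [CommRing C] [Algebra ℂ H] [Algebra ℂ B] [Algebra ℂ C] {x : ℕ → B}
    (hB : IsPathAlgebra m lam n B x) {xH : Fin m → H} {y t : H}
    (hpow : ∀ i, xH i ^ (m + 1) = algebraMap ℂ H lam⁻¹ * y * t * ∏ j ∈ univ.erase i, xH j)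
    (hlift : ∀ (S : Type) [CommRing S] [Algebra ℂ S] (η τ : S) (s : Fin m → S),
      (∀ i, s i ^ (m + 1) = algebraMap ℂ S lam⁻¹ * η * τ * ∏ j ∈ univ.erase i, s j) →
        ∃ f : H →ₐ[ℂ] S, (∀ i, f (xH i) = s i) ∧ f y = η ∧ f t = τ)
    (hext : ∀ (S : Type) [CommRing S] [Algebra ℂ S] (f g : H →ₐ[ℂ] S),
      (∀ i, f (xH i) = g (xH i)) → f y = g y → f t = g t → f = g)
    (α : H →ₐ[ℂ] C) (β : B →ₐ[ℂ] C) (hαβ : α y = β (x 0))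
    (hrel : algebraMap ℂ C lam * α y ^ (m + 1) =
      α t * ∏ j, α (xH j) + β (pathEdge m n x))
    (hCl : ∀ (S : Type) [CommRing S] [Algebra ℂ S] (f : H →ₐ[ℂ] S) (g : B →ₐ[ℂ] S),
      f y = g (x 0) → algebraMap ℂ S lam * f y ^ (m + 1) =
        f t * ∏ j, f (xH j) + g (pathEdge m n x) →
        ∃ F : C →ₐ[ℂ] S, (∀ a, F (α a) = f a) ∧ ∀ b, F (β b) = g b)
    (hCe : ∀ (S : Type) [CommRing S] [Algebra ℂ S] (F G : C →ₐ[ℂ] S),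
      (∀ a, F (α a) = G (α a)) → (∀ b, F (β b) = G (β b)) → F = G) :
    ∃ x' : ℕ → C, IsPathAlgebra m lam (n + 1) C x' ∧ x' 0 = α t ∧
      pathEdge m (n + 1) x' = α ((∏ j, xH j) * y) := by
  let x' : ℕ → C := fun v => if v = 0 then α t else
    if h : v - 1 < m then α (xH ⟨v - 1, h⟩) else β (x (v - (m + 1)))
  have hx0 : x' 0 = α t := rfl
  have hxs : ∀ j : Fin m, x' (j + 1) = α (xH j) := fun j => by simp [x']
  have hxB : ∀ v, x' (v + (m + 1)) = β (x v) := by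
    intro v
    have h1 : ¬ (v + (m + 1) - 1 < m) := by omega
    have h2 : v + (m + 1) - (m + 1) = v := by omega
    simp only [x', h1, h2]
    simp
  have hxy : x' (m + 1) = α y := by
    have := hxB 0
    rwa [zero_add, ← hαβ] at this
  have hinv : ∀ (S : Type) [CommRing S] [Algebra ℂ S],
      algebraMap ℂ S lam * algebraMap ℂ S lam⁻¹ = 1 := by
    intro S _ _
    rw [← map_mul, mul_inv_cancel₀ hlam, map_one]
  refine ⟨x', ⟨⟨fun i => ?_, ?_, ?_⟩, ?_, ?_⟩, hx0, ?_⟩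
  · have h1 := congrArg α (hpow i)
    simp only [map_pow, map_mul, map_prod, AlgHom.commutes] at h1
    simp only [hxs, hx0, hxy, h1]
    linear_combination (α y * α t * ∏ j ∈ univ.erase i, α (xH j)) * hinv C
  · simp only [hxs, hx0, hxy, hrel, hxB]
    exact congrArg _ (pathEdge_map m n x (β : B →+* C))
  · simp only [hxB]
    exact hB.rel.map β
  · intro S _ _ s hs
    obtain ⟨h1, h2, h3⟩ := hs
    obtain ⟨f, hf, hfy, hft⟩ := hlift S (s (m + 1)) (s 0) (fun i => s (i + 1)) (fun i => by
      linear_combination algebraMap ℂ S lam⁻¹ * h1 i - s (i + 1) ^ (m + 1) * hinv S)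
    obtain ⟨g, hg⟩ := hB.lift S _ h3
    have hg0 : g (x 0) = s (m + 1) := by rw [hg 0 (Nat.zero_le _), zero_add]
    obtain ⟨F, hF, hF'⟩ := hCl S f g (by rw [hfy, hg0]) (by
      rw [hfy, hft, h2]
      simp only [hf]
      refine congrArg _ (Eq.symm ?_)
      exact (pathEdge_map m n x (g : B →+* S)).trans (pathEdge_congr hg))
    refine ⟨F, fun v hv => ?_⟩
    rcases Nat.lt_or_ge v (m + 1) with hvm | hvm
    · rcases v with _ | v
      · rw [hx0, hF, hft]
      · have := hxs ⟨v, by omega⟩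
        simp only at this
        rw [this, hF, hf]
    · obtain ⟨v, rfl⟩ := Nat.exists_eq_add_of_le' hvm
      rw [hxB, hF', hg]
      rw [Nat.succ_mul] at hv
      omega
  · intro S _ _ F G hFG
    have hb : F.comp β = G.comp β := by
      refine hB.ext S _ _ fun v hv => ?_
      rw [AlgHom.comp_apply, AlgHom.comp_apply, ← hxB]
      refine hFG _ ?_
      rw [Nat.succ_mul]
      omega
    have hm : m + 1 ≤ (n + 1) * (m + 1) := Nat.le_mul_of_pos_left _ (Nat.succ_pos n)
    have ha : F.comp α = G.comp α := by
      refine hext S _ _ (fun i => ?_) ?_ ?_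
      · rw [AlgHom.comp_apply, AlgHom.comp_apply, ← hxs]
        exact hFG _ (by have := i.2; omega)
      · rw [AlgHom.comp_apply, AlgHom.comp_apply, ← hxy]
        exact hFG _ hm
      · rw [AlgHom.comp_apply, AlgHom.comp_apply, ← hx0]
        exact hFG _ (Nat.zero_le _)
    exact hCe S F G (fun a => DFunLike.congr_fun ha a) fun b => DFunLike.congr_fun hb b
  · simp only [pathEdge, hxs, hxy, Nat.succ_ne_zero, if_false, map_mul, map_prod]

/-- Prepending an edge to a path algebra whose edge product acts triangularly. -/
theorem IsPathAlgebra.exists_succ {m n : ℕ} {lam : ℂ} (hlam : lam ≠ 0) {H B ι κ : Type}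
    [CommRing H] [CommRing B] [Algebra ℂ H] [Algebra ℂ B] [Algebra (Polynomial ℂ) H]
    [IsScalarTower ℂ (Polynomial ℂ) H] [LinearOrder ι] [LinearOrder κ] [Fintype ι] [Fintype κ]
    {x : ℕ → B} (hB : IsPathAlgebra m lam n B x) {q : ι → ℂ}
    (hq : ∀ i, lam - q i ≠ 0)
    (htri : IsTriangular (Polynomial.aeval (R := ℂ) (x 0)).toRingHom (pathEdge m n x) B
      (fun i => Polynomial.C (q i) * Polynomial.X ^ (m + 1)))
    {xH : Fin m → H} {y t : H} (hy : algebraMap (Polynomial ℂ) H Polynomial.X = y)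
    (hpow : ∀ i, xH i ^ (m + 1) = algebraMap ℂ H lam⁻¹ * y * t * ∏ j ∈ univ.erase i, xH j)
    (hlift : ∀ (S : Type) [CommRing S] [Algebra ℂ S] (η τ : S) (s : Fin m → S),
      (∀ i, s i ^ (m + 1) = algebraMap ℂ S lam⁻¹ * η * τ * ∏ j ∈ univ.erase i, s j) →
        ∃ f : H →ₐ[ℂ] S, (∀ i, f (xH i) = s i) ∧ f y = η ∧ f t = τ)
    (hext : ∀ (S : Type) [CommRing S] [Algebra ℂ S] (f g : H →ₐ[ℂ] S),
      (∀ i, f (xH i) = g (xH i)) → f y = g y → f t = g t → f = g)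
    (hreg : ∀ b : ℂ, b ≠ 0 → ∀ g : H,
      g * (algebraMap ℂ H b * y ^ (m + 1) - t * ∏ i, xH i) = 0 → g = 0)
    {D : ℂ → κ → ℂ}
    (hE : ∀ b : ℂ, b ≠ 0 → IsTriangular (Polynomial.aeval (R := ℂ) t).toRingHom
      ((∏ i, xH i) * y)
      (H ⧸ (Ideal.span {algebraMap ℂ H b * y ^ (m + 1) - t * ∏ i, xH i} : Ideal H))
      (fun j => Polynomial.C (D b j) * Polynomial.X ^ (m + 1))) :
    ∃ (B' : Type) (_ : CommRing B') (_ : Algebra ℂ B') (x' : ℕ → B'),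
      IsPathAlgebra m lam (n + 1) B' x' ∧
      IsTriangular (Polynomial.aeval (R := ℂ) (x' 0)).toRingHom (pathEdge m (n + 1) x') B'
        (fun z : ι ×ₗ κ => Polynomial.C (D (lam - q (ofLex z).1) (ofLex z).2) *
          Polynomial.X ^ (m + 1)) := by
  let _ : Algebra (Polynomial ℂ) B := (Polynomial.aeval (R := ℂ) (x 0)).toRingHom.toAlgebra
  have : IsScalarTower ℂ (Polynomial ℂ) B := IsScalarTower.of_algebraMap_eq fun c =>
    (AlgHom.commutes (Polynomial.aeval (R := ℂ) (x 0)) c).symm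
  have hBX : algebraMap (Polynomial ℂ) B Polynomial.X = x 0 := Polynomial.aeval_X _
  rw [isTriangular_iff (fun c z => Algebra.smul_def c z)] at htri
  obtain ⟨v, hv⟩ := htri
  obtain ⟨C, _, _, _, _, β, w, hw, hβ, hCl, hCe⟩ := exists_pushout (H := H) v
  set z : H := algebraMap ℂ H lam * y ^ (m + 1) - t * ∏ i, xH i with hz
  have hz' : ∀ i, z - algebraMap (Polynomial ℂ) H (Polynomial.C (q i) * Polynomial.X ^ (m + 1)) =
      algebraMap ℂ H (lam - q i) * y ^ (m + 1) - t * ∏ i, xH i := by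
    intro i
    have h1 : algebraMap (Polynomial ℂ) H (Polynomial.C (q i)) = algebraMap ℂ H (q i) :=
      (IsScalarTower.algebraMap_apply ℂ (Polynomial ℂ) H (q i)).symm
    rw [map_mul, map_pow, hy, h1, hz, map_sub]
    ring
  have hT := isTriangular_quotient_pushout hv (β := (β : B →+* C)) hw hβ z
    (fun i => by rw [hz' i]; exact hreg _ (hq i))
    (E := fun i j => Polynomial.C (D (lam - q i) j) * Polynomial.X ^ (m + 1))
    (fun i => by rw [hz' i]; exact hE _ (hq i))
  let I : Ideal C := Ideal.span {algebraMap H C z - β (pathEdge m n x)}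
  let π : C →ₐ[ℂ] C ⧸ I := Ideal.Quotient.mkₐ ℂ I
  have hπ : Function.Surjective π := Ideal.Quotient.mkₐ_surjective ℂ I
  let α₀ : H →ₐ[ℂ] C := IsScalarTower.toAlgHom ℂ H C
  have hα₀ : ∀ a, α₀ a = algebraMap H C a := fun a => rfl
  have hrel : π (α₀ z) = π (β (pathEdge m n x)) :=
    Ideal.Quotient.eq.2 (Ideal.subset_span rfl)
  have hpush : ∀ (S : Type) [CommRing S] [Algebra ℂ S] (f : H →ₐ[ℂ] S) (g : B →ₐ[ℂ] S),
      f y = g (x 0) → algebraMap ℂ S lam * f y ^ (m + 1) =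
        f t * ∏ j, f (xH j) + g (pathEdge m n x) →
        ∃ F : C ⧸ I →ₐ[ℂ] S, (∀ a, F (π (α₀ a)) = f a) ∧ ∀ b, F (π (β b)) = g b := by
    intro S _ _ f g hfg hr
    obtain ⟨F, hF, hF'⟩ := hCl S f g (by rw [hy, hBX, hfg])
    refine ⟨Ideal.Quotient.liftₐ I F fun c hc => ?_, fun a => hF a, fun b => hF' b⟩
    obtain ⟨c, rfl⟩ := Ideal.mem_span_singleton'.1 hc
    rw [map_mul, map_sub, hF, hF', hz]
    simp only [map_sub, map_mul, map_pow, map_prod, AlgHom.commutes]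
    rw [hr]
    ring
  have hαβ : α₀ y = β (x 0) := by rw [hα₀, ← hy, ← hβ, hBX]
  obtain ⟨x', hx', hx0, hedge⟩ := hB.succ hlam hpow hlift hext (π.comp α₀) (π.comp β)
    (congrArg π hαβ)
    (by
      have h1 : π (α₀ z) = algebraMap ℂ _ lam * π (α₀ y) ^ (m + 1) -
          π (α₀ t) * ∏ j, π (α₀ (xH j)) := by
        rw [hz]
        simp only [map_sub, map_mul, map_pow, map_prod, AlgHom.commutes]
      rw [h1] at hrel
      simp only [AlgHom.comp_apply]
      linear_combination hrel)
    hpush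
    (by
      intro S _ _ F G h1 h2
      have h3 : F.comp π = G.comp π := hCe S _ _ h1 h2
      ext c
      obtain ⟨c, rfl⟩ := hπ c
      exact DFunLike.congr_fun h3 c)
  refine ⟨C ⧸ I, inferInstance, inferInstance, x', hx', ?_⟩
  have hφ : (Polynomial.aeval (R := ℂ) (x' 0)).toRingHom =
      (algebraMap H (C ⧸ I)).comp (Polynomial.aeval (R := ℂ) t).toRingHom := by
    have h1 : Polynomial.aeval (R := ℂ) (x' 0) = (π.comp α₀).comp (Polynomial.aeval t) := by
      refine Polynomial.algHom_ext ?_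
      rw [Polynomial.aeval_X, hx0, AlgHom.comp_apply _ (Polynomial.aeval t), Polynomial.aeval_X]
    rw [h1]
    rfl
  rw [hφ, hedge]
  exact hT

theorem aseq_succ {k : ℕ} {lam : ℂ} (hlam : lam ≠ 0) (i : ℕ) :
    aseq k lam (i + 1) = lam ^ k / (lam ^ k - aseq k lam i) := by
  cases i with
  | zero => simp [aseq, hlam]
  | succ i => rfl

theorem lam_sub_aseq {m : ℕ} {lam : ℂ} (hlam : lam ≠ 0) (s : ℕ) :
    lam - aseq (m + 2) lam s / lam ^ (m + 1) =
      (lam ^ (m + 2) - aseq (m + 2) lam s) / lam ^ (m + 1) := by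
  rw [sub_div, pow_succ lam (m + 1), mul_div_assoc, mul_comm,
    div_mul_cancel₀ _ (pow_ne_zero _ hlam)]

theorem aseq_succ_div {m : ℕ} {lam : ℂ} (hlam : lam ≠ 0) (s : ℕ) :
    (lam - aseq (m + 2) lam s / lam ^ (m + 1))⁻¹ * lam⁻¹ ^ m =
      aseq (m + 2) lam (s + 1) / lam ^ (m + 1) := by
  rw [lam_sub_aseq hlam, aseq_succ hlam]
  by_cases h : lam ^ (m + 2) - aseq (m + 2) lam s = 0
  · simp [h]
  · rw [inv_pow]
    field_simp
    ring

theorem muPath_succ_succ (n m s : ℕ) :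
    muPath (n + 1) (m + 2) (s + 1) = (m + 2) ^ m * muPath n (m + 2) s := by
  unfold muPath
  have h : n + 1 - (s + 1) - 1 = n - s - 1 := by omega
  simp only [Nat.add_right_cancel_iff, h, Nat.add_sub_cancel]
  split_ifs <;> ring

theorem muPath_succ_zero (n m : ℕ) :
    muPath (n + 1) (m + 2) 0 =
      ((m + 1) ^ (m + 1) - (m + 2) ^ m) * ((m + 1) ^ (m + 1)) ^ n := by
  simp [muPath, ← pow_mul, mul_comm]

theorem EdgeAlgebra.prod_diagonal (m : ℕ) (F : ℂ → ℂ) (q : ℂ) :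
    ∏ j, F (EdgeAlgebra.diagonal m q j) =
      F q ^ (m + 2) ^ m * F 0 ^ ((m + 1) ^ (m + 1) - (m + 2) ^ m) := by
  rw [← Equiv.prod_comp toLex, Fintype.prod_sum_type]
  simp [EdgeAlgebra.diagonal]

/-- The path algebra exists, and its edge product acts triangularly over `ℂ[x_0]`, with diagonal
entries `(a_{s-1} / λ ^ (k - 1)) x_0 ^ (k - 1)` of multiplicity `μ_{n,k}(s)`. -/
theorem exists_pathAlgebra (m : ℕ) {lam : ℂ} (hlam : lam ≠ 0) (n : ℕ)
    (hden : ∀ i < n, lam ^ (m + 2) - aseq (m + 2) lam i ≠ 0) :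
    ∃ (B : Type) (_ : CommRing B) (_ : Algebra ℂ B) (x : ℕ → B) (ι : Type) (_ : LinearOrder ι)
      (_ : Fintype ι) (q : ι → ℂ), IsPathAlgebra m lam n B x ∧
      IsTriangular (Polynomial.aeval (R := ℂ) (x 0)).toRingHom (pathEdge m n x) B
        (fun i => Polynomial.C (q i) * Polynomial.X ^ (m + 1)) ∧
      (∀ i, ∃ s ≤ n, q i = aseq (m + 2) lam s / lam ^ (m + 1)) ∧
      Fintype.card ι = ((m + 1) ^ (m + 1)) ^ n ∧
      ∀ F : ℂ → ℂ, ∏ i, F (q i) = ∏ s ∈ range (n + 1),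
        F (aseq (m + 2) lam s / lam ^ (m + 1)) ^ muPath n (m + 2) s := by
  induction n with
  | zero =>
    refine ⟨Polynomial ℂ, inferInstance, inferInstance, fun _ => Polynomial.X, Fin 1,
      inferInstance, inferInstance, fun _ => 0, isPathAlgebra_zero m lam, isTriangular_zero m,
      fun i => ⟨0, le_rfl, by simp [aseq]⟩, by simp, fun F => by simp [aseq, muPath]⟩
  | succ n ih =>
    obtain ⟨B, _, _, x, ι, _, _, q, hB, htri, hq, hcard, hprod⟩ :=
      ih fun i hi => hden i (Nat.lt_succ_of_lt hi)
    have hne : ∀ i, lam - q i ≠ 0 := by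
      intro i
      obtain ⟨s, hs, hqs⟩ := hq i
      rw [hqs, lam_sub_aseq hlam]
      exact div_ne_zero (hden s (Nat.lt_succ_of_le hs)) (pow_ne_zero _ hlam)
    have : IsScalarTower ℂ (Polynomial ℂ) (HubAlgebra m lam) :=
      IsScalarTower.of_algebraMap_eq fun c => rfl
    obtain ⟨B', _, _, x', hB', htri'⟩ := hB.exists_succ hlam (H := HubAlgebra m lam) hne htri
      (xH := HubAlgebra.x m lam) (y := HubAlgebra.y m lam) (t := HubAlgebra.t m lam) rfl
      HubAlgebra.x_pow (fun S _ _ η τ s h => HubAlgebra.exists_lift η τ s h)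
      (fun S _ _ f g h hy ht => HubAlgebra.hom_ext h hy ht)
      (fun b hb => HubAlgebra.mul_left_injective hb)
      (D := fun b => EdgeAlgebra.diagonal m (b⁻¹ * lam⁻¹ ^ m))
      (fun b hb => HubAlgebra.isTriangular_quotient hb hlam)
    have hle : (m + 2) ^ m ≤ (m + 1) ^ (m + 1) :=
      (EdgeAlgebra.isTriangular (m := m) (a := fun _ => 1) fun _ => one_ne_zero).1
    refine ⟨B', inferInstance, inferInstance, x', _, inferInstance, inferInstance, _, hB', htri',
      fun z => ?_, ?_, fun F => ?_⟩
    · obtain ⟨s, hs, hqs⟩ := hq (ofLex z).1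
      unfold EdgeAlgebra.diagonal
      rcases ofLex (ofLex z).2 with j | j
      · exact ⟨s + 1, Nat.succ_le_succ hs, by rw [Sum.elim_inl, hqs, aseq_succ_div hlam]⟩
      · exact ⟨0, Nat.zero_le _, by simp [aseq]⟩
    · rw [Fintype.card_lex, Fintype.card_prod, Fintype.card_lex, Fintype.card_sum,
        Fintype.card_fin, Fintype.card_fin, hcard, Nat.add_sub_cancel' hle, ← pow_succ]
    · rw [← Equiv.prod_comp toLex, Fintype.prod_prod_type]
      simp only [ofLex_toLex, EdgeAlgebra.prod_diagonal]
      rw [Finset.prod_mul_distrib,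
        hprod fun c => F ((lam - c)⁻¹ * lam⁻¹ ^ m) ^ (m + 2) ^ m, Finset.prod_const,
        Finset.prod_range_succ' _ (n + 1), muPath_succ_zero, Finset.card_univ, hcard]
      simp only [aseq_succ_div hlam, muPath_succ_succ, ← pow_mul]
      simp [aseq]

theorem pathRel_iff {m n : ℕ} {lam : ℂ} {S : Type*} [CommRing S] [Algebra ℂ S] {s : ℕ → S} :
    PathRel m lam n s ↔ ∀ T < n,
      (∀ i : Fin m, algebraMap ℂ S lam * s (T * (m + 1) + (i + 1)) ^ (m + 1) =
        s (T * (m + 1) + 0) * s (T * (m + 1) + (m + 1)) *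
          ∏ j ∈ univ.erase i, s (T * (m + 1) + (j + 1))) ∧
      algebraMap ℂ S lam * s (T * (m + 1) + (m + 1)) ^ (m + 1) =
        s (T * (m + 1) + 0) * ∏ j : Fin m, s (T * (m + 1) + (j + 1)) +
          if T + 1 < n then (∏ j : Fin m, s ((T + 1) * (m + 1) + (j + 1))) *
            s ((T + 1) * (m + 1) + (m + 1)) else 0 := by
  induction n generalizing s with
  | zero => simp [PathRel]
  | succ n ih =>
    have hshift : ∀ T v, s ((T + 1) * (m + 1) + v) = s (T * (m + 1) + v + (m + 1)) :=
      fun T v => congrArg s (by ring)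
    have hedge : (if 0 + 1 < n + 1 then (∏ j : Fin m, s ((0 + 1) * (m + 1) + (j + 1))) *
        s ((0 + 1) * (m + 1) + (m + 1)) else 0) = pathEdge m n fun v => s (v + (m + 1)) := by
      unfold pathEdge
      rcases Nat.eq_zero_or_pos n with rfl | hn
      · simp
      · rw [if_pos (by omega), if_neg (by omega), hshift]
        simp only [hshift, zero_mul, zero_add]
    rw [Nat.forall_lt_succ_left, hedge, PathRel, ih]
    simp only [zero_mul, zero_add, Nat.add_lt_add_iff_right, hshift, and_assoc]

theorem prod_Icc_edge {S : Type*} [CommMonoid S] (m a : ℕ) (g : ℕ → S) :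
    ∏ u ∈ Icc a (a + (m + 1)), g u = g (a + 0) * (∏ j : Fin m, g (a + (j + 1))) *
      g (a + (m + 1)) := by
  have h : Icc a (a + (m + 1)) = Ico a (a + (m + 2)) := by
    ext u
    simp only [mem_Icc, mem_Ico]
    omega
  rw [h, Finset.prod_Ico_eq_prod_range, Nat.add_sub_cancel_left, Finset.prod_range_succ,
    Finset.prod_range_succ', Finset.prod_range, mul_comm (g (a + 0))]

theorem prod_erase_eq_ite {α S : Type*} [CommMonoid S] [DecidableEq α] (A : Finset α) (v : α)
    (s : α → S) : ∏ u ∈ A.erase v, s u = ∏ u ∈ A, if u = v then 1 else s u := by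
  rw [← Finset.prod_erase A (a := v) (f := fun u => if u = v then 1 else s u) (if_pos rfl)]
  exact Finset.prod_congr rfl fun u hu => (if_neg (Finset.ne_of_mem_erase hu)).symm

theorem filter_inEdge_inner {m n T i : ℕ} (hT : T < n) (hi : i < m) :
    (Icc 1 n).filter (fun t => inEdge (m + 2) t (T * (m + 1) + (i + 1))) = {T + 1} := by
  ext t
  simp only [mem_filter, mem_Icc, inEdge, mem_singleton, show m + 2 - 1 = m + 1 from rfl]
  constructor
  · rintro ⟨⟨h1, h2⟩, h3, h4⟩
    obtain ⟨t, rfl⟩ := Nat.exists_eq_add_of_le' h1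
    rw [Nat.add_sub_cancel] at h3
    rcases lt_trichotomy t T with h | h | h
    · have := Nat.mul_le_mul_right (m + 1) (Nat.succ_le_of_lt h)
      simp only [Nat.succ_eq_add_one] at this
      omega
    · rw [h]
    · have := Nat.mul_le_mul_right (m + 1) (Nat.succ_le_of_lt h)
      simp only [Nat.succ_eq_add_one, Nat.succ_mul T] at this
      omega
  · rintro rfl
    rw [Nat.add_sub_cancel, Nat.succ_mul]
    omega

theorem filter_inEdge_outer {m n T : ℕ} (hT : T < n) :
    (Icc 1 n).filter (fun t => inEdge (m + 2) t (T * (m + 1) + (m + 1))) =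
      if T + 1 < n then {T + 1, T + 2} else {T + 1} := by
  have hmem : ∀ t, t ∈ (Icc 1 n).filter
      (fun t => inEdge (m + 2) t (T * (m + 1) + (m + 1))) ↔ t ≤ n ∧ (t = T + 1 ∨ t = T + 2) := by
    intro t
    simp only [mem_filter, mem_Icc, inEdge, show m + 2 - 1 = m + 1 from rfl, ← Nat.succ_mul]
    rw [Nat.mul_le_mul_right_iff (Nat.succ_pos m), Nat.mul_le_mul_right_iff (Nat.succ_pos m)]
    omega
  ext t
  rw [hmem]
  split_ifs <;> simp only [mem_insert, mem_singleton] <;> omega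

/-- The homogenized equations in terms of vertices. -/
theorem pathRel_iff_vertex {m n : ℕ} {lam : ℂ} {S : Type*} [CommRing S] [Algebra ℂ S]
    {s : ℕ → S} : PathRel m lam n s ↔ ∀ v < n * (m + 1),
      algebraMap ℂ S lam * s (v + 1) ^ (m + 1) =
        ∑ t ∈ (Icc 1 n).filter (fun t => inEdge (m + 2) t (v + 1)),
          ∏ u ∈ Icc ((t - 1) * (m + 1)) (t * (m + 1)), if u = v + 1 then 1 else s u := by
  have hinner : ∀ T < n, ∀ i : Fin m,
      ∑ t ∈ (Icc 1 n).filter (fun t => inEdge (m + 2) t (T * (m + 1) + (i + 1))),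
        ∏ u ∈ Icc ((t - 1) * (m + 1)) (t * (m + 1)),
          (if u = T * (m + 1) + (i + 1) then 1 else s u) =
      s (T * (m + 1) + 0) * s (T * (m + 1) + (m + 1)) *
        ∏ j ∈ univ.erase i, s (T * (m + 1) + (j + 1)) := by
    intro T hT i
    have hi := i.2
    rw [filter_inEdge_inner hT i.2, sum_singleton, Nat.add_sub_cancel, Nat.succ_mul,
      prod_Icc_edge, if_neg (by omega), if_neg (by omega), prod_erase_eq_ite]
    simp only [Nat.add_right_inj, Nat.add_right_cancel_iff, Fin.val_inj]
    ring
  have houter : ∀ T < n,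
      ∑ t ∈ (Icc 1 n).filter (fun t => inEdge (m + 2) t (T * (m + 1) + (m + 1))),
        ∏ u ∈ Icc ((t - 1) * (m + 1)) (t * (m + 1)),
          (if u = T * (m + 1) + (m + 1) then 1 else s u) =
      s (T * (m + 1) + 0) * ∏ j : Fin m, s (T * (m + 1) + (j + 1)) +
          if T + 1 < n then (∏ j : Fin m, s ((T + 1) * (m + 1) + (j + 1))) *
            s ((T + 1) * (m + 1) + (m + 1)) else 0 := by
    intro T hT
    have h1 : ∏ u ∈ Icc ((T + 1 - 1) * (m + 1)) ((T + 1) * (m + 1)),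
        (if u = T * (m + 1) + (m + 1) then 1 else s u) =
        s (T * (m + 1) + 0) * ∏ j : Fin m, s (T * (m + 1) + (j + 1)) := by
      rw [Nat.add_sub_cancel, Nat.succ_mul, prod_Icc_edge, if_neg (by omega), if_pos rfl, mul_one]
      exact congrArg _ (prod_congr rfl fun j _ => if_neg (by have := j.2; omega))
    have hT' : T * (m + 1) + (m + 1) = (T + 1) * (m + 1) := (Nat.succ_mul T (m + 1)).symm
    have h2 : ∏ u ∈ Icc ((T + 2 - 1) * (m + 1)) ((T + 2) * (m + 1)),
        (if u = T * (m + 1) + (m + 1) then 1 else s u) =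
        (∏ j : Fin m, s ((T + 1) * (m + 1) + (j + 1))) * s ((T + 1) * (m + 1) + (m + 1)) := by
      rw [show T + 2 - 1 = T + 1 from rfl, show T + 2 = (T + 1) + 1 from rfl,
        Nat.succ_mul (T + 1), prod_Icc_edge, hT', if_pos (Nat.add_zero _),
        if_neg (by omega), one_mul]
      exact congrArg (· * _) (prod_congr rfl fun j _ => if_neg (by omega))
    rw [filter_inEdge_outer hT]
    split_ifs with h
    · rw [sum_pair (by omega), h1, h2]
    · rw [sum_singleton, h1]
      exact (add_zero _).symm
  rw [pathRel_iff]
  constructor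
  · intro h v hv
    have hT : v / (m + 1) < n := Nat.div_lt_of_lt_mul (by rwa [mul_comm])
    have hv' : v / (m + 1) * (m + 1) + v % (m + 1) = v := Nat.div_add_mod' v (m + 1)
    have hr : v % (m + 1) < m + 1 := Nat.mod_lt _ (Nat.succ_pos m)
    rcases Nat.lt_or_ge (v % (m + 1)) m with hr' | hr'
    · have h1 : v + 1 = v / (m + 1) * (m + 1) + (((⟨v % (m + 1), hr'⟩ : Fin m) : ℕ) + 1) := by
        simp only
        omega
      rw [h1, hinner _ hT]
      exact (h _ hT).1 _
    · have h1 : v + 1 = v / (m + 1) * (m + 1) + (m + 1) := by omega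
      rw [h1, houter _ hT]
      exact (h _ hT).2
  · intro h T hT
    have hb := Nat.mul_le_mul_right (m + 1) (Nat.succ_le_of_lt hT)
    simp only [Nat.succ_eq_add_one, Nat.succ_mul T] at hb
    refine ⟨fun i => ?_, ?_⟩
    · rw [← hinner T hT]
      exact h (T * (m + 1) + i) (by have := i.2; omega)
    · rw [← houter T hT]
      exact h (T * (m + 1) + m) (by omega)

theorem prod_filter_fin {S : Type*} [CommMonoid S] (N : ℕ) (P : ℕ → Prop) [DecidablePred P]
    (g : ℕ → S) : ∏ u ∈ univ.filter (fun u : Fin N => P (u + 1)), g (u + 1) =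
      ∏ v ∈ (Icc 1 N).filter P, g v := by
  have h : Icc 1 N = Ico 1 (N + 1) := by
    ext u
    simp only [mem_Icc, mem_Ico]
    omega
  rw [Finset.prod_filter, Finset.prod_filter, Fin.prod_univ_eq_prod_range
    (fun u => if P (u + 1) then g (u + 1) else 1), h, Finset.prod_Ico_eq_prod_range]
  simp [add_comm]

theorem aeval_fpoly {m n : ℕ} {lam : ℂ} {S : Type*} [CommRing S] [Algebra ℂ S]
    {s : ℕ → S} (hs : s 0 = 1) (v : Fin (n * (m + 1))) :
    aeval (fun u : Fin (n * (m + 1)) => s (u + 1)) (fpoly (m + 2) n lam v) =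
      algebraMap ℂ S lam * s (v + 1) ^ (m + 1) -
        ∑ t ∈ (Icc 1 n).filter (fun t => inEdge (m + 2) t (v + 1)),
          ∏ u ∈ Icc ((t - 1) * (m + 1)) (t * (m + 1)), if u = v + 1 then 1 else s u := by
  have hk : m + 2 - 1 = m + 1 := rfl
  unfold fpoly
  rw [map_sub, map_mul, map_pow, map_sum, aeval_X]
  refine congrArg₂ _ (congrArg (· * _) (algHom_C _ _)) (sum_congr rfl fun t ht => ?_)
  rw [map_prod]
  simp only [aeval_X]
  refine (prod_erase_eq_ite _ v fun u : Fin (n * (m + 1)) => s (u + 1)).trans ?_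
  have h1 : ∀ u : Fin (n * (m + 1)), (if u = v then 1 else s (u + 1)) =
      (fun w => if w = (v : ℕ) + 1 then 1 else s w) (u + 1) := by
    intro u
    simp [Fin.ext_iff]
  refine (prod_congr rfl fun u _ => h1 u).trans ?_
  refine (prod_filter_fin (n * (m + 1)) (inEdge (m + 2) t)
    (fun w => if w = (v : ℕ) + 1 then 1 else s w)).trans ?_
  have h2 : (Icc 1 (n * (m + 1))).filter (inEdge (m + 2) t) =
      (Icc ((t - 1) * (m + 1)) (t * (m + 1))).erase 0 := by
    have h3 : t * (m + 1) ≤ n * (m + 1) :=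
      Nat.mul_le_mul_right _ (mem_Icc.1 (mem_filter.1 ht).1).2
    ext u
    simp only [mem_filter, mem_Icc, mem_erase, inEdge, hk]
    omega
  rw [h2]
  refine prod_erase _ ?_
  simp [hs]

/-- Setting the initial variable of a path algebra to `1` yields the quotient by `pathIdeal`. -/
theorem IsPathAlgebra.exists_specialization {m n : ℕ} {lam : ℂ} {B : Type} [CommRing B]
    [Algebra ℂ B] {x : ℕ → B} (hB : IsPathAlgebra m lam n B x) :
    ∃ ρ : B →ₐ[ℂ] MvPolynomial (Fin (n * (m + 1))) ℂ ⧸ pathIdeal (m + 2) n lam,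
      Function.Surjective ρ ∧ (∀ b, ρ b = 0 ↔ ∃ c, b = (x 0 - 1) * c) ∧
      ∀ u : Fin (n * (m + 1)), ρ (x (u + 1)) = Ideal.Quotient.mk _ (X u) := by
  let J : Ideal (MvPolynomial (Fin (n * (m + 1))) ℂ) := pathIdeal (m + 2) n lam
  let τ : MvPolynomial (Fin (n * (m + 1))) ℂ →ₐ[ℂ] MvPolynomial (Fin (n * (m + 1))) ℂ ⧸ J :=
    Ideal.Quotient.mkₐ ℂ J
  let s : ℕ → MvPolynomial (Fin (n * (m + 1))) ℂ ⧸ J := fun v =>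
    if v = 0 then 1 else if h : v - 1 < n * (m + 1) then τ (X ⟨v - 1, h⟩) else 0
  have hs0 : s 0 = 1 := rfl
  have hsX : ∀ u : Fin (n * (m + 1)), s (u + 1) = τ (X u) := fun u => by simp [s]
  have hτ : aeval (fun u : Fin (n * (m + 1)) => s (u + 1)) = τ :=
    MvPolynomial.algHom_ext fun u => by rw [aeval_X, hsX]
  have hs : PathRel m lam n s := by
    rw [pathRel_iff_vertex]
    intro v hv
    have h1 := aeval_fpoly (lam := lam) hs0 ⟨v, hv⟩
    rw [hτ] at h1
    have h2 : τ (fpoly (m + 2) n lam ⟨v, hv⟩) = 0 :=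
      Ideal.Quotient.eq_zero_iff_mem.2 (Ideal.subset_span ⟨⟨v, hv⟩, rfl⟩)
    rw [h2] at h1
    exact sub_eq_zero.1 h1.symm
  obtain ⟨ρ, hρ⟩ := hB.lift _ s hs
  have hρ0 : ρ (x 0) = 1 := (hρ 0 (Nat.zero_le _)).trans hs0
  have hρX : ∀ u : Fin (n * (m + 1)), ρ (x (u + 1)) = τ (X u) := fun u =>
    (hρ _ u.2).trans (hsX u)
  have hρτ : ρ.comp (aeval fun u : Fin (n * (m + 1)) => x (u + 1)) = τ :=
    MvPolynomial.algHom_ext fun u => by rw [AlgHom.comp_apply, aeval_X, hρX]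
  refine ⟨ρ, fun a => ?_, fun b => ⟨fun hb => ?_, ?_⟩, hρX⟩
  · obtain ⟨p, rfl⟩ := Ideal.Quotient.mkₐ_surjective ℂ J a
    exact ⟨_, DFunLike.congr_fun hρτ p⟩
  · let I : Ideal B := Ideal.span {x 0 - 1}
    let π : B →ₐ[ℂ] B ⧸ I := Ideal.Quotient.mkₐ ℂ I
    have hπ0 : π (x 0) = 1 := Ideal.Quotient.eq.2 (Ideal.subset_span rfl)
    let γ : MvPolynomial (Fin (n * (m + 1))) ℂ →ₐ[ℂ] B ⧸ I :=
      aeval fun u : Fin (n * (m + 1)) => π (x (u + 1))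
    have hγ : ∀ p ∈ J, γ p = 0 := by
      have hle : J ≤ RingHom.ker γ := by
        refine Ideal.span_le.2 ?_
        rintro _ ⟨v, rfl⟩
        refine (aeval_fpoly (s := fun w => π (x w)) hπ0 v).trans ?_
        exact sub_eq_zero.2 (pathRel_iff_vertex.1 (hB.rel.map π) v v.2)
      exact fun p hp => hle hp
    let G : MvPolynomial (Fin (n * (m + 1))) ℂ ⧸ J →ₐ[ℂ] B ⧸ I := Ideal.Quotient.liftₐ J γ hγ
    have hGτ : ∀ p, G (τ p) = γ p := fun p => rfl
    have hG : G.comp ρ = π := by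
      refine hB.ext _ _ _ fun v hv => ?_
      rw [AlgHom.comp_apply]
      rcases v with _ | v
      · rw [hρ0, map_one, hπ0]
      · have h1 := hρX ⟨v, hv⟩
        simp only at h1
        rw [h1, hGτ]
        exact aeval_X _ _
    have hπb : π b = 0 := by rw [← hG, AlgHom.comp_apply, hb, map_zero]
    obtain ⟨c, hc⟩ := Ideal.mem_span_singleton'.1 (Ideal.Quotient.eq_zero_iff_mem.1 hπb)
    exact ⟨c, by rw [← hc, mul_comm]⟩
  · rintro ⟨c, rfl⟩
    rw [map_mul, map_sub, hρ0, map_one, sub_self, zero_mul]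

theorem map_pathEdge_eq_prod {m n : ℕ} (hn : 1 ≤ n) {B A : Type*} [CommRing B] [CommRing A]
    {x : ℕ → B} {ρ : B →+* A} {z : Fin (n * (m + 1)) → A}
    (hρ : ∀ u : Fin (n * (m + 1)), ρ (x (u + 1)) = z u) :
    ρ (pathEdge m n x) =
      ∏ u ∈ univ.filter (fun u : Fin (n * (m + 1)) => u.val + 1 ≤ m + 1), z u := by
  have hN : m + 1 ≤ n * (m + 1) := Nat.le_mul_of_pos_left _ hn
  have h : (Icc 1 (n * (m + 1))).filter (· ≤ m + 1) = Ico 1 (m + 2) := by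
    ext v
    simp only [mem_filter, mem_Icc, mem_Ico]
    omega
  simp only [← hρ]
  rw [prod_filter_fin (n * (m + 1)) (· ≤ m + 1) fun v => ρ (x v), h, prod_Ico_eq_prod_range,
    show m + 2 - 1 = m + 1 from rfl, prod_range_succ, prod_range, pathEdge_map, pathEdge,
    if_neg (by omega)]
  simp only [add_comm]

/-- For `λ ≠ 0` with `λ^k - a_{i-1} ≠ 0` for all `0 ≤ i ≤ n`, and `A` finite
dimensional over `ℂ`: the determinant of multiplication by
`λ - x_1·x_2⋯x_{k-1}` on `A = ℂ[x_1,…,x_r]/⟨f_1,…,f_r⟩` equals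
`∏_{s=0}^{n} (λ - a_{s-1}/λ^{k-1})^{μ_{n,k}(s)}`. -/
theorem hyperpath_multiplication_det (k n : ℕ) (hk : 3 ≤ k) (hn : 1 ≤ n)
    (lam : ℂ) (hlam : lam ≠ 0)
    (hden : ∀ i ≤ n, lam ^ k - aseq k lam i ≠ 0)
    (hfin : FiniteDimensional ℂ
      (MvPolynomial (Fin (n * (k - 1))) ℂ ⧸ pathIdeal k n lam)) :
    LinearMap.det (LinearMap.mulLeft ℂ
        (Ideal.Quotient.mk (pathIdeal k n lam)
          (C lam - ∏ u ∈ Finset.univ.filter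
              (fun u : Fin (n * (k - 1)) => u.val + 1 ≤ k - 1), X u))) =
      ∏ s ∈ Finset.range (n + 1),
        (lam - aseq k lam s / lam ^ (k - 1)) ^ (muPath n k s) := by
  obtain ⟨m, rfl⟩ : ∃ m, k = m + 2 := Nat.exists_eq_add_of_le' (by omega)
  obtain ⟨B, _, _, x, ι, _, _, q, hB, htri, -, -, hprod⟩ :=
    exists_pathAlgebra m hlam n fun i hi => hden i hi.le
  obtain ⟨ρ, hρ, hker, hρX⟩ := hB.exists_specialization
  have hρedge : ρ (pathEdge m n x) = Ideal.Quotient.mk (pathIdeal (m + 2) n lam)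
      (∏ u ∈ univ.filter (fun u : Fin (n * (m + 2 - 1)) => u.val + 1 ≤ m + 2 - 1), X u) := by
    rw [map_prod]
    exact map_pathEdge_eq_prod hn (ρ := ρ.toRingHom) hρX
  have hdet := (htri.specialize ρ hρ hker).det_mulLeft_sub lam
  rw [hρedge] at hdet
  simp only [Polynomial.eval_mul, Polynomial.eval_C, Polynomial.eval_pow, Polynomial.eval_X,
    one_pow, mul_one] at hdet
  rw [hprod fun c => lam - c] at hdet
  exact hdet
end
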